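/- (Compactness under a uniform weighted pointwise bound.) Let n ≥ 3 be an integer, let Ω ⊂ ℝⁿ be a smooth bounded domain with 0 ∈ Ω, let 0 < s < 2, γ < (n−2)²/4, and write 2⋆(s) = 2(n−s)/(n−2). Let h ∈ C¹(Ω̄\{0}) satisfy, for some 0 ≤ θ < 2 and c ∈ ℝ, lim_{x→0}|x|^θ h(x) = c and lim_{x→0}|x|^θ⟨x,∇h(x)⟩ = −cθ, with −Δ − γ/|x|² − h coercive on Ω; let b ∈ C¹(Ω̄) be nonnegative with b(0) > 0 and ∇b(0) = 0. Let p_ε ∈ [0, 2⋆(s)−2) with p_ε → 0 as ε → 0, and for each ε > 0 let u_ε be a classical solution of −Δu_ε − γu_ε/|x|² − h u_ε = b(x)|u_ε|^{2⋆(s)−2−p_ε}u_ε/|x|^s in Ω with u_ε = 0 on ∂Ω, such that sup_ε ∫_Ω |∇u_ε|² dx < ∞. Fix τ with β₋(γ) < τ < (n−2)/2 and suppose there exists C > 0 such that |x|^τ |u_ε(x)| ≤ C for all ε > 0 and all x ∈ Ω\{0}. Then there exist a sequence ε_k → 0 and a classical solution u₀ of −Δu₀ − γu₀/|x|² − h u₀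 = b(x)|u₀|^{2⋆(s)−2}u₀/|x|^s in Ω with u₀ = 0 on ∂Ω such that ∫_Ω |∇(u_{ε_k} − u₀)|² dx → 0. -/

import Mathlib

open Real Filter Set MeasureTheory

/-- The Euclidean Laplacian of `u : ℝⁿ → ℝ` at `x`, as the trace of the second derivative. -/
noncomputable def lap (n : ℕ) (u : EuclideanSpace ℝ (Fin n) → ℝ)
    (x : EuclideanSpace ℝ (Fin n)) : ℝ :=
  ∑ i : Fin n,
    fderiv ℝ (fun y => fderiv ℝ u y (EuclideanSpace.single i 1)) x (EuclideanSpace.single i 1)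

/-- A smooth bounded domain in `ℝⁿ`. -/
def SmoothDomain {n : ℕ} (Ω : Set (EuclideanSpace ℝ (Fin n))) : Prop :=
  IsOpen Ω ∧ Bornology.IsBounded Ω ∧
    ∀ x ∈ frontier Ω, ∃ (U : Set (EuclideanSpace ℝ (Fin n)))
      (φ : EuclideanSpace ℝ (Fin n) → ℝ), IsOpen U ∧ x ∈ U ∧ ContDiff ℝ (⊤ : ℕ∞) φ ∧
        (∀ y ∈ U, fderiv ℝ φ y ≠ 0) ∧ Ω ∩ U = {y ∈ U | φ y < 0}

/-- Coercivity of the operator `−Δ − γ/|x|² − h` on `Ω`. -/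
def CoerciveOn {n : ℕ} (Ω : Set (EuclideanSpace ℝ (Fin n))) (γ : ℝ)
    (h : EuclideanSpace ℝ (Fin n) → ℝ) : Prop :=
  ∃ Λ > (0 : ℝ), ∀ φ : EuclideanSpace ℝ (Fin n) → ℝ,
    ContDiff ℝ (⊤ : ℕ∞) φ → HasCompactSupport φ → tsupport φ ⊆ Ω →
      Λ * ∫ x in Ω, ‖fderiv ℝ φ x‖ ^ 2 ≤
        (∫ x in Ω, ‖fderiv ℝ φ x‖ ^ 2) - γ * (∫ x in Ω, φ x ^ 2 / ‖x‖ ^ 2)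
          - ∫ x in Ω, h x * φ x ^ 2

/-- A classical solution `u ∈ C⁰(Ω̄) ∩ C²(Ω̄\{0})` with finite energy, vanishing on `∂Ω`, of
`−Δu − γu/|x|² − hu = b(x)|u|^{q−2}u/|x|^s` on `Ω\{0}`. -/
def ClassicalSolution {n : ℕ} (Ω : Set (EuclideanSpace ℝ (Fin n))) (γ : ℝ)
    (h b : EuclideanSpace ℝ (Fin n) → ℝ) (q s : ℝ)
    (u : EuclideanSpace ℝ (Fin n) → ℝ) : Prop :=
  ContinuousOn u (closure Ω) ∧ ContDiffOn ℝ 2 u (closure Ω \ {0}) ∧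
  IntegrableOn (fun x => ‖fderiv ℝ u x‖ ^ 2) Ω ∧
  (∀ x ∈ frontier Ω, u x = 0) ∧
  ∀ x ∈ Ω \ {0},
    -lap n u x - γ * u x / ‖x‖ ^ 2 - h x * u x = b x * |u x| ^ (q - 2) * u x / ‖x‖ ^ s

section Basics

/-- The Euclidean space of dimension `n`. -/
abbrev Eucl (n : ℕ) := EuclideanSpace ℝ (Fin n)

variable {n : ℕ}

/-- The `i`-th vector of the standard basis. -/
noncomputable abbrev bvec (i : Fin n) : Eucl n := EuclideanSpace.single i 1

/-- The Laplacian as the trace of the iterated Fréchet derivative. -/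
noncomputable def lapl (u : Eucl n → ℝ) (x : Eucl n) : ℝ :=
  ∑ i, fderiv ℝ (fderiv ℝ u) x (bvec i) (bvec i)

lemma norm_bvec (i : Fin n) : ‖bvec i‖ = 1 := by simp [bvec]

lemma sum_coord (x : Eucl n) : ∑ i, x i • bvec i = x := by
  simpa [bvec] using (EuclideanSpace.basisFun (Fin n) ℝ).sum_repr x

lemma inner_bvec (x : Eucl n) (i : Fin n) : inner ℝ x (bvec i) = x i := by
  simp [bvec, EuclideanSpace.inner_single_right]

lemma map_sum_coord {F : Type*} [NormedAddCommGroup F] [NormedSpace ℝ F]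
    (A : Eucl n →L[ℝ] F) (x : Eucl n) : A x = ∑ i, x i • A (bvec i) := by
  conv_lhs => rw [← sum_coord x]
  simp [map_sum]

lemma fderiv_fderiv_apply {u : Eucl n → ℝ} {x : Eucl n}
    (hu : DifferentiableAt ℝ (fderiv ℝ u) x) (v w : Eucl n) :
    fderiv ℝ (fun y => fderiv ℝ u y v) x w = fderiv ℝ (fderiv ℝ u) x w v := by
  have := hu.hasFDerivAt.clm_apply (hasFDerivAt_const v x)
  rw [this.fderiv]
  simp

lemma lap_eq_lapl {u : Eucl n → ℝ} {x : Eucl n}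
    (hu : DifferentiableAt ℝ (fderiv ℝ u) x) : lap n u x = lapl u x := by
  unfold lap lapl
  exact Finset.sum_congr rfl fun i _ => fderiv_fderiv_apply hu _ _

lemma ContDiffOn.contDiffAt_of_isOpen {F : Type*} [NormedAddCommGroup F] [NormedSpace ℝ F]
    {u : Eucl n → F} {U : Set (Eucl n)} {m : WithTop ℕ∞} (hu : ContDiffOn ℝ m u U)
    (hU : IsOpen U) {x : Eucl n} (hx : x ∈ U) : ContDiffAt ℝ m u x :=
  hu.contDiffAt (hU.mem_nhds hx)

lemma ContDiffOn.fderiv_one {F : Type*} [NormedAddCommGroup F] [NormedSpace ℝ F]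
    {u : Eucl n → F} {U : Set (Eucl n)} (hu : ContDiffOn ℝ 2 u U)
    (hU : IsOpen U) : ContDiffOn ℝ 1 (fderiv ℝ u) U :=
  hu.fderiv_of_isOpen hU (by norm_num)

lemma ContDiffAt.fderiv_one {F : Type*} [NormedAddCommGroup F] [NormedSpace ℝ F]
    {u : Eucl n → F} {x : Eucl n} (hu : ContDiffAt ℝ 2 u x) : ContDiffAt ℝ 1 (fderiv ℝ u) x :=
  hu.fderiv_right (by norm_num)

lemma ContDiffAt.differentiableAt_fderiv {F : Type*} [NormedAddCommGroup F] [NormedSpace ℝ F]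
    {u : Eucl n → F} {x : Eucl n} (hu : ContDiffAt ℝ 2 u x) :
    DifferentiableAt ℝ (fderiv ℝ u) x := hu.fderiv_one.differentiableAt (by norm_num)

lemma ContDiffAt.differentiableAt_two {F : Type*} [NormedAddCommGroup F] [NormedSpace ℝ F]
    {u : Eucl n → F} {x : Eucl n} (hu : ContDiffAt ℝ 2 u x) :
    DifferentiableAt ℝ u x := hu.differentiableAt (by norm_num)

lemma ContDiffAt.continuousAt_fderiv_fderiv {F : Type*} [NormedAddCommGroup F] [NormedSpace ℝ F]
    {u : Eucl n → F} {x : Eucl n} (hu : ContDiffAt ℝ 2 u x) :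
    ContinuousAt (fderiv ℝ (fderiv ℝ u)) x :=
  (hu.fderiv_one.fderiv_right (m := 0) (by norm_num)).continuousAt

lemma ContDiffAt.fderiv_fderiv_comm {u : Eucl n → ℝ} {x : Eucl n} (hu : ContDiffAt ℝ 2 u x)
    (v w : Eucl n) : fderiv ℝ (fderiv ℝ u) x v w = fderiv ℝ (fderiv ℝ u) x w v :=
  (hu.isSymmSndFDerivAt (by simp)) v w


/-- The radial potential of the mollifier. -/
noncomputable def molPot (y : Eucl n) : ℝ := -expNegInvGlue (1 - ‖y‖ ^ 2)

/-- The mollifier: a radial bump supported in the unit ball. -/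
noncomputable def mol (y : Eucl n) : ℝ := 2 * deriv expNegInvGlue (1 - ‖y‖ ^ 2)

lemma contDiff_molPot : ContDiff ℝ (⊤ : ℕ∞) (molPot (n := n)) := by
  unfold molPot
  exact (expNegInvGlue.contDiff.comp (contDiff_const.sub (contDiff_norm_sq ℝ))).neg

lemma contDiff_mol : ContDiff ℝ (⊤ : ℕ∞) (mol (n := n)) := by
  unfold mol
  have h : ContDiff ℝ (⊤ : ℕ∞) (deriv expNegInvGlue) := by
    have := (expNegInvGlue.contDiff (n := ⊤))
    exact (contDiff_infty_iff_deriv.1 this).2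
  exact contDiff_const.mul (h.comp (contDiff_const.sub (contDiff_norm_sq ℝ)))

lemma fderiv_molPot (y v : Eucl n) : fderiv ℝ molPot y v = mol y * inner ℝ y v := by
  have h1 : HasDerivAt expNegInvGlue (deriv expNegInvGlue (1 - ‖y‖ ^ 2)) (1 - ‖y‖ ^ 2) :=
    ((expNegInvGlue.contDiff (n := 1)).differentiable (by norm_num)).differentiableAt.hasDerivAt
  have h2 : HasFDerivAt (fun y : Eucl n => 1 - ‖y‖ ^ 2) (-(2 • innerSL ℝ y)) y :=
    (hasStrictFDerivAt_norm_sq y).hasFDerivAt.const_sub 1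
  have h3 := (h1.comp_hasFDerivAt y h2).neg
  have : fderiv ℝ molPot y = _ := HasFDerivAt.fderiv (f := molPot) h3
  rw [this]
  simp [mol]
  ring

lemma mol_nonneg (y : Eucl n) : 0 ≤ mol y :=
  mul_nonneg zero_le_two expNegInvGlue.monotone.deriv_nonneg

lemma mol_pos {y : Eucl n} (hy : ‖y‖ < 1) : 0 < mol y := by
  unfold mol
  set t := 1 - ‖y‖ ^ 2
  have ht : 0 < t := by have := norm_nonneg y; simp only [t]; nlinarith
  have h1 : HasDerivAt (fun x : ℝ => Real.exp (-x⁻¹)) (Real.exp (-t⁻¹) * (-(-(t ^ 2)⁻¹))) t :=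
    (hasDerivAt_inv ht.ne').neg.exp
  have h2 : expNegInvGlue =ᶠ[nhds t] fun x : ℝ => Real.exp (-x⁻¹) := by
    filter_upwards [lt_mem_nhds ht] with x hx
    simp [expNegInvGlue, not_le.2 hx]
  rw [h2.deriv_eq, h1.deriv, neg_neg]
  positivity

lemma tsupport_mol : tsupport (mol (n := n)) ⊆ Metric.closedBall 0 1 := by
  refine closure_minimal ?_ Metric.isClosed_closedBall
  intro y hy
  by_contra h
  apply hy
  have h1 : 1 < ‖y‖ := by simpa using h
  have h2 : expNegInvGlue =ᶠ[nhds (1 - ‖y‖ ^ 2)] fun _ => 0 := by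
    filter_upwards [gt_mem_nhds (show 1 - ‖y‖ ^ 2 < 0 by nlinarith)] with x hx
    exact expNegInvGlue.zero_of_nonpos hx.le
  simp [mol, h2.deriv_eq]

lemma tsupport_molPot : tsupport (molPot (n := n)) ⊆ Metric.closedBall 0 1 := by
  refine closure_minimal ?_ Metric.isClosed_closedBall
  intro y hy
  by_contra h
  apply hy
  have h1 : 1 < ‖y‖ := by simpa using h
  simp [molPot, expNegInvGlue.zero_of_nonpos (show 1 - ‖y‖ ^ 2 ≤ 0 by nlinarith)]

lemma hasCompactSupport_mol : HasCompactSupport (mol (n := n)) :=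
  (isCompact_closedBall _ _).of_isClosed_subset (isClosed_tsupport _) tsupport_mol

lemma hasCompactSupport_molPot : HasCompactSupport (molPot (n := n)) :=
  (isCompact_closedBall _ _).of_isClosed_subset (isClosed_tsupport _) tsupport_molPot

lemma integrable_mol : Integrable (mol (n := n)) :=
  contDiff_mol.continuous.integrable_of_hasCompactSupport hasCompactSupport_mol

lemma integral_mol_pos : 0 < ∫ y : Eucl n, mol y := by
  refine contDiff_mol.continuous.integral_pos_of_hasCompactSupport_nonneg_nonzero
    hasCompactSupport_mol mol_nonneg (x := 0) (mol_pos (by simp)).ne'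

end Basics

section Tools

variable {n : ℕ}

lemma continuous_mul_of_continuousAt_tsupport {X : Type*} [TopologicalSpace X] {f g : X → ℝ}
    (hf : ∀ x ∈ tsupport g, ContinuousAt f x) (hg : Continuous g) :
    Continuous fun x => f x * g x := by
  rw [continuous_iff_continuousAt]
  intro x
  by_cases hx : x ∈ tsupport g
  · exact (hf x hx).mul hg.continuousAt
  · have h0 : g =ᶠ[nhds x] 0 := notMem_tsupport_iff_eventuallyEq.1 hx
    have : (fun x => f x * g x) =ᶠ[nhds x] fun _ => 0 := h0.mono fun y hy => by simp [hy]
    exact continuousAt_const.congr this.symm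

lemma integrable_mul_of_continuousAt_tsupport {f g : Eucl n → ℝ}
    (hf : ∀ x ∈ tsupport g, ContinuousAt f x) (hg : Continuous g) (hc : HasCompactSupport g) :
    Integrable fun x => f x * g x :=
  (continuous_mul_of_continuousAt_tsupport hf hg).integrable_of_hasCompactSupport hc.mul_left

lemma two_le_infty : (2 : WithTop ℕ∞) ≤ ((⊤ : ℕ∞) : WithTop ℕ∞) :=
  WithTop.coe_le_coe.2 (le_top : (2 : ℕ∞) ≤ ⊤)

lemma tsupport_fderiv_const_subset (g : Eucl n → ℝ) (v : Eucl n) :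
    tsupport (fun x => fderiv ℝ g x v) ⊆ tsupport g := by
  refine (closure_minimal ?_ (isClosed_tsupport _))
  intro x hx
  refine tsupport_fderiv_subset ℝ (f := g) (subset_tsupport _ ?_)
  intro h
  exact hx (by simp [h])

lemma HasCompactSupport.fderiv_apply_const {g : Eucl n → ℝ} (hc : HasCompactSupport g) (v : Eucl n) :
    HasCompactSupport (fun x => fderiv ℝ g x v) :=
  hc.of_isClosed_subset (isClosed_tsupport _) (tsupport_fderiv_const_subset g v)

lemma ContDiff.fderiv_apply_const {g : Eucl n → ℝ} (hg : ContDiff ℝ (⊤ : ℕ∞) g) (v : Eucl n) :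
    ContDiff ℝ (⊤ : ℕ∞) (fun x => fderiv ℝ g x v) :=
  (hg.fderiv_right (m := (⊤ : ℕ∞)) (by simp)).clm_apply contDiff_const

lemma integral_fderiv_mul_eq_neg {f g : Eucl n → ℝ} (hf : ∀ x ∈ tsupport g, ContDiffAt ℝ 1 f x)
    (hg : ContDiff ℝ 1 g) (hc : HasCompactSupport g) (v : Eucl n) :
    ∫ x, fderiv ℝ f x v * g x = -∫ x, f x * fderiv ℝ g x v := by
  have hg' : Continuous fun x => fderiv ℝ g x v :=
    (hg.continuous_fderiv (by norm_num)).clm_apply continuous_const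
  have h1 : Integrable fun x => fderiv ℝ f x v * g x :=
    integrable_mul_of_continuousAt_tsupport (fun x hx =>
      ((hf x hx).fderiv_right (m := 0) (by norm_num)).continuousAt.clm_apply continuousAt_const)
      hg.continuous hc
  have h2 : Integrable fun x => f x * fderiv ℝ g x v :=
    integrable_mul_of_continuousAt_tsupport (fun x hx =>
      (hf x (tsupport_fderiv_const_subset g v hx)).continuousAt) hg' (hc.fderiv_apply_const v)
  have h3 : Integrable fun x => f x * g x :=
    integrable_mul_of_continuousAt_tsupport (fun x hx => (hf x hx).continuousAt) hg.continuous hc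
  rw [integral_mul_fderiv_eq_neg_fderiv_mul_of_integrable h1 h2 h3
    (fun x hx => (hf x hx).differentiableAt (by norm_num))
    (fun x _ => hg.differentiable (by norm_num) x), neg_neg]

/-- Integrating by parts twice moves the Laplacian into the contraction of two gradients. -/
lemma integral_hessian_mul_gradient {g Θ : Eucl n → ℝ} (hg : ∀ x ∈ tsupport Θ, ContDiffAt ℝ 2 g x)
    (hΘ : ContDiff ℝ (⊤ : ℕ∞) Θ) (hc : HasCompactSupport Θ) (v : Eucl n) :
    ∫ x, ∑ i, fderiv ℝ (fderiv ℝ g) x (bvec i) v * fderiv ℝ Θ x (bvec i)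
      = ∫ x, lapl g x * fderiv ℝ Θ x v := by
  have hcont : ∀ a b c : Eucl n, Integrable fun x =>
      fderiv ℝ (fderiv ℝ g) x a b * fderiv ℝ Θ x c := fun a b c =>
    integrable_mul_of_continuousAt_tsupport (fun x hx =>
      ((hg x (tsupport_fderiv_const_subset Θ c hx)).continuousAt_fderiv_fderiv.clm_apply
        continuousAt_const).clm_apply continuousAt_const)
      (hΘ.fderiv_apply_const c).continuous (hc.fderiv_apply_const c)
  have key : ∀ a b c : Eucl n, ∫ x, fderiv ℝ (fderiv ℝ g) x a b * fderiv ℝ Θ x c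
      = -∫ x, fderiv ℝ g x b * fderiv ℝ (fun y => fderiv ℝ Θ y c) x a := by
    intro a b c
    rw [← integral_fderiv_mul_eq_neg (f := fun x => fderiv ℝ g x b)]
    · refine integral_congr_ae (Eventually.of_forall fun x => ?_)
      by_cases hx : x ∈ tsupport Θ
      · simp only
        rw [fderiv_fderiv_apply (hg x hx).differentiableAt_fderiv]
      · have : fderiv ℝ Θ x c = 0 := by
          by_contra h
          exact hx (tsupport_fderiv_const_subset Θ c (subset_tsupport _ h))
        simp [this]
    · exact fun x hx => (hg x (tsupport_fderiv_const_subset Θ c hx)).fderiv_one.clm_apply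
        contDiffAt_const
    · exact (hΘ.fderiv_apply_const c).of_le (by exact_mod_cast le_top)
    · exact hc.fderiv_apply_const c
  unfold lapl
  simp_rw [Finset.sum_mul]
  rw [integral_finsetSum _ fun i _ => hcont _ _ _, integral_finsetSum _ fun i _ => hcont _ _ _]
  refine Finset.sum_congr rfl fun i _ => ?_
  have h1 : ∫ x, fderiv ℝ (fderiv ℝ g) x (bvec i) v * fderiv ℝ Θ x (bvec i)
      = ∫ x, fderiv ℝ (fderiv ℝ g) x v (bvec i) * fderiv ℝ Θ x (bvec i) := by
    refine integral_congr_ae (Eventually.of_forall fun x => ?_)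
    by_cases hx : x ∈ tsupport Θ
    · simp only
      rw [(hg x hx).fderiv_fderiv_comm]
    · have : fderiv ℝ Θ x (bvec i) = 0 := by
        by_contra h
        exact hx (tsupport_fderiv_const_subset Θ _ (subset_tsupport _ h))
      simp [this]
  rw [h1, key, key]
  congr 1
  refine integral_congr_ae (Eventually.of_forall fun x => ?_)
  have hd : ContDiffAt ℝ 2 Θ x := (hΘ.of_le two_le_infty).contDiffAt
  simp only
  rw [fderiv_fderiv_apply hd.differentiableAt_fderiv, fderiv_fderiv_apply hd.differentiableAt_fderiv,
    hd.fderiv_fderiv_comm]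

lemma ae_ne_zero (n : ℕ) [NeZero n] : ∀ᵐ y : Eucl n, y ≠ 0 := by
  have : Nontrivial (Eucl n) := inferInstance
  exact Measure.ae_ne volume 0

lemma aestronglyMeasurable_mul_weight [NeZero n] {F g : Eucl n → ℝ} (hg : Continuous g)
    (hF : ContinuousOn F (tsupport g \ {0})) :
    AEStronglyMeasurable (fun y => F y * g y) volume := by
  have hms : MeasurableSet (tsupport g \ {0}) :=
    (isClosed_tsupport g).measurableSet.diff (measurableSet_singleton 0)
  have h1 : AEStronglyMeasurable ((tsupport g \ {0}).indicator F) volume :=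
    (aestronglyMeasurable_indicator_iff hms).2 (hF.aestronglyMeasurable hms)
  refine (h1.mul hg.aestronglyMeasurable).congr ?_
  filter_upwards [ae_ne_zero n] with y hy
  by_cases h : y ∈ tsupport g
  · simp [indicator_of_mem (show y ∈ tsupport g \ {0} from ⟨h, hy⟩)]
  · simp [image_eq_zero_of_notMem_tsupport h]

/-- Differentiation under the integral sign against a compactly supported weight, with a possible
singularity at the origin. -/
lemma hasDerivAt_integral_mul_weight [NeZero n] {g : Eucl n → ℝ} (hg : Continuous g)
    (hc : HasCompactSupport g) {I : Set ℝ} (hI : IsOpen I) {G G' : ℝ → Eucl n → ℝ} {B : ℝ}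
    (hG : ∀ s ∈ I, ∀ y ∈ tsupport g, y ≠ 0 → HasDerivAt (fun t => G t y) (G' s y) s)
    (hGc : ∀ s ∈ I, ContinuousOn (G s) (tsupport g \ {0}))
    (hGc' : ∀ s ∈ I, ContinuousOn (G' s) (tsupport g \ {0}))
    (hB : ∀ s ∈ I, ∀ y ∈ tsupport g, y ≠ 0 → |G s y| ≤ B)
    (hB' : ∀ s ∈ I, ∀ y ∈ tsupport g, y ≠ 0 → |G' s y| ≤ B) {s : ℝ} (hs : s ∈ I) :
    HasDerivAt (fun t => ∫ y, G t y * g y) (∫ y, G' s y * g y) s := by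
  have hmeas : ∀ F : Eucl n → ℝ, ContinuousOn F (tsupport g \ {0}) →
      AEStronglyMeasurable (fun y => F y * g y) volume := fun F hF =>
    aestronglyMeasurable_mul_weight hg hF
  have h0 := ae_ne_zero n
  have hbd : Integrable fun y => B * |g y| :=
    ((hg.integrable_of_hasCompactSupport hc).abs).const_mul B
  refine (hasDerivAt_integral_of_dominated_loc_of_deriv_le (F := fun t y => G t y * g y)
    (F' := fun t y => G' t y * g y) (bound := fun y => B * |g y|) (hI.mem_nhds hs)
    ?_ ?_ (hmeas _ (hGc' s hs)) ?_ hbd ?_).2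
  · filter_upwards [hI.mem_nhds hs] with t ht using hmeas _ (hGc t ht)
  · refine hbd.mono' (hmeas _ (hGc s hs)) ?_
    filter_upwards [h0] with y hy
    by_cases h : y ∈ tsupport g
    · rw [Real.norm_eq_abs, abs_mul]
      exact mul_le_mul_of_nonneg_right (hB s hs y h hy) (abs_nonneg _)
    · simp [image_eq_zero_of_notMem_tsupport h]
  · filter_upwards [h0] with y hy t ht
    by_cases h : y ∈ tsupport g
    · rw [Real.norm_eq_abs, abs_mul]
      exact mul_le_mul_of_nonneg_right (hB' t ht y h hy) (abs_nonneg _)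
    · simp [image_eq_zero_of_notMem_tsupport h]
  · filter_upwards [h0] with y hy t ht
    by_cases h : y ∈ tsupport g
    · exact (hG t ht y h hy).mul_const _
    · simpa [image_eq_zero_of_notMem_tsupport h] using hasDerivAt_const t (0 : ℝ)

end Tools

section Mollifier

variable {n : ℕ}

lemma fderiv_comp_affine {F : Type*} [NormedAddCommGroup F] [NormedSpace ℝ F] (w : Eucl n → F)
    (x : Eucl n) (s : ℝ) (y : Eucl n) :
    fderiv ℝ (fun y => w (x + s • y)) y = s • fderiv ℝ w (x + s • y) := by
  rw [fderiv_comp_smul (f := fun z => w (x + z)) s, fderiv_comp_add_left]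

lemma fderiv_fderiv_comp_affine {F : Type*} [NormedAddCommGroup F] [NormedSpace ℝ F]
    (w : Eucl n → F) (x : Eucl n) (s : ℝ) (y : Eucl n) :
    fderiv ℝ (fderiv ℝ (fun y => w (x + s • y))) y = s • s • fderiv ℝ (fderiv ℝ w) (x + s • y) := by
  have : fderiv ℝ (fun y => w (x + s • y)) = s • fun y => fderiv ℝ w (x + s • y) :=
    funext fun y => fderiv_comp_affine w x s y
  rw [this]
  have h := congrFun (fderiv_const_smul_field (𝕜 := ℝ) (f := fun y => fderiv ℝ w (x + s • y)) s) y
  rw [Pi.smul_apply, fderiv_comp_affine (fderiv ℝ w)] at h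
  exact h

lemma lapl_comp_affine (w : Eucl n → ℝ) (x : Eucl n) (s : ℝ) (y : Eucl n) :
    lapl (fun y => w (x + s • y)) y = s ^ 2 * lapl w (x + s • y) := by
  unfold lapl
  rw [Finset.mul_sum]
  refine Finset.sum_congr rfl fun i _ => ?_
  rw [fderiv_fderiv_comp_affine]
  simp only [smul_apply, smul_eq_mul]
  ring

lemma ContDiffAt.comp_affine {F : Type*} [NormedAddCommGroup F] [NormedSpace ℝ F] {m : WithTop ℕ∞}
    {w : Eucl n → F} {x : Eucl n} {s : ℝ} {y : Eucl n} (hw : ContDiffAt ℝ m w (x + s • y)) :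
    ContDiffAt ℝ m (fun y => w (x + s • y)) y :=
  ContDiffAt.comp y hw (contDiffAt_const.add (contDiffAt_id.const_smul s))

lemma affine_mem_closedBall {x y : Eucl n} {s r : ℝ} (hs : 0 ≤ s) (hsr : s ≤ r)
    (hy : y ∈ Metric.closedBall (0 : Eucl n) 1) : x + s • y ∈ Metric.closedBall x r := by
  have hy' : ‖y‖ ≤ 1 := by simpa using hy
  simp only [Metric.mem_closedBall, dist_self_add_left, norm_smul, Real.norm_eq_abs, abs_of_nonneg hs]
  nlinarith [norm_nonneg y]

lemma abs_integral_mul_le {f g : Eucl n → ℝ} {A : ℝ} (hg : Integrable g)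
    (hf : ∀ y, g y ≠ 0 → |f y| ≤ A) : |∫ y, f y * g y| ≤ A * ∫ y, |g y| := by
  rw [← integral_const_mul, ← Real.norm_eq_abs]
  refine norm_integral_le_of_norm_le (hg.abs.const_mul A) (Eventually.of_forall fun y => ?_)
  rw [Real.norm_eq_abs, abs_mul]
  by_cases h : g y = 0
  · simp [h]
  · exact mul_le_mul_of_nonneg_right (hf y h) (abs_nonneg _)

lemma continuousOn_integral_affine_mul {F g : Eucl n → ℝ} {x : Eucl n} {r : ℝ}
    (hF : ∀ z ∈ Metric.closedBall x r, ContinuousAt F z) (hg : Continuous g)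
    (hgs : tsupport g ⊆ Metric.closedBall 0 1) :
    ContinuousOn (fun s : ℝ => ∫ y, F (x + s • y) * g y) (Icc 0 r) := by
  refine continuousOn_integral_of_compact_support (k := Metric.closedBall 0 1)
    (isCompact_closedBall _ _) ?_ ?_
  · rintro ⟨s, y⟩ ⟨hs, -⟩
    refine ContinuousAt.continuousWithinAt ?_
    by_cases hy : y ∈ tsupport g
    · have h1 : ContinuousAt (fun p : ℝ × Eucl n => x + p.1 • p.2) (s, y) := by fun_prop
      have h2 : ContinuousAt F ((fun p : ℝ × Eucl n => x + p.1 • p.2) (s, y)) :=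
        hF _ (affine_mem_closedBall hs.1 hs.2 (hgs hy))
      exact (ContinuousAt.comp (f := fun p : ℝ × Eucl n => x + p.1 • p.2) h2 h1).mul
        (hg.comp continuous_snd).continuousAt
    · have h0 : g =ᶠ[nhds y] 0 := notMem_tsupport_iff_eventuallyEq.1 hy
      have h1 : ∀ᶠ p : ℝ × Eucl n in nhds (s, y), g p.2 = 0 :=
        (continuous_snd.continuousAt (x := (s, y))).eventually (p := fun z => g z = 0) h0
      refine continuousAt_const (y := (0 : ℝ)) |>.congr ?_
      filter_upwards [h1] with p hp
      simp [Function.uncurry, hp]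
  · intro s y _ hy
    simp [image_eq_zero_of_notMem_tsupport fun h => hy (hgs h)]

lemma hasDerivAt_integral_affine_mul [NeZero n] {F g : Eucl n → ℝ} {x : Eucl n} {r : ℝ}
    (hF : ∀ z ∈ Metric.closedBall x r, ContDiffAt ℝ 1 F z) (hg : Continuous g)
    (hgs : tsupport g ⊆ Metric.closedBall 0 1) {s : ℝ} (hs : s ∈ Ioo 0 r) :
    HasDerivAt (fun s : ℝ => ∫ y, F (x + s • y) * g y)
      (∫ y, fderiv ℝ F (x + s • y) y * g y) s := by
  have hcont : ContinuousOn F (Metric.closedBall x r) := fun z hz =>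
    (hF z hz).continuousAt.continuousWithinAt
  have hcont' : ContinuousOn (fderiv ℝ F) (Metric.closedBall x r) := fun z hz =>
    ((hF z hz).fderiv_right (m := 0) (by norm_num)).continuousAt.continuousWithinAt
  obtain ⟨B₁, hB₁⟩ := (isCompact_closedBall x r).exists_bound_of_continuousOn hcont
  obtain ⟨B₂, hB₂⟩ := (isCompact_closedBall x r).exists_bound_of_continuousOn hcont'
  have hmem : ∀ t ∈ Ioo 0 r, ∀ y ∈ tsupport g, x + t • y ∈ Metric.closedBall x r :=
    fun t ht y hy => affine_mem_closedBall ht.1.le ht.2.le (hgs hy)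
  refine hasDerivAt_integral_mul_weight hg
    ((isCompact_closedBall _ _).of_isClosed_subset (isClosed_tsupport _) hgs) isOpen_Ioo
    (G := fun t y => F (x + t • y)) (G' := fun t y => fderiv ℝ F (x + t • y) y)
    (B := max B₁ B₂) ?_ ?_ ?_ ?_ ?_ hs
  · intro t ht y hy _
    have h1 : HasDerivAt (fun t : ℝ => x + t • y) y t := by
      simpa using ((hasDerivAt_id t).smul_const y).const_add x
    exact ((hF _ (hmem t ht y hy)).differentiableAt (by norm_num)).hasFDerivAt.comp_hasDerivAt t h1
  · intro t ht
    exact hcont.comp (by fun_prop) fun y hy => hmem t ht y hy.1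
  · intro t ht
    exact (hcont'.comp (by fun_prop) fun y hy => hmem t ht y hy.1).clm_apply continuousOn_id
  · intro t ht y hy _
    exact (hB₁ _ (hmem t ht y hy)).trans (le_max_left _ _)
  · intro t ht y hy _
    have hy1 : ‖y‖ ≤ 1 := by simpa using hgs hy
    refine ((fderiv ℝ F (x + t • y)).le_opNorm y).trans ?_
    refine (mul_le_of_le_one_right (norm_nonneg _) hy1).trans ?_
    exact (hB₂ _ (hmem t ht y hy)).trans (le_max_right _ _)

lemma integral_affine_fderiv_mul {F g : Eucl n → ℝ} {x : Eucl n} {r s : ℝ}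
    (hF : ∀ z ∈ Metric.closedBall x r, ContDiffAt ℝ 1 F z) (hg : ContDiff ℝ 1 g)
    (hgs : tsupport g ⊆ Metric.closedBall 0 1) (hs : 0 < s) (hsr : s ≤ r) (u : Eucl n) :
    ∫ y, fderiv ℝ F (x + s • y) u * g y = -s⁻¹ * ∫ y, F (x + s • y) * fderiv ℝ g y u := by
  have h := integral_fderiv_mul_eq_neg (f := fun y => F (x + s • y)) (g := g)
    (fun y hy => (hF _ (affine_mem_closedBall hs.le hsr (hgs hy))).comp_affine) hg
    ((isCompact_closedBall _ _).of_isClosed_subset (isClosed_tsupport _) hgs) u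
  have h2 : ∫ y, fderiv ℝ (fun y => F (x + s • y)) y u * g y
      = s * ∫ y, fderiv ℝ F (x + s • y) u * g y := by
    rw [← integral_const_mul]
    refine integral_congr_ae (Eventually.of_forall fun y => ?_)
    simp only [fderiv_comp_affine, smul_apply, smul_eq_mul]
    ring
  rw [h2] at h
  rw [neg_mul, ← mul_neg, ← h]
  field_simp

lemma integral_affine_hessian_mul {w Θ : Eucl n → ℝ} {x : Eucl n} {r s : ℝ}
    (hw : ∀ z ∈ Metric.closedBall x r, ContDiffAt ℝ 2 w z) (hΘ : ContDiff ℝ (⊤ : ℕ∞) Θ)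
    (hΘs : tsupport Θ ⊆ Metric.closedBall 0 1) (hs : 0 < s) (hsr : s ≤ r) (v : Eucl n) :
    ∫ y, ∑ i, fderiv ℝ (fderiv ℝ w) (x + s • y) (bvec i) v * fderiv ℝ Θ y (bvec i)
      = ∫ y, lapl w (x + s • y) * fderiv ℝ Θ y v := by
  have h := integral_hessian_mul_gradient (g := fun y => w (x + s • y)) (Θ := Θ)
    (fun y hy => (hw _ (affine_mem_closedBall hs.le hsr (hΘs hy))).comp_affine) hΘ
    ((isCompact_closedBall _ _).of_isClosed_subset (isClosed_tsupport _) hΘs) v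
  have h1 : ∀ y, ∑ i, fderiv ℝ (fderiv ℝ fun y => w (x + s • y)) y (bvec i) v
      * fderiv ℝ Θ y (bvec i) = s ^ 2 *
      ∑ i, fderiv ℝ (fderiv ℝ w) (x + s • y) (bvec i) v * fderiv ℝ Θ y (bvec i) := by
    intro y
    rw [fderiv_fderiv_comp_affine, Finset.mul_sum]
    refine Finset.sum_congr rfl fun i _ => ?_
    simp only [smul_apply, smul_eq_mul]
    ring
  simp_rw [h1, lapl_comp_affine, mul_assoc, integral_const_mul] at h
  exact mul_left_cancel₀ (pow_ne_zero 2 hs.ne') h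

lemma exists_mollifier_bound (n : ℕ) : ∃ K : ℝ, 0 < K ∧
    (∀ v : Eucl n, ∫ y, |fderiv ℝ mol y v| ≤ K * ‖v‖) ∧
    (∀ v : Eucl n, ∫ y, |fderiv ℝ molPot y v| ≤ K * ‖v‖) ∧
    (∀ u v : Eucl n, ∫ y, |fderiv ℝ (fun z => fderiv ℝ mol z u) y v| ≤ K * ‖u‖ * ‖v‖) ∧
    (∀ u v : Eucl n, ∫ y, |fderiv ℝ (fun z => fderiv ℝ molPot z u) y v| ≤ K * ‖u‖ * ‖v‖) := by
  have key1 : ∀ g : Eucl n → ℝ, ContDiff ℝ (⊤ : ℕ∞) g → HasCompactSupport g →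
      ∀ v : Eucl n, ∫ y, |fderiv ℝ g y v| ≤ (∫ y, ‖fderiv ℝ g y‖) * ‖v‖ := by
    intro g hg hc v
    rw [← integral_mul_const]
    refine integral_mono_of_nonneg (Eventually.of_forall fun y => abs_nonneg _) ?_
      (Eventually.of_forall fun y => (fderiv ℝ g y).le_opNorm v)
    exact (((hg.continuous_fderiv (by simp)).integrable_of_hasCompactSupport
      (hc.fderiv ℝ)).norm).mul_const _
  have key2 : ∀ g : Eucl n → ℝ, ContDiff ℝ (⊤ : ℕ∞) g → HasCompactSupport g →
      ∀ u v : Eucl n, ∫ y, |fderiv ℝ (fun z => fderiv ℝ g z u) y v|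
        ≤ (∫ y, ‖fderiv ℝ (fderiv ℝ g) y‖) * ‖u‖ * ‖v‖ := by
    intro g hg hc u v
    rw [← integral_mul_const, ← integral_mul_const]
    refine integral_mono_of_nonneg (Eventually.of_forall fun y => abs_nonneg _) ?_
      (Eventually.of_forall fun y => ?_)
    · have h1 : ContDiff ℝ (⊤ : ℕ∞) (fderiv ℝ g) := hg.fderiv_right (by simp)
      exact ((((h1.continuous_fderiv (by simp)).integrable_of_hasCompactSupport
        ((hc.fderiv ℝ).fderiv ℝ)).norm).mul_const _).mul_const _
    · have hd : ContDiffAt ℝ 2 g y := (hg.of_le two_le_infty).contDiffAt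
      simp only
      rw [fderiv_fderiv_apply hd.differentiableAt_fderiv]
      refine ((fderiv ℝ (fderiv ℝ g) y).le_opNorm₂ v u).trans_eq (by ring)
  set a := ∫ y : Eucl n, ‖fderiv ℝ mol y‖ with ha
  set b := ∫ y : Eucl n, ‖fderiv ℝ molPot y‖ with hb
  set c := ∫ y : Eucl n, ‖fderiv ℝ (fderiv ℝ mol) y‖ with hc
  set d := ∫ y : Eucl n, ‖fderiv ℝ (fderiv ℝ molPot) y‖ with hd
  have ha0 : 0 ≤ a := integral_nonneg fun _ => norm_nonneg _
  have hb0 : 0 ≤ b := integral_nonneg fun _ => norm_nonneg _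
  have hc0 : 0 ≤ c := integral_nonneg fun y => norm_nonneg (fderiv ℝ (fderiv ℝ mol) y)
  have hd0 : 0 ≤ d := integral_nonneg fun y => norm_nonneg (fderiv ℝ (fderiv ℝ molPot) y)
  refine ⟨a + b + c + d + 1, by positivity, fun v => ?_, fun v => ?_, fun u v => ?_, fun u v => ?_⟩
  · refine (key1 _ contDiff_mol hasCompactSupport_mol v).trans ?_
    gcongr
    linarith
  · refine (key1 _ contDiff_molPot hasCompactSupport_molPot v).trans ?_
    gcongr
    linarith
  · refine (key2 _ contDiff_mol hasCompactSupport_mol u v).trans ?_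
    gcongr
    linarith
  · refine (key2 _ contDiff_molPot hasCompactSupport_molPot u v).trans ?_
    gcongr
    linarith

lemma one_le_infty : (1 : WithTop ℕ∞) ≤ ((⊤ : ℕ∞) : WithTop ℕ∞) :=
  WithTop.coe_le_coe.2 (le_top : (1 : ℕ∞) ≤ ⊤)

lemma integrable_fderiv_const {g : Eucl n → ℝ} (hg : ContDiff ℝ (⊤ : ℕ∞) g)
    (hc : HasCompactSupport g) (v : Eucl n) : Integrable fun y => fderiv ℝ g y v :=
  (hg.fderiv_apply_const v).continuous.integrable_of_hasCompactSupport (hc.fderiv_apply_const v)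

lemma mem_closedBall_of_fderiv_ne {g : Eucl n → ℝ} (hgs : tsupport g ⊆ Metric.closedBall 0 1)
    {y v : Eucl n} (h : fderiv ℝ g y v ≠ 0) : y ∈ Metric.closedBall (0 : Eucl n) 1 :=
  hgs (tsupport_fderiv_const_subset g v (subset_tsupport _ h))

/-- Interior gradient estimate. -/
theorem gradient_estimate (n : ℕ) [NeZero n] : ∃ C : ℝ, 0 < C ∧
    ∀ (w : Eucl n → ℝ) (x : Eucl n) (r A B : ℝ), 0 < r → ContDiffOn ℝ 2 w (Metric.ball x r) →
      (∀ z ∈ Metric.ball x r, |w z| ≤ A) → (∀ z ∈ Metric.ball x r, |lapl w z| ≤ B) →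
        ‖fderiv ℝ w x‖ ≤ C * (A / r + r * B) := by
  obtain ⟨K, hK, hK1, hK2, -, -⟩ := exists_mollifier_bound n
  have hm := integral_mol_pos (n := n)
  set m := ∫ y : Eucl n, mol y with hmdef
  refine ⟨2 * K / m, by positivity, fun w x R A B hR hw hA hB => ?_⟩
  have hA0 : 0 ≤ A := (abs_nonneg _).trans (hA x (Metric.mem_ball_self hR))
  have hB0 : 0 ≤ B := (abs_nonneg _).trans (hB x (Metric.mem_ball_self hR))
  refine ContinuousLinearMap.opNorm_le_bound _ (by positivity) fun v => ?_
  set r := R / 2 with hr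
  have hr0 : 0 < r := by positivity
  have hsub : Metric.closedBall x r ⊆ Metric.ball x R :=
    Metric.closedBall_subset_ball (by rw [hr]; linarith)
  have hw2 : ∀ z ∈ Metric.closedBall x r, ContDiffAt ℝ 2 w z := fun z hz =>
    hw.contDiffAt_of_isOpen Metric.isOpen_ball (hsub hz)
  have hF : ∀ z ∈ Metric.closedBall x r, ContDiffAt ℝ 1 (fun z => fderiv ℝ w z v) z := fun z hz =>
    (hw2 z hz).fderiv_one.clm_apply contDiffAt_const
  set P : ℝ → ℝ := fun s => ∫ y, fderiv ℝ w (x + s • y) v * mol y with hP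
  have hPd : ∀ s ∈ Ioo 0 r, HasDerivAt P
      (∫ y, fderiv ℝ (fun z => fderiv ℝ w z v) (x + s • y) y * mol y) s := fun s hs =>
    hasDerivAt_integral_affine_mul hF contDiff_mol.continuous tsupport_mol hs
  have hPc : ContinuousOn P (Icc 0 r) := continuousOn_integral_affine_mul
    (fun z hz => (hF z hz).continuousAt) contDiff_mol.continuous tsupport_mol
  obtain ⟨s, hs, hslope⟩ := exists_hasDerivAt_eq_slope P _ hr0 hPc hPd
  have hder : ∫ y, fderiv ℝ (fun z => fderiv ℝ w z v) (x + s • y) y * mol y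
      = ∫ y, lapl w (x + s • y) * fderiv ℝ molPot y v := by
    rw [← integral_affine_hessian_mul hw2 contDiff_molPot tsupport_molPot hs.1 hs.2.le v]
    refine integral_congr_ae (Eventually.of_forall fun y => ?_)
    by_cases hy : y ∈ tsupport (mol (n := n))
    · simp only
      rw [fderiv_fderiv_apply (hw2 _ (affine_mem_closedBall hs.1.le hs.2.le
        (tsupport_mol hy))).differentiableAt_fderiv, map_sum_coord (fderiv ℝ (fderiv ℝ w) _) y]
      simp only [fderiv_molPot, inner_bvec, sum_apply,
        smul_apply, smul_eq_mul, Finset.sum_mul]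
      exact Finset.sum_congr rfl fun i _ => by ring
    · simp [fderiv_molPot, image_eq_zero_of_notMem_tsupport hy]
  have hb1 : |∫ y, lapl w (x + s • y) * fderiv ℝ molPot y v| ≤ B * (K * ‖v‖) := by
    refine (abs_integral_mul_le (A := B) (integrable_fderiv_const contDiff_molPot
      hasCompactSupport_molPot v) fun y hy => hB _ (hsub (affine_mem_closedBall hs.1.le hs.2.le
        (mem_closedBall_of_fderiv_ne tsupport_molPot hy)))).trans ?_
    exact mul_le_mul_of_nonneg_left (hK2 v) hB0
  have hPr : |P r| ≤ r⁻¹ * (A * (K * ‖v‖)) := by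
    have hw1 : ∀ z ∈ Metric.closedBall x r, ContDiffAt ℝ 1 w z := fun z hz =>
      (hw2 z hz).of_le (by norm_num)
    simp only [hP]
    rw [integral_affine_fderiv_mul hw1 (contDiff_mol.of_le one_le_infty) tsupport_mol hr0 le_rfl v,
      abs_mul, abs_neg, abs_of_pos (inv_pos.2 hr0)]
    refine mul_le_mul_of_nonneg_left ?_ (inv_pos.2 hr0).le
    refine (abs_integral_mul_le (A := A) (integrable_fderiv_const contDiff_mol
      hasCompactSupport_mol v) fun y hy => hA _ (hsub (affine_mem_closedBall hr0.le le_rfl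
        (mem_closedBall_of_fderiv_ne tsupport_mol hy)))).trans ?_
    exact mul_le_mul_of_nonneg_left (hK1 v) hA0
  have hP0 : P 0 = fderiv ℝ w x v * m := by
    simp [hP, hmdef, integral_const_mul]
  rw [hder] at hslope
  have h3 : P r - P 0 = (∫ y, lapl w (x + s • y) * fderiv ℝ molPot y v) * r := by
    rw [hslope, sub_zero, div_mul_cancel₀ _ hr0.ne']
  have h4 : |P 0| ≤ r⁻¹ * (A * (K * ‖v‖)) + B * (K * ‖v‖) * r := by
    have : P 0 = P r - (∫ y, lapl w (x + s • y) * fderiv ℝ molPot y v) * r := by linarith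
    rw [this]
    refine (abs_sub _ _).trans (add_le_add hPr ?_)
    rw [abs_mul, abs_of_pos hr0]
    exact mul_le_mul_of_nonneg_right hb1 hr0.le
  rw [hP0, abs_mul, abs_of_pos hm] at h4
  rw [Real.norm_eq_abs, ← mul_le_mul_iff_left₀ hm]
  refine h4.trans ?_
  have hv := norm_nonneg v
  rw [hr]
  have e1 : 2 * K / m * (A / R + R * B) * ‖v‖ * m = 2 * K * (A / R + R * B) * ‖v‖ := by
    field_simp
  rw [e1]
  have e2 : (R / 2)⁻¹ * (A * (K * ‖v‖)) = 2 * K * (A / R) * ‖v‖ := by field_simp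
  rw [e2]
  have : 0 ≤ K * R * B * ‖v‖ := by positivity
  nlinarith

/-- Interior Hessian estimate for functions whose Laplacian has a controlled oscillation. -/
theorem hessian_estimate (n : ℕ) [NeZero n] : ∃ C : ℝ, 0 < C ∧
    ∀ (w : Eucl n → ℝ) (x : Eucl n) (r A M : ℝ), 0 < r → ContDiffOn ℝ 2 w (Metric.ball x r) →
      0 ≤ M → (∀ z ∈ Metric.ball x r, |w z| ≤ A) →
      (∀ z ∈ Metric.ball x r, |lapl w z - lapl w x| ≤ M * ‖z - x‖) →
        ‖fderiv ℝ (fderiv ℝ w) x‖ ≤ C * (A / r ^ 2 + r * M) := by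
  obtain ⟨K, hK, hK1, hK2, hK3, hK4⟩ := exists_mollifier_bound n
  have hm := integral_mol_pos (n := n)
  set m := ∫ y : Eucl n, mol y with hmdef
  refine ⟨4 * K / m, by positivity, fun w x R A M hR hw hM0 hA hM => ?_⟩
  have hA0 : 0 ≤ A := (abs_nonneg _).trans (hA x (Metric.mem_ball_self hR))
  refine ContinuousLinearMap.opNorm_le_bound₂ _ (by positivity) fun u v => ?_
  set r := R / 2 with hr
  have hr0 : 0 < r := by positivity
  have hsub : Metric.closedBall x r ⊆ Metric.ball x R :=
    Metric.closedBall_subset_ball (by rw [hr]; linarith)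
  have hw2 : ∀ z ∈ Metric.closedBall x r, ContDiffAt ℝ 2 w z := fun z hz =>
    hw.contDiffAt_of_isOpen Metric.isOpen_ball (hsub hz)
  have hw1 : ∀ z ∈ Metric.closedBall x r, ContDiffAt ℝ 1 w z := fun z hz =>
    (hw2 z hz).of_le (by norm_num)
  have hF : ∀ z ∈ Metric.closedBall x r, ContDiffAt ℝ 1 (fun z => fderiv ℝ w z v) z := fun z hz =>
    (hw2 z hz).fderiv_one.clm_apply contDiffAt_const
  set Θ : Eucl n → ℝ := fun y => fderiv ℝ molPot y u with hΘ
  have hΘd : ContDiff ℝ (⊤ : ℕ∞) Θ := contDiff_molPot.fderiv_apply_const u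
  have hΘs : tsupport Θ ⊆ Metric.closedBall 0 1 :=
    (tsupport_fderiv_const_subset _ u).trans tsupport_molPot
  have hΘc : HasCompactSupport Θ := hasCompactSupport_molPot.fderiv_apply_const u
  set g : Eucl n → ℝ := fun y => fderiv ℝ mol y u with hg
  have hgd : ContDiff ℝ (⊤ : ℕ∞) g := contDiff_mol.fderiv_apply_const u
  have hgs : tsupport g ⊆ Metric.closedBall 0 1 :=
    (tsupport_fderiv_const_subset _ u).trans tsupport_mol
  have hgc : HasCompactSupport g := hasCompactSupport_mol.fderiv_apply_const u
  set Q : ℝ → ℝ := fun s => ∫ y, fderiv ℝ (fun z => fderiv ℝ w z v) (x + s • y) u * mol y with hQ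
  set T : ℝ → ℝ := fun s => ∫ y, fderiv ℝ w (x + s • y) v * g y with hT
  set T' : ℝ → ℝ := fun s => ∫ y, fderiv ℝ (fun z => fderiv ℝ w z v) (x + s • y) y * g y with hT'
  set J : ℝ → ℝ := fun s => ∫ y, lapl w (x + s • y) * fderiv ℝ Θ y v with hJ
  have hQT : ∀ s, 0 < s → s ≤ r → Q s = -s⁻¹ * T s := fun s hs hsr =>
    integral_affine_fderiv_mul hF (contDiff_mol.of_le one_le_infty) tsupport_mol hs hsr u
  have hTd : ∀ s ∈ Ioo 0 r, HasDerivAt T (T' s) s := fun s hs =>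
    hasDerivAt_integral_affine_mul hF hgd.continuous hgs hs
  have hT'eq : ∀ s ∈ Ioo 0 r, T' s = J s - Q s := by
    intro s hs
    have hcA : ∀ y ∈ tsupport (mol (n := n)), ContinuousAt
        (fun y => fderiv ℝ (fun z => fderiv ℝ w z v) (x + s • y) u) y := by
      intro y hy
      have h1 := (hF _ (affine_mem_closedBall hs.1.le hs.2.le (tsupport_mol hy))).fderiv_right
        (m := 0) (by norm_num)
      exact (h1.continuousAt.comp (f := fun y => x + s • y) (by fun_prop)).clm_apply
        continuousAt_const
    have hi1 := integrable_mul_of_continuousAt_tsupport hcA contDiff_mol.continuous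
      hasCompactSupport_mol
    have hi2 : Integrable fun y => ∑ i, fderiv ℝ (fderiv ℝ w) (x + s • y) (bvec i) v
        * fderiv ℝ Θ y (bvec i) := by
      refine integrable_finsetSum _ fun i _ => integrable_mul_of_continuousAt_tsupport ?_
        (hΘd.fderiv_apply_const _).continuous (hΘc.fderiv_apply_const _)
      intro y hy
      have h1 := (hw2 _ (affine_mem_closedBall hs.1.le hs.2.le
        (hΘs (tsupport_fderiv_const_subset _ _ hy)))).continuousAt_fderiv_fderiv
      exact ((h1.comp (f := fun y => x + s • y) (by fun_prop)).clm_apply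
        continuousAt_const).clm_apply continuousAt_const
    simp only [hJ, hQ, hT']
    rw [← integral_affine_hessian_mul hw2 hΘd hΘs hs.1 hs.2.le v, ← integral_sub hi2 hi1]
    refine integral_congr_ae (Eventually.of_forall fun y => ?_)
    have hmp : ContDiffAt ℝ 2 (molPot (n := n)) y := (contDiff_molPot.of_le two_le_infty).contDiffAt
    have hΘi : ∀ i, fderiv ℝ Θ y (bvec i) = fderiv ℝ mol y u * y i + mol y * u i := by
      intro i
      rw [hΘ, fderiv_fderiv_apply hmp.differentiableAt_fderiv, hmp.fderiv_fderiv_comm,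
        ← fderiv_fderiv_apply hmp.differentiableAt_fderiv]
      have h1 : (fun z : Eucl n => fderiv ℝ molPot z (bvec i)) = fun z => mol z * inner ℝ z (bvec i) :=
        funext fun z => fderiv_molPot z _
      have h2 : HasFDerivAt (fun z : Eucl n => inner ℝ z (bvec i)) (innerSL ℝ (bvec i)) y := by
        have := (innerSL ℝ (bvec i)).hasFDerivAt (x := y)
        refine this.congr_of_eventuallyEq (Eventually.of_forall fun z => ?_)
        simp [real_inner_comm]
      have h3 := ((contDiff_mol (n := n)).differentiable (by simp) y).hasFDerivAt.fun_mul h2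
      rw [h1, HasFDerivAt.fderiv h3]
      simp [bvec, EuclideanSpace.inner_single_right, EuclideanSpace.inner_single_left]
      ring
    by_cases hy : y ∈ tsupport (mol (n := n))
    · simp only
      rw [fderiv_fderiv_apply (hw2 _ (affine_mem_closedBall hs.1.le hs.2.le
        (tsupport_mol hy))).differentiableAt_fderiv,
        fderiv_fderiv_apply (hw2 _ (affine_mem_closedBall hs.1.le hs.2.le
        (tsupport_mol hy))).differentiableAt_fderiv, map_sum_coord (fderiv ℝ (fderiv ℝ w) _) y,
        map_sum_coord (fderiv ℝ (fderiv ℝ w) _) u]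
      simp only [hΘi, hg, sum_apply,
        smul_apply, smul_eq_mul, Finset.sum_mul]
      rw [← Finset.sum_sub_distrib]
      exact Finset.sum_congr rfl fun i _ => by ring
    · have h1 : fderiv ℝ mol y u = 0 := by
        by_contra h
        exact hy (tsupport_fderiv_const_subset _ _ (subset_tsupport _ h))
      simp [hΘi, hg, h1, image_eq_zero_of_notMem_tsupport hy]
  have hQd : ∀ s ∈ Ioo 0 r, HasDerivAt Q (-s⁻¹ * J s) s := by
    intro s hs
    have h1 : HasDerivAt (fun s => -s⁻¹ * T s) (-(-(s ^ 2)⁻¹) * T s + -s⁻¹ * T' s) s :=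
      (hasDerivAt_inv hs.1.ne').neg.mul (hTd s hs)
    have h2 : Q =ᶠ[nhds s] fun s => -s⁻¹ * T s := by
      filter_upwards [isOpen_Ioo.mem_nhds hs] with t ht using hQT t ht.1 ht.2.le
    refine (h1.congr_of_eventuallyEq h2).congr_deriv ?_
    rw [hT'eq s hs, hQT s hs.1 hs.2.le]
    have := hs.1.ne'
    field_simp
    ring
  have hQc : ContinuousOn Q (Icc 0 r) := continuousOn_integral_affine_mul
    (F := fun z => fderiv ℝ (fun z => fderiv ℝ w z v) z u)
    (fun z hz => ((hF z hz).fderiv_right (m := 0) (by norm_num)).continuousAt.clm_apply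
      continuousAt_const) contDiff_mol.continuous tsupport_mol
  obtain ⟨s, hs, hslope⟩ := exists_hasDerivAt_eq_slope Q _ hr0 hQc hQd
  have hJb : |J s| ≤ M * s * (K * ‖u‖ * ‖v‖) := by
    have h0 : ∫ y, fderiv ℝ Θ y v = 0 := by
      have := integral_fderiv_mul_eq_neg (f := fun _ => (1 : ℝ)) (fun x _ => contDiffAt_const)
        (hΘd.of_le one_le_infty) hΘc v
      simpa using this.symm
    have hi := integrable_fderiv_const hΘd hΘc v
    have hi1 : Integrable fun y => lapl w (x + s • y) * fderiv ℝ Θ y v := by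
      refine integrable_mul_of_continuousAt_tsupport ?_
        (hΘd.fderiv_apply_const _).continuous (hΘc.fderiv_apply_const _)
      intro y hy
      have h1 := (hw2 _ (affine_mem_closedBall hs.1.le hs.2.le
        (hΘs (tsupport_fderiv_const_subset _ _ hy)))).continuousAt_fderiv_fderiv
      unfold lapl
      refine tendsto_finsetSum _ fun i _ => ?_
      exact ((h1.comp (f := fun y => x + s • y) (by fun_prop)).clm_apply
        continuousAt_const).clm_apply continuousAt_const
    have h2 : J s = ∫ y, (lapl w (x + s • y) - lapl w x) * fderiv ℝ Θ y v := by
      simp_rw [sub_mul]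
      rw [integral_sub hi1 (hi.const_mul _), integral_const_mul, h0, mul_zero, sub_zero]
    rw [h2]
    refine (abs_integral_mul_le (A := M * s) hi fun y hy => ?_).trans
      (mul_le_mul_of_nonneg_left (hK4 u v) (mul_nonneg hM0 hs.1.le))
    have hyb := mem_closedBall_of_fderiv_ne hΘs hy
    have hy1 : ‖y‖ ≤ 1 := by simpa using hyb
    refine (hM _ (hsub (affine_mem_closedBall hs.1.le hs.2.le hyb))).trans ?_
    refine mul_le_mul_of_nonneg_left ?_ hM0
    rw [add_sub_cancel_left, norm_smul, Real.norm_eq_abs, abs_of_pos hs.1]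
    exact mul_le_of_le_one_right hs.1.le hy1
  have hQr : |Q r| ≤ r⁻¹ * (r⁻¹ * (A * (K * ‖u‖ * ‖v‖))) := by
    rw [hQT r hr0 le_rfl]
    have hgs1 : ContDiff ℝ 1 g := hgd.of_le one_le_infty
    simp only [hT]
    rw [integral_affine_fderiv_mul hw1 hgs1 hgs hr0 le_rfl v,
      abs_mul, abs_mul, abs_neg, abs_of_pos (inv_pos.2 hr0)]
    refine mul_le_mul_of_nonneg_left (mul_le_mul_of_nonneg_left ?_ (inv_pos.2 hr0).le)
      (inv_pos.2 hr0).le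
    refine (abs_integral_mul_le (A := A) (integrable_fderiv_const hgd
      hgc v) fun y hy => hA _ (hsub (affine_mem_closedBall hr0.le le_rfl
        (mem_closedBall_of_fderiv_ne hgs hy)))).trans ?_
    exact mul_le_mul_of_nonneg_left (hK3 u v) hA0
  have hQ0 : Q 0 = fderiv ℝ (fderiv ℝ w) x u v * m := by
    have := fderiv_fderiv_apply (hw2 x (Metric.mem_closedBall_self hr0.le)).differentiableAt_fderiv
      v u
    simp [hQ, hmdef, integral_const_mul, this]
  have h3 : Q r - Q 0 = -s⁻¹ * J s * r := by
    rw [hslope, sub_zero, div_mul_cancel₀ _ hr0.ne']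
  have h4 : |Q 0| ≤ r⁻¹ * (r⁻¹ * (A * (K * ‖u‖ * ‖v‖))) + M * (K * ‖u‖ * ‖v‖) * r := by
    have : Q 0 = Q r - -s⁻¹ * J s * r := by linarith
    rw [this]
    refine (abs_sub _ _).trans (add_le_add hQr ?_)
    rw [abs_mul, abs_of_pos hr0, abs_mul, abs_neg, abs_of_pos (inv_pos.2 hs.1)]
    refine mul_le_mul_of_nonneg_right ?_ hr0.le
    rw [inv_mul_le_iff₀ hs.1]
    exact hJb.trans_eq (by ring)
  rw [hQ0, abs_mul, abs_of_pos hm] at h4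
  rw [Real.norm_eq_abs, ← mul_le_mul_iff_left₀ hm]
  refine h4.trans ?_
  rw [hr]
  have e1 : 4 * K / m * (A / R ^ 2 + R * M) * ‖u‖ * ‖v‖ * m
      = 4 * K * (A / R ^ 2 + R * M) * ‖u‖ * ‖v‖ := by
    field_simp
  rw [e1]
  have e2 : (R / 2)⁻¹ * ((R / 2)⁻¹ * (A * (K * ‖u‖ * ‖v‖))) = 4 * K * (A / R ^ 2) * ‖u‖ * ‖v‖ := by
    field_simp
    ring
  rw [e2]
  have : 0 ≤ K * R * M * ‖u‖ * ‖v‖ := by positivity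
  nlinarith

end Mollifier

section ArzelaAscoli

/-- Arzelà–Ascoli on an arbitrary subset, for eventually bounded and equicontinuous sequences. -/
lemma exists_subseq_tendstoLocallyUniformlyOn {X : Type*} [MetricSpace X]
    [SecondCountableTopology X] {S : Set X} {f : ℕ → X → ℝ}
    (hb : ∀ x ∈ S, ∃ B, ∀ᶠ k in atTop, |f k x| ≤ B)
    (he : ∀ x ∈ S, ∀ ε > 0, ∃ δ > 0, ∀ᶠ k in atTop, ∀ y ∈ S, dist y x < δ →
      |f k y - f k x| ≤ ε) :
    ∃ φ : ℕ → ℕ, StrictMono φ ∧ ∃ g : X → ℝ,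
      TendstoLocallyUniformlyOn (fun k => f (φ k)) g atTop S := by
  obtain ⟨D, hDc, hDd⟩ := TopologicalSpace.exists_countable_dense S
  have hb' : ∀ x ∈ S, ∃ B, ∀ k, |f k x| ≤ B := by
    intro x hx
    obtain ⟨B, hB⟩ := hb x hx
    have h1 : IsBoundedUnder (· ≤ ·) atTop fun k => |f k x| := ⟨B, by simpa using hB⟩
    obtain ⟨B', hB'⟩ := h1.bddAbove_range
    exact ⟨B', fun k => hB' ⟨k, rfl⟩⟩
  choose! B hB using hb'
  have : Countable D := hDc.to_subtype
  have hK : IsCompact (Set.univ.pi fun d : D => Icc (-B d.1.1) (B d.1.1)) :=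
    isCompact_univ_pi fun d => isCompact_Icc
  obtain ⟨g0, -, φ, hφ, hlim⟩ := hK.tendsto_subseq (x := fun k (d : D) => f k d.1.1)
    (fun k d _ => abs_le.1 (hB _ d.1.2 k))
  rw [tendsto_pi_nhds] at hlim
  have hc : ∀ x ∈ S, ∃ l, Tendsto (fun k => f (φ k) x) atTop (nhds l) := by
    intro x hx
    refine cauchySeq_tendsto_of_complete (Metric.cauchySeq_iff'.2 fun ε hε => ?_)
    obtain ⟨δ, hδ, hk⟩ := he x hx (ε / 8) (by positivity)
    obtain ⟨d, hdD, hd⟩ := Metric.mem_closure_iff.1 (hDd.closure_eq ▸ mem_univ (⟨x, hx⟩ : S)) δ hδ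
    have hdx : dist d.1 x < δ := by rw [dist_comm]; exact hd
    have h2 := (hlim ⟨d, hdD⟩).eventually (Metric.ball_mem_nhds _ (show 0 < ε / 8 by positivity))
    obtain ⟨N, hN⟩ := eventually_atTop.1 ((hφ.tendsto_atTop.eventually hk).and h2)
    refine ⟨N, fun k hk => ?_⟩
    have a1 := (hN k hk).1 d.1 d.2 hdx
    have a2 := (hN N le_rfl).1 d.1 d.2 hdx
    have a3 : |f (φ k) d.1 - g0 ⟨d, hdD⟩| < ε / 8 := (hN k hk).2
    have a4 : |f (φ N) d.1 - g0 ⟨d, hdD⟩| < ε / 8 := (hN N le_rfl).2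
    rw [Real.dist_eq]
    rw [abs_le] at a1 a2
    rw [abs_lt] at a3 a4 ⊢
    constructor <;> linarith [a1.1, a1.2, a2.1, a2.2, a3.1, a3.2, a4.1, a4.2]
  choose! g hg using hc
  refine ⟨φ, hφ, g, Metric.tendstoLocallyUniformlyOn_iff.2 fun ε hε x hx => ?_⟩
  obtain ⟨δ, hδ, hk⟩ := he x hx (ε / 4) (by positivity)
  have hk' := hφ.tendsto_atTop.eventually hk
  refine ⟨S ∩ Metric.ball x δ, inter_mem_nhdsWithin _ (Metric.ball_mem_nhds x hδ), ?_⟩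
  have hgy : ∀ y ∈ S, dist y x < δ → |g y - g x| ≤ ε / 4 := fun y hy hyx =>
    le_of_tendsto ((hg y hy).sub (hg x hx)).abs (hk'.mono fun k h => h y hy hyx)
  have h2 := (hg x hx).eventually (Metric.ball_mem_nhds _ (show 0 < ε / 4 by positivity))
  filter_upwards [hk', h2] with k h3 h4 y hy
  have a1 := h3 y hy.1 hy.2
  have a2 := hgy y hy.1 hy.2
  have a3 : |f (φ k) x - g x| < ε / 4 := h4
  rw [Real.dist_eq]
  rw [abs_le] at a1 a2
  rw [abs_lt] at a3 ⊢
  constructor <;> linarith [a1.1, a1.2, a2.1, a2.2, a3.1, a3.2]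

end ArzelaAscoli

section HardyClass

variable {n : ℕ}

lemma integrable_indicator_rpow [NeZero n] {a : ℝ} (ha : -(n : ℝ) < a) (C r : ℝ) :
    Integrable ((Metric.closedBall (0 : Eucl n) r).indicator fun x => C * ‖x‖ ^ a) := by
  rw [integrable_indicator_iff Metric.isClosed_closedBall.measurableSet]
  have h : IntegrableOn (fun x : Eucl n => C * ‖x‖ ^ a) (Metric.ball 0 (r + 1)) := by
    refine integrableOn_ball_of_norm_le_rpow (C := |C|) (α := -a) ?_ ?_ ?_ ?_
    · rw [finrank_euclideanSpace_fin]; exact NeZero.one_le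
    · rw [finrank_euclideanSpace_fin]; linarith
    · refine Eventually.of_forall fun x => ?_
      rw [norm_mul, Real.norm_eq_abs, neg_neg, Real.norm_eq_abs,
        abs_of_nonneg (Real.rpow_nonneg (norm_nonneg x) a)]
    · exact (measurable_norm.pow_const a).const_mul C |>.aestronglyMeasurable
  exact h.mono_set (Metric.closedBall_subset_ball (by linarith))

/-- Bounded functions which almost solve the Hardy equation on a punctured ball. -/
structure ApproxHardy (γ κ R ε : ℝ) (v : Eucl n → ℝ) : Prop where
  smooth : ContDiffOn ℝ 2 v (Metric.ball 0 R \ {0})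
  bound : ∀ x ∈ Metric.ball (0 : Eucl n) R, x ≠ 0 → |v x| ≤ 1
  eqn : ∀ x ∈ Metric.ball (0 : Eucl n) R, x ≠ 0 →
    |lapl v x + γ * v x / ‖x‖ ^ 2| ≤ ε * ‖x‖ ^ (κ - 2)

lemma ApproxHardy.contDiffAt {γ κ R ε : ℝ} {v : Eucl n → ℝ} (hv : ApproxHardy γ κ R ε v)
    {x : Eucl n} (hx : ‖x‖ < R) (hx0 : x ≠ 0) : ContDiffAt ℝ 2 v x :=
  hv.smooth.contDiffAt_of_isOpen (Metric.isOpen_ball.sdiff isClosed_singleton)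
    ⟨by simpa using hx, hx0⟩

lemma ApproxHardy.scale {γ κ R ε : ℝ} {v : Eucl n → ℝ} (hv : ApproxHardy γ κ R ε v)
    {s : ℝ} (hs : 0 < s) : ApproxHardy γ κ (R / s) (ε * s ^ κ) fun x => v (s • x) := by
  have hmem : ∀ x ∈ Metric.ball (0 : Eucl n) (R / s), s • x ∈ Metric.ball (0 : Eucl n) R := by
    intro x hx
    simp only [Metric.mem_ball, dist_zero_right, norm_smul, Real.norm_eq_abs, abs_of_pos hs] at hx ⊢
    rwa [lt_div_iff₀' hs] at hx
  refine ⟨?_, ?_, ?_⟩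
  · refine hv.smooth.comp (by fun_prop) fun x hx => ⟨hmem x hx.1, ?_⟩
    simpa [hs.ne'] using hx.2
  · exact fun x hx hx0 => hv.bound _ (hmem x hx) (by simpa [hs.ne'] using hx0)
  · intro x hx hx0
    have h := hv.eqn _ (hmem x hx) (by simpa [hs.ne'] using hx0)
    have hl : lapl (fun x => v (s • x)) x = s ^ 2 * lapl v (s • x) := by
      simpa using lapl_comp_affine v 0 s x
    have hx1 : 0 < ‖x‖ := norm_pos_iff.2 hx0
    rw [hl]
    rw [norm_smul, Real.norm_eq_abs, abs_of_pos hs] at h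
    have e : s ^ 2 * lapl v (s • x) + γ * v (s • x) / ‖x‖ ^ 2
        = s ^ 2 * (lapl v (s • x) + γ * v (s • x) / (s * ‖x‖) ^ 2) := by field_simp
    rw [e, abs_mul, abs_of_pos (pow_pos hs 2)]
    calc s ^ 2 * |lapl v (s • x) + γ * v (s • x) / (s * ‖x‖) ^ 2|
        ≤ s ^ 2 * (ε * (s * ‖x‖) ^ (κ - 2)) := by gcongr
      _ = ε * s ^ κ * ‖x‖ ^ (κ - 2) := by
        rw [Real.mul_rpow hs.le hx1.le, Real.rpow_sub hs]
        have : s ^ (2 : ℝ) = s ^ 2 := by norm_cast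
        rw [this]
        field_simp

lemma ApproxHardy.neg {γ κ R ε : ℝ} {v : Eucl n → ℝ} (hv : ApproxHardy γ κ R ε v) :
    ApproxHardy γ κ R ε fun x => -v x := by
  refine ⟨hv.smooth.neg, fun x hx hx0 => by simpa using hv.bound x hx hx0, fun x hx hx0 => ?_⟩
  have h := hv.eqn x hx hx0
  have hl : lapl (fun x => -v x) x = -lapl v x := by
    unfold lapl
    have : fderiv ℝ (fun x => -v x) = fun x => -fderiv ℝ v x := funext fun y => fderiv_fun_neg
    rw [this, fderiv_fun_neg]
    simp
  rw [hl, show -lapl v x + γ * -v x / ‖x‖ ^ 2 = -(lapl v x + γ * v x / ‖x‖ ^ 2) by ring, abs_neg]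
  exact h

lemma ApproxHardy.mono {γ κ R ε R' ε' : ℝ} {v : Eucl n → ℝ} (hv : ApproxHardy γ κ R ε v)
    (hR : R' ≤ R) (hε : ε ≤ ε') : ApproxHardy γ κ R' ε' v := by
  have hb : Metric.ball (0 : Eucl n) R' ⊆ Metric.ball 0 R := Metric.ball_subset_ball hR
  refine ⟨hv.smooth.mono (diff_subset_diff_left hb), fun x hx => hv.bound x (hb hx),
    fun x hx hx0 => (hv.eqn x (hb hx) hx0).trans ?_⟩
  gcongr

lemma ApproxHardy.gradient (n : ℕ) [NeZero n] (γ κ : ℝ) (hκ0 : 0 < κ) (hκ2 : κ < 2) :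
    ∃ C : ℝ, 0 < C ∧ ∀ (R ε : ℝ) (v : Eucl n → ℝ), ApproxHardy γ κ R ε v → 0 ≤ ε →
      ∀ x : Eucl n, x ≠ 0 → 2 * ‖x‖ < R → ε * ‖x‖ ^ κ ≤ 1 → ‖fderiv ℝ v x‖ ≤ C / ‖x‖ := by
  obtain ⟨C, hC, hest⟩ := gradient_estimate n
  refine ⟨C * (2 + (2 * |γ| + 2)), by positivity, fun R ε v hv hε x hx0 hxR hεx => ?_⟩
  have hx : 0 < ‖x‖ := norm_pos_iff.2 hx0
  have hz : ∀ z ∈ Metric.ball x (‖x‖ / 2), ‖x‖ / 2 < ‖z‖ ∧ ‖z‖ < 2 * ‖x‖ := by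
    intro z hz
    have h1 : ‖z - x‖ < ‖x‖ / 2 := by simpa [dist_eq_norm] using hz
    have h2 := norm_sub_norm_le x z
    have h3 := norm_sub_norm_le z x
    rw [norm_sub_rev] at h2
    constructor <;> linarith
  have hz0 : ∀ z ∈ Metric.ball x (‖x‖ / 2), z ∈ Metric.ball (0 : Eucl n) R ∧ z ≠ 0 := by
    intro z hz'
    refine ⟨by simpa using (hz z hz').2.trans hxR, ?_⟩
    rw [← norm_pos_iff]
    linarith [(hz z hz').1]
  have h := hest v x (‖x‖ / 2) 1 ((4 * |γ| + 4) / ‖x‖ ^ 2) (by positivity)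
    (hv.smooth.mono fun z hz' => ⟨(hz0 z hz').1, (hz0 z hz').2⟩)
    (fun z hz' => hv.bound z (hz0 z hz').1 (hz0 z hz').2) ?_
  · refine h.trans (le_of_eq ?_)
    field_simp
    ring
  · intro z hz'
    have h1 := hv.eqn z (hz0 z hz').1 (hz0 z hz').2
    have h2 := hv.bound z (hz0 z hz').1 (hz0 z hz').2
    obtain ⟨h3, -⟩ := hz z hz'
    have hzp : 0 < ‖z‖ := by linarith
    have h4 : |γ * v z / ‖z‖ ^ 2| ≤ 4 * |γ| / ‖x‖ ^ 2 := by
      rw [abs_div, abs_mul, abs_of_pos (pow_pos hzp 2)]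
      calc |γ| * |v z| / ‖z‖ ^ 2 ≤ |γ| * 1 / (‖x‖ / 2) ^ 2 := by gcongr
        _ = _ := by ring
    have h5 : ε * ‖z‖ ^ (κ - 2) ≤ 4 / ‖x‖ ^ 2 := by
      have h6 : ‖z‖ ^ (κ - 2) ≤ (‖x‖ / 2) ^ (κ - 2) :=
        Real.rpow_le_rpow_of_nonpos (by positivity) h3.le (by linarith)
      have h7 : (‖x‖ / 2) ^ (κ - 2) ≤ 4 * (‖x‖ ^ κ / ‖x‖ ^ 2) := by
        rw [Real.div_rpow hx.le zero_le_two, Real.rpow_sub hx, Real.rpow_two,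
          Real.rpow_sub zero_lt_two, Real.rpow_two]
        have : (1 : ℝ) ≤ 2 ^ κ := Real.one_le_rpow one_le_two hκ0.le
        rw [div_div_eq_mul_div, div_le_iff₀ (by positivity)]
        have : 0 ≤ ‖x‖ ^ κ / ‖x‖ ^ 2 := by positivity
        nlinarith
      calc ε * ‖z‖ ^ (κ - 2) ≤ ε * (4 * (‖x‖ ^ κ / ‖x‖ ^ 2)) := by gcongr; exact h6.trans h7
        _ = 4 * (ε * ‖x‖ ^ κ) / ‖x‖ ^ 2 := by ring
        _ ≤ 4 * 1 / ‖x‖ ^ 2 := by gcongr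
        _ = _ := by ring
    have h8 : |lapl v z| ≤ |lapl v z + γ * v z / ‖z‖ ^ 2| + |γ * v z / ‖z‖ ^ 2| := by
      have := abs_sub (lapl v z + γ * v z / ‖z‖ ^ 2) (γ * v z / ‖z‖ ^ 2)
      rwa [add_sub_cancel_right] at this
    calc |lapl v z| ≤ 4 / ‖x‖ ^ 2 + 4 * |γ| / ‖x‖ ^ 2 := by linarith
      _ = _ := by ring

end HardyClass

section HardyPair

variable {n : ℕ}

lemma exists_puncture (n : ℕ) : ∃ (ψ : Eucl n → ℝ) (K : ℝ), ContDiff ℝ (⊤ : ℕ∞) ψ ∧ 0 ≤ K ∧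
    (∀ y, ‖y‖ ≤ 1 → ψ y = 0) ∧ (∀ y, 2 < ‖y‖ → ψ y = 1) ∧ (∀ y, 0 ≤ ψ y ∧ ψ y ≤ 1) ∧
    (∀ y, 2 < ‖y‖ → fderiv ℝ ψ y = 0) ∧ ∀ y, ‖y‖ * ‖fderiv ℝ ψ y‖ ≤ K := by
  let f : ContDiffBump (0 : Eucl n) := ⟨1, 2, one_pos, one_lt_two⟩
  have hf : ContDiff ℝ (⊤ : ℕ∞) f := f.contDiff
  have hD : ∀ y, fderiv ℝ (fun y => 1 - f y) y = -fderiv ℝ f y := fun y => by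
    rw [fderiv_const_sub]
  have h2 : ∀ y : Eucl n, 2 < ‖y‖ → y ∉ tsupport f := fun y hy => by
    rw [f.tsupport_eq]
    simpa [f] using hy
  have hcD : HasCompactSupport (fderiv ℝ f) := f.hasCompactSupport.fderiv ℝ
  obtain ⟨K, hK⟩ := hcD.exists_bound_of_continuous (hf.continuous_fderiv (by simp))
  refine ⟨fun y => 1 - f y, 2 * |K|, contDiff_const.sub hf, by positivity, fun y hy => ?_,
    fun y hy => ?_, fun y => ?_, fun y hy => ?_, fun y => ?_⟩
  · show 1 - f y = 0
    rw [f.one_of_mem_closedBall (by simpa [f] using hy), sub_self]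
  · show 1 - f y = 1
    rw [image_eq_zero_of_notMem_tsupport (h2 y hy), sub_zero]
  · exact ⟨by linarith [f.le_one (x := y)], by linarith [f.nonneg (x := y)]⟩
  · rw [hD, image_eq_zero_of_notMem_tsupport
      (fun h => h2 y hy (tsupport_fderiv_subset ℝ h)), neg_zero]
  · rw [hD, norm_neg]
    by_cases hy : 2 < ‖y‖
    · rw [image_eq_zero_of_notMem_tsupport
        (fun h => h2 y hy (tsupport_fderiv_subset ℝ h)), norm_zero, mul_zero]
      positivity
    · exact mul_le_mul (not_lt.1 hy) ((hK y).trans (le_abs_self K)) (norm_nonneg _) zero_le_two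

lemma integrable_abs_molPot_rpow [NeZero n] {a : ℝ} (ha : -(n : ℝ) < a) :
    Integrable fun x : Eucl n => |molPot x| * ‖x‖ ^ a := by
  have hc : Continuous (molPot (n := n)) := contDiff_molPot.continuous
  obtain ⟨K, hK⟩ := hasCompactSupport_molPot.exists_bound_of_continuous hc
  refine (integrable_indicator_rpow ha K 1).mono'
    (hc.abs.aestronglyMeasurable.mul (measurable_norm.pow_const a).aestronglyMeasurable)
    (Eventually.of_forall fun x => ?_)
  have h0 : 0 ≤ ‖x‖ ^ a := Real.rpow_nonneg (norm_nonneg x) a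
  rw [norm_mul, norm_of_nonneg h0, Real.norm_eq_abs, abs_abs]
  by_cases hx : x ∈ Metric.closedBall (0 : Eucl n) 1
  · rw [indicator_of_mem hx]
    exact mul_le_mul_of_nonneg_right (hK x) h0
  · rw [indicator_of_notMem hx, image_eq_zero_of_notMem_tsupport (fun h => hx (tsupport_molPot h))]
    simp

lemma ApproxHardy.pair (hn : 3 ≤ n) [NeZero n] {γ κ : ℝ} (hκ0 : 0 < κ) (hκ2 : κ < 2)
    {R₁ R₂ ε₁ ε₂ : ℝ} {v₁ v₂ : Eucl n → ℝ} (h₁ : ApproxHardy γ κ R₁ ε₁ v₁)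
    (h₂ : ApproxHardy γ κ R₂ ε₂ v₂) (hR₁ : 2 < R₁) (hR₂ : 2 < R₂) (hε₁ : 0 ≤ ε₁) (hε₂ : 0 ≤ ε₂)
    (hε₁' : ε₁ ≤ 1) (hε₂' : ε₂ ≤ 1) :
    |∫ y, (v₂ y * fderiv ℝ v₁ y y - v₁ y * fderiv ℝ v₂ y y) * mol y|
      ≤ (∫ y : Eucl n, |molPot y| * ‖y‖ ^ (κ - 2)) * (ε₁ + ε₂) := by
  have hn' : (3 : ℝ) ≤ n := by exact_mod_cast hn
  obtain ⟨C, hC, hgrad⟩ := ApproxHardy.gradient n γ κ hκ0 hκ2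
  obtain ⟨ψ, K, hψ, hK0, hψ0, hψ1, hψb, hDψ, hψK⟩ := exists_puncture n
  have hmp : ContDiff ℝ (⊤ : ℕ∞) (molPot (n := n)) := contDiff_molPot
  obtain ⟨K₀, hK₀⟩ := hasCompactSupport_molPot.exists_bound_of_continuous (hmp.continuous)
  obtain ⟨K₁, hK₁⟩ := (hasCompactSupport_molPot.fderiv ℝ).exists_bound_of_continuous
    (hmp.continuous_fderiv (by simp) : Continuous (fderiv ℝ (molPot (n := n))))
  let η : ℕ → Eucl n → ℝ := fun k x => ψ (((k : ℝ) + 1) • x)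
  have hη : ∀ k, ContDiff ℝ (⊤ : ℕ∞) (η k) := fun k => hψ.comp (contDiff_const_smul _)
  have hDη : ∀ k x, fderiv ℝ (η k) x = ((k : ℝ) + 1) • fderiv ℝ ψ (((k : ℝ) + 1) • x) := by
    intro k x
    have := (((hψ.differentiable (by simp)).differentiableAt
      (x := ((k : ℝ) + 1) • x)).hasFDerivAt.comp x
      (((k : ℝ) + 1) • ContinuousLinearMap.id ℝ (Eucl n)).hasFDerivAt).fderiv
    refine this.trans ?_
    ext v
    simp
  have hDηb : ∀ k x, ‖x‖ * ‖fderiv ℝ (η k) x‖ ≤ K := by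
    intro k x
    have h := hψK (((k : ℝ) + 1) • x)
    have hk : (0 : ℝ) ≤ (k : ℝ) + 1 := by positivity
    rw [norm_smul, norm_of_nonneg hk] at h
    rw [hDη, norm_smul, norm_of_nonneg hk]
    linarith
  let g : ℕ → Eucl n → ℝ := fun k x => molPot x * η k x
  have hg : ∀ k, ContDiff ℝ (⊤ : ℕ∞) (g k) := fun k => hmp.mul (hη k)
  have hgc : ∀ k, HasCompactSupport (g k) := fun k => hasCompactSupport_molPot.mul_right
  have hts1 : ∀ k, ∀ x ∈ tsupport (g k), ‖x‖ ≤ 1 := fun k x hx => by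
    simpa using tsupport_molPot (tsupport_mul_subset_left hx)
  have hts0 : ∀ k, ∀ x ∈ tsupport (g k), x ≠ 0 := by
    rintro k x hx rfl
    refine (notMem_tsupport_iff_eventuallyEq.2 ?_) hx
    filter_upwards [Metric.ball_mem_nhds (0 : Eucl n)
      (show (0 : ℝ) < 1 / ((k : ℝ) + 1) by positivity)] with y hy
    have hk : (0 : ℝ) < (k : ℝ) + 1 := by positivity
    have : η k y = 0 := by
      refine hψ0 _ ?_
      rw [norm_smul, norm_of_nonneg hk.le]
      have h2 : ‖y‖ < 1 / ((k : ℝ) + 1) := by simpa using hy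
      rw [lt_div_iff₀ hk] at h2
      linarith
    simp [g, this]
  have hcd₁ : ∀ x : Eucl n, ‖x‖ ≤ 1 → x ≠ 0 → ContDiffAt ℝ 2 v₁ x := fun x hx hx0 =>
    h₁.contDiffAt (by linarith) hx0
  have hcd₂ : ∀ x : Eucl n, ‖x‖ ≤ 1 → x ≠ 0 → ContDiffAt ℝ 2 v₂ x := fun x hx hx0 =>
    h₂.contDiffAt (by linarith) hx0
  let f : Fin n → Eucl n → ℝ := fun i x => v₂ x * fderiv ℝ v₁ x (bvec i) -
    v₁ x * fderiv ℝ v₂ x (bvec i)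
  have hcd1 : ∀ (v : Eucl n → ℝ) (x : Eucl n) (i : Fin n), ContDiffAt ℝ 2 v x →
      ContDiffAt ℝ 1 (fun x => fderiv ℝ v x (bvec i)) x := fun v x i hv =>
    (hv.fderiv_right (m := 1) (by norm_num)).clm_apply contDiffAt_const
  have hf : ∀ i (x : Eucl n), ‖x‖ ≤ 1 → x ≠ 0 → ContDiffAt ℝ 1 (f i) x := by
    intro i x hx hx0
    exact (((hcd₂ x hx hx0).of_le (by norm_num)).mul (hcd1 _ x i (hcd₁ x hx hx0))).sub
      (((hcd₁ x hx hx0).of_le (by norm_num)).mul (hcd1 _ x i (hcd₂ x hx hx0)))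
  have hdiv : ∀ x : Eucl n, ‖x‖ ≤ 1 → x ≠ 0 → ∑ i, fderiv ℝ (f i) x (bvec i)
      = v₂ x * lapl v₁ x - v₁ x * lapl v₂ x := by
    intro x hx hx0
    have d₁ := (hcd₁ x hx hx0).differentiableAt_two
    have d₂ := (hcd₂ x hx hx0).differentiableAt_two
    have e₁ := (hcd₁ x hx hx0).differentiableAt_fderiv
    have e₂ := (hcd₂ x hx hx0).differentiableAt_fderiv
    have key : ∀ i, fderiv ℝ (f i) x (bvec i) = v₂ x * fderiv ℝ (fderiv ℝ v₁) x (bvec i) (bvec i)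
        - v₁ x * fderiv ℝ (fderiv ℝ v₂) x (bvec i) (bvec i) := by
      intro i
      have E₁ : HasFDerivAt (fun x => fderiv ℝ v₁ x (bvec i))
        (fderiv ℝ (fun x => fderiv ℝ v₁ x (bvec i)) x) x :=
        (e₁.clm_apply (differentiableAt_const _)).hasFDerivAt
      have E₂ : HasFDerivAt (fun x => fderiv ℝ v₂ x (bvec i))
        (fderiv ℝ (fun x => fderiv ℝ v₂ x (bvec i)) x) x :=
        (e₂.clm_apply (differentiableAt_const _)).hasFDerivAt
      have := ((d₂.hasFDerivAt.fun_mul E₁).fun_sub (d₁.hasFDerivAt.fun_mul E₂)).fderiv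
      rw [show fderiv ℝ (f i) x = _ from this]
      simp only [sub_apply, add_apply, smul_apply, fderiv_fderiv_apply e₁, fderiv_fderiv_apply e₂,
        smul_eq_mul]
      ring
    simp_rw [key, Finset.sum_sub_distrib, ← Finset.mul_sum]
    rfl
  have hLHS : ∀ k, |∫ x, ∑ i, f i x * fderiv ℝ (g k) x (bvec i)|
      ≤ (∫ y : Eucl n, |molPot y| * ‖y‖ ^ (κ - 2)) * (ε₁ + ε₂) := by
    intro k
    have hInt : ∀ i, Integrable fun x => fderiv ℝ (f i) x (bvec i) * g k x := fun i =>
      integrable_mul_of_continuousAt_tsupport (fun x hx =>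
        (((hf i x (hts1 k x hx) (hts0 k x hx)).fderiv_right (m := 0)
          (by norm_num)).continuousAt.clm_apply continuousAt_const)) (hg k).continuous (hgc k)
    have hInt' : ∀ i, Integrable fun x => f i x * fderiv ℝ (g k) x (bvec i) := fun i =>
      integrable_mul_of_continuousAt_tsupport (fun x hx =>
        (hf i x (hts1 k x (tsupport_fderiv_const_subset _ _ hx))
          (hts0 k x (tsupport_fderiv_const_subset _ _ hx))).continuousAt)
        ((hg k).fderiv_apply_const _).continuous ((hgc k).fderiv_apply_const _)
    have e1 : ∫ x, ∑ i, f i x * fderiv ℝ (g k) x (bvec i)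
        = -∫ x, ∑ i, fderiv ℝ (f i) x (bvec i) * g k x := by
      rw [integral_finsetSum _ fun i _ => hInt' i, integral_finsetSum _ fun i _ => hInt i,
        ← Finset.sum_neg_distrib]
      refine Finset.sum_congr rfl fun i _ => ?_
      rw [integral_fderiv_mul_eq_neg (fun x hx => hf i x (hts1 k x hx) (hts0 k x hx))
        ((hg k).of_le (by simp)) (hgc k), neg_neg]
    rw [e1, abs_neg, ← integral_mul_const]
    have hi : Integrable fun y : Eucl n => |molPot y| * ‖y‖ ^ (κ - 2) * (ε₁ + ε₂) :=
      (integrable_abs_molPot_rpow (by linarith)).mul_const _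
    rw [← Real.norm_eq_abs]
    refine norm_integral_le_of_norm_le hi (Eventually.of_forall fun x => ?_)
    rw [← Finset.sum_mul]
    by_cases hx : x ∈ tsupport (g k)
    · have hx1 := hts1 k x hx
      have hx0 := hts0 k x hx
      rw [hdiv x hx1 hx0]
      have m₁ : x ∈ Metric.ball (0 : Eucl n) R₁ := by simpa using (by linarith : ‖x‖ < R₁)
      have m₂ : x ∈ Metric.ball (0 : Eucl n) R₂ := by simpa using (by linarith : ‖x‖ < R₂)
      have a₁ := h₁.eqn x m₁ hx0
      have a₂ := h₂.eqn x m₂ hx0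
      have b₁ := h₁.bound x m₁ hx0
      have b₂ := h₂.bound x m₂ hx0
      have e : v₂ x * lapl v₁ x - v₁ x * lapl v₂ x = v₂ x * (lapl v₁ x + γ * v₁ x / ‖x‖ ^ 2)
        - v₁ x * (lapl v₂ x + γ * v₂ x / ‖x‖ ^ 2) := by ring
      have hw : 0 ≤ ‖x‖ ^ (κ - 2) := Real.rpow_nonneg (norm_nonneg x) _
      have hb : |v₂ x * lapl v₁ x - v₁ x * lapl v₂ x| ≤ (ε₁ + ε₂) * ‖x‖ ^ (κ - 2) := by
        rw [e]
        refine (abs_sub _ _).trans ?_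
        rw [abs_mul, abs_mul]
        calc _ ≤ 1 * (ε₁ * ‖x‖ ^ (κ - 2)) + 1 * (ε₂ * ‖x‖ ^ (κ - 2)) := by gcongr
          _ = _ := by ring
      have hη1 : |η k x| ≤ 1 := by
        rw [abs_le]; constructor <;> linarith [(hψb (((k : ℝ) + 1) • x)).1,
          (hψb (((k : ℝ) + 1) • x)).2, show η k x = ψ (((k : ℝ) + 1) • x) from rfl]
      have hg1 : |g k x| ≤ |molPot x| := by
        simp only [g, abs_mul]
        exact mul_le_of_le_one_right (abs_nonneg _) hη1
      rw [norm_mul, Real.norm_eq_abs, Real.norm_eq_abs]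
      calc _ ≤ ((ε₁ + ε₂) * ‖x‖ ^ (κ - 2)) * |molPot x| := by gcongr
        _ = _ := by ring
    · rw [image_eq_zero_of_notMem_tsupport hx, mul_zero, norm_zero]
      have hw : 0 ≤ ‖x‖ ^ (κ - 2) := Real.rpow_nonneg (norm_nonneg x) _
      positivity
  have hfb : ∀ i (x : Eucl n), ‖x‖ < 1 → x ≠ 0 → |f i x| ≤ 2 * C / ‖x‖ := by
    intro i x hx hx0
    have m₁ : x ∈ Metric.ball (0 : Eucl n) R₁ := by simpa using (by linarith : ‖x‖ < R₁)
    have m₂ : x ∈ Metric.ball (0 : Eucl n) R₂ := by simpa using (by linarith : ‖x‖ < R₂)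
    have hxk : ‖x‖ ^ κ ≤ 1 := Real.rpow_le_one (norm_nonneg x) hx.le hκ0.le
    have hxk0 : 0 ≤ ‖x‖ ^ κ := Real.rpow_nonneg (norm_nonneg x) κ
    have a₁ := hgrad _ _ _ h₁ hε₁ x hx0 (by linarith) (by nlinarith)
    have a₂ := hgrad _ _ _ h₂ hε₂ x hx0 (by linarith) (by nlinarith)
    have b₁ := h₁.bound x m₁ hx0
    have b₂ := h₂.bound x m₂ hx0
    have c₁ : |fderiv ℝ v₁ x (bvec i)| ≤ C / ‖x‖ := by
      refine ((fderiv ℝ v₁ x).le_opNorm _).trans ?_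
      rwa [norm_bvec, mul_one]
    have c₂ : |fderiv ℝ v₂ x (bvec i)| ≤ C / ‖x‖ := by
      refine ((fderiv ℝ v₂ x).le_opNorm _).trans ?_
      rwa [norm_bvec, mul_one]
    refine (abs_sub _ _).trans ?_
    rw [abs_mul, abs_mul]
    calc _ ≤ 1 * (C / ‖x‖) + 1 * (C / ‖x‖) := by gcongr
      _ = _ := by ring
  have hDg : ∀ k x, fderiv ℝ (g k) x = molPot x • fderiv ℝ (η k) x + η k x • fderiv ℝ molPot x :=
    fun k x => fderiv_fun_mul (hmp.differentiable (by simp)).differentiableAt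
      ((hη k).differentiable (by simp)).differentiableAt
  have hfc : ∀ i, ContinuousOn (f i) (Metric.closedBall 0 1 \ {0}) := fun i x hx =>
    (hf i x (by simpa using hx.1) hx.2).continuousAt.continuousWithinAt
  have htend : Tendsto (fun k => ∫ x, ∑ i, f i x * fderiv ℝ (g k) x (bvec i)) atTop
      (nhds (∫ x, ∑ i, f i x * fderiv ℝ molPot x (bvec i))) := by
    have hae := ae_ne_zero n
    refine tendsto_integral_of_dominated_convergence
      ((Metric.closedBall (0 : Eucl n) 1).indicator fun x =>
        ((n : ℝ) * (2 * C * (|K₀| * K + |K₁|))) * ‖x‖ ^ (-2 : ℝ)) ?_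
      (integrable_indicator_rpow (by linarith) _ _) ?_ ?_
    · intro k
      have : (fun x => ∑ i, f i x * fderiv ℝ (g k) x (bvec i))
          = ∑ i, fun x => f i x * fderiv ℝ (g k) x (bvec i) := by
        ext x; simp
      rw [this]
      refine Finset.aestronglyMeasurable_sum _ fun i _ => ?_
      refine aestronglyMeasurable_mul_weight ((hg k).fderiv_apply_const _).continuous
        ((hfc i).mono ?_)
      intro x hx
      exact ⟨by simpa using hts1 k x (tsupport_fderiv_const_subset _ _ hx.1), hx.2⟩
    · intro k
      have hsph : ∀ᵐ x : Eucl n, x ∉ Metric.sphere (0 : Eucl n) 1 := by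
        rw [ae_iff]
        simpa only [not_not] using! Measure.addHaar_sphere volume (0 : Eucl n) 1
      filter_upwards [hae, hsph] with x hx0 hxs
      by_cases hx : x ∈ Metric.closedBall (0 : Eucl n) 1
      · rw [indicator_of_mem hx]
        have hx' : ‖x‖ < 1 := by
          refine lt_of_le_of_ne (by simpa using hx) (by simpa using hxs)
        have hxp : 0 < ‖x‖ := norm_pos_iff.2 hx0
        have hη1 : |η k x| ≤ 1 := by
          rw [abs_le]; constructor <;> linarith [(hψb (((k : ℝ) + 1) • x)).1,
            (hψb (((k : ℝ) + 1) • x)).2, show η k x = ψ (((k : ℝ) + 1) • x) from rfl]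
        have hDgb : ‖fderiv ℝ (g k) x‖ ≤ (|K₀| * K + |K₁|) / ‖x‖ := by
          rw [hDg]
          have q1 : ‖molPot x • fderiv ℝ (η k) x‖ ≤ |K₀| * (K / ‖x‖) := by
            rw [norm_smul]
            refine mul_le_mul ((hK₀ x).trans (le_abs_self _)) ?_ (norm_nonneg _) (abs_nonneg _)
            rw [le_div_iff₀ hxp]
            linarith [hDηb k x]
          have q2 : ‖η k x • fderiv ℝ molPot x‖ ≤ |K₁| / ‖x‖ := by
            rw [norm_smul, Real.norm_eq_abs]
            calc _ ≤ 1 * |K₁| := mul_le_mul hη1 ((hK₁ x).trans (le_abs_self _))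
                    (norm_nonneg _) zero_le_one
              _ ≤ |K₁| / ‖x‖ := by
                rw [one_mul, le_div_iff₀ hxp]
                exact mul_le_of_le_one_right (abs_nonneg _) hx'.le
          refine (norm_add_le _ _).trans ((add_le_add q1 q2).trans (le_of_eq ?_))
          ring
        refine (norm_sum_le _ _).trans ?_
        calc ∑ i, ‖f i x * fderiv ℝ (g k) x (bvec i)‖
            ≤ ∑ i : Fin n, 2 * C / ‖x‖ * ((|K₀| * K + |K₁|) / ‖x‖) := by
              refine Finset.sum_le_sum fun i _ => ?_
              rw [norm_mul]
              refine mul_le_mul (hfb i x hx' hx0) ?_ (norm_nonneg _) (by positivity)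
              refine ((fderiv ℝ (g k) x).le_opNorm _).trans ?_
              rwa [norm_bvec, mul_one]
          _ = _ := by
            rw [Finset.sum_const, Finset.card_univ, Fintype.card_fin, nsmul_eq_mul,
              Real.rpow_neg hxp.le, Real.rpow_two]
            field_simp
      · rw [indicator_of_notMem hx]
        have : ∀ i, fderiv ℝ (g k) x (bvec i) = 0 := fun i =>
          image_eq_zero_of_notMem_tsupport (f := fun x => fderiv ℝ (g k) x (bvec i)) fun h =>
            hx (by simpa using hts1 k x (tsupport_fderiv_const_subset _ _ h))
        simp [this]
    · filter_upwards [hae] with x hx0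
      refine tendsto_finsetSum _ fun i _ => Tendsto.const_mul _ ?_
      refine tendsto_const_nhds.congr' ?_
      have hxp : 0 < ‖x‖ := norm_pos_iff.2 hx0
      have : ∀ᶠ k : ℕ in atTop, 2 / ‖x‖ < (k : ℝ) + 1 :=
        (tendsto_natCast_atTop_atTop.atTop_add tendsto_const_nhds).eventually_gt_atTop _
      filter_upwards [this] with k hk
      have hk2 : 2 < ‖((k : ℝ) + 1) • x‖ := by
        rw [norm_smul, norm_of_nonneg (by positivity)]
        rwa [div_lt_iff₀ hxp] at hk
      rw [hDg, hDη, hDψ _ hk2, show η k x = 1 from hψ1 _ hk2]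
      simp
  have hfin := le_of_tendsto' htend.abs hLHS
  refine le_of_eq_of_le (congrArg abs (integral_congr_ae (Eventually.of_forall fun x => ?_))) hfin
  simp only [fderiv_molPot, inner_bvec, f]
  conv_lhs => rw [map_sum_coord (fderiv ℝ v₁ x) x, map_sum_coord (fderiv ℝ v₂ x) x]
  simp only [smul_eq_mul]
  rw [Finset.mul_sum, Finset.mul_sum, ← Finset.sum_sub_distrib, Finset.sum_mul]
  refine Finset.sum_congr rfl fun i _ => ?_
  ring

end HardyPair

section HardyCorrelation

variable {n : ℕ}

lemma mem_closedBall_of_tsupport_mol {y : Eucl n} (hy : y ∈ tsupport (mol (n := n))) : ‖y‖ ≤ 1 := by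
  simpa using tsupport_mol hy

lemma ApproxHardy.correlation (n : ℕ) (hn : 3 ≤ n) [NeZero n] (γ κ : ℝ) (hκ0 : 0 < κ) (hκ2 : κ < 2) :
    ∃ C : ℝ, 0 ≤ C ∧ ∀ (R₁ R₂ ε₁ ε₂ : ℝ) (v₁ v₂ : Eucl n → ℝ), ApproxHardy γ κ R₁ ε₁ v₁ →
      ApproxHardy γ κ R₂ ε₂ v₂ → 0 ≤ ε₁ → 0 ≤ ε₂ → ∀ a b : ℝ, a ≤ b →
      2 * exp b < R₁ → 2 * exp (-a) < R₂ → ε₁ * exp (κ * b) < 1 → ε₂ * exp (-(κ * a)) < 1 →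
      |(∫ y, v₁ (exp b • y) * v₂ (exp (-b) • y) * mol y)
        - ∫ y, v₁ (exp a • y) * v₂ (exp (-a) • y) * mol y|
        ≤ C * (ε₁ * exp (κ * b) + ε₂ * exp (-(κ * a))) := by
  obtain ⟨C, hC, hgrad⟩ := ApproxHardy.gradient n γ κ hκ0 hκ2
  set C₂ := ∫ y : Eucl n, |molPot y| * ‖y‖ ^ (κ - 2) with hC₂
  have hC₂0 : 0 ≤ C₂ := integral_nonneg fun y =>
    mul_nonneg (abs_nonneg _) (Real.rpow_nonneg (norm_nonneg _) _)
  refine ⟨C₂ / κ, by positivity, ?_⟩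
  intro R₁ R₂ ε₁ ε₂ v₁ v₂ h₁ h₂ hε₁ hε₂ a b hab hb₁ ha₂ hb₁' ha₂'
  let I : Set ℝ := {l | 2 * exp l < R₁ ∧ 2 * exp (-l) < R₂ ∧ ε₁ * exp (κ * l) < 1 ∧
    ε₂ * exp (-(κ * l)) < 1}
  have hI : IsOpen I := by
    simp only [I, setOf_and]
    refine IsOpen.inter ?_ (IsOpen.inter ?_ (IsOpen.inter ?_ ?_)) <;>
      exact isOpen_lt (by fun_prop) (by fun_prop)
  have hIab : ∀ l ∈ Icc a b, l ∈ I := by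
    intro l hl
    have e1 : exp l ≤ exp b := exp_le_exp.2 hl.2
    have e2 : exp (-l) ≤ exp (-a) := exp_le_exp.2 (by linarith [hl.1])
    have e3 : exp (κ * l) ≤ exp (κ * b) := exp_le_exp.2 (by nlinarith [hl.2])
    have e4 : exp (-(κ * l)) ≤ exp (-(κ * a)) := exp_le_exp.2 (by nlinarith [hl.1])
    exact ⟨by linarith, by linarith, (mul_le_mul_of_nonneg_left e3 hε₁).trans_lt hb₁',
      (mul_le_mul_of_nonneg_left e4 hε₂).trans_lt ha₂'⟩
  have hns : ∀ (l : ℝ) (y : Eucl n), ‖exp l • y‖ = exp l * ‖y‖ := fun l y => by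
    rw [norm_smul, norm_of_nonneg (exp_pos l).le]
  have hle : ∀ (l : ℝ) (y : Eucl n), ‖y‖ ≤ 1 → ‖exp l • y‖ ≤ exp l := fun l y hy => by
    rw [hns]; exact mul_le_of_le_one_right (exp_pos l).le hy
  have hne : ∀ (l : ℝ) (y : Eucl n), y ≠ 0 → exp l • y ≠ 0 := fun l y hy =>
    smul_ne_zero (exp_pos l).ne' hy
  have hrp : ∀ (l : ℝ) (y : Eucl n), ‖y‖ ≤ 1 → ‖exp l • y‖ ^ κ ≤ exp (κ * l) := fun l y hy => by
    calc ‖exp l • y‖ ^ κ ≤ exp l ^ κ := Real.rpow_le_rpow (norm_nonneg _) (hle l y hy) hκ0.le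
      _ = exp (κ * l) := by rw [← Real.exp_mul, mul_comm]
  have hcd₁ : ∀ l ∈ I, ∀ y : Eucl n, ‖y‖ ≤ 1 → y ≠ 0 → ContDiffAt ℝ 2 v₁ (exp l • y) :=
    fun l hl y hy hy0 => h₁.contDiffAt (by linarith [hle l y hy, hl.1, exp_pos l]) (hne l y hy0)
  have hcd₂ : ∀ l ∈ I, ∀ y : Eucl n, ‖y‖ ≤ 1 → y ≠ 0 → ContDiffAt ℝ 2 v₂ (exp (-l) • y) :=
    fun l hl y hy hy0 => h₂.contDiffAt (by linarith [hle (-l) y hy, hl.2.1, exp_pos (-l)])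
      (hne (-l) y hy0)
  have hb1 : ∀ l ∈ I, ∀ y : Eucl n, ‖y‖ ≤ 1 → y ≠ 0 → |v₁ (exp l • y)| ≤ 1 :=
    fun l hl y hy hy0 => h₁.bound _
      (by simpa using (by linarith [hle l y hy, hl.1, exp_pos l] : ‖exp l • y‖ < R₁)) (hne l y hy0)
  have hb2 : ∀ l ∈ I, ∀ y : Eucl n, ‖y‖ ≤ 1 → y ≠ 0 → |v₂ (exp (-l) • y)| ≤ 1 :=
    fun l hl y hy hy0 => h₂.bound _
      (by simpa using (by linarith [hle (-l) y hy, hl.2.1, exp_pos (-l)] : ‖exp (-l) • y‖ < R₂))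
      (hne (-l) y hy0)
  have hradial : ∀ (v : Eucl n → ℝ) (z : Eucl n), z ≠ 0 → ‖fderiv ℝ v z‖ ≤ C / ‖z‖ →
      |fderiv ℝ v z z| ≤ C := fun v z hz h => by
    refine ((fderiv ℝ v z).le_opNorm z).trans ?_
    rwa [← le_div_iff₀ (norm_pos_iff.2 hz)]
  have hd1 : ∀ l ∈ I, ∀ y : Eucl n, ‖y‖ ≤ 1 → y ≠ 0 →
      |fderiv ℝ v₁ (exp l • y) (exp l • y)| ≤ C := fun l hl y hy hy0 =>
    hradial _ _ (hne l y hy0) (hgrad _ _ _ h₁ hε₁ _ (hne l y hy0)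
      (by linarith [hle l y hy, hl.1])
      ((mul_le_mul_of_nonneg_left (hrp l y hy) hε₁).trans hl.2.2.1.le))
  have hd2 : ∀ l ∈ I, ∀ y : Eucl n, ‖y‖ ≤ 1 → y ≠ 0 →
      |fderiv ℝ v₂ (exp (-l) • y) (exp (-l) • y)| ≤ C := fun l hl y hy hy0 =>
    hradial _ _ (hne (-l) y hy0) (hgrad _ _ _ h₂ hε₂ _ (hne (-l) y hy0)
      (by linarith [hle (-l) y hy, hl.2.1])
      ((mul_le_mul_of_nonneg_left (hrp (-l) y hy) hε₂).trans (by
        rw [mul_neg]; exact hl.2.2.2.le)))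
  let G : ℝ → Eucl n → ℝ := fun l y => v₁ (exp l • y) * v₂ (exp (-l) • y)
  let G' : ℝ → Eucl n → ℝ := fun l y =>
    fderiv ℝ v₁ (exp l • y) (exp l • y) * v₂ (exp (-l) • y)
      - v₁ (exp l • y) * fderiv ℝ v₂ (exp (-l) • y) (exp (-l) • y)
  have hts : ∀ y ∈ tsupport (mol (n := n)), ‖y‖ ≤ 1 := fun y hy => mem_closedBall_of_tsupport_mol hy
  have hder : ∀ l ∈ I, HasDerivAt (fun l => ∫ y, G l y * mol y) (∫ y, G' l y * mol y) l := by
    intro l hl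
    refine hasDerivAt_integral_mul_weight (G := G) (G' := G') (B := 1 + 2 * C)
      contDiff_mol.continuous hasCompactSupport_mol hI ?_ ?_ ?_ ?_ ?_ hl
    · intro l hl y hy hy0
      have f1 : HasDerivAt (fun t => v₁ (exp t • y)) (fderiv ℝ v₁ (exp l • y) (exp l • y)) l :=
        (hcd₁ l hl y (hts y hy) hy0).differentiableAt_two.hasFDerivAt.comp_hasDerivAt l
          ((Real.hasDerivAt_exp l).smul_const y)
      have f2 : HasDerivAt (fun t => v₂ (exp (-t) • y))
          (fderiv ℝ v₂ (exp (-l) • y) ((exp (-l) * (-1)) • y)) l :=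
        (hcd₂ l hl y (hts y hy) hy0).differentiableAt_two.hasFDerivAt.comp_hasDerivAt l
          (((hasDerivAt_neg l).exp).smul_const y)
      refine (f1.mul f2).congr_deriv ?_
      simp only [G', mul_neg_one, neg_smul, map_neg]
      ring
    · intro l hl y hy
      exact (((hcd₁ l hl y (hts y hy.1) hy.2).continuousAt.comp (by fun_prop)).mul
        ((hcd₂ l hl y (hts y hy.1) hy.2).continuousAt.comp (by fun_prop))).continuousWithinAt
    · intro l hl y hy
      have c1 : ContinuousAt (fun y => fderiv ℝ v₁ (exp l • y)) y :=
        ContinuousAt.comp (f := fun y => exp l • y) (g := fderiv ℝ v₁)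
          (hcd₁ l hl y (hts y hy.1) hy.2).differentiableAt_fderiv.continuousAt (by fun_prop)
      have c2 : ContinuousAt (fun y => fderiv ℝ v₂ (exp (-l) • y)) y :=
        ContinuousAt.comp (f := fun y => exp (-l) • y) (g := fderiv ℝ v₂)
          (hcd₂ l hl y (hts y hy.1) hy.2).differentiableAt_fderiv.continuousAt (by fun_prop)
      have c3 : ContinuousAt (fun y => v₁ (exp l • y)) y :=
        ContinuousAt.comp (f := fun y => exp l • y) (g := v₁)
          (hcd₁ l hl y (hts y hy.1) hy.2).continuousAt (by fun_prop)
      have c4 : ContinuousAt (fun y => v₂ (exp (-l) • y)) y :=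
        ContinuousAt.comp (f := fun y => exp (-l) • y) (g := v₂)
          (hcd₂ l hl y (hts y hy.1) hy.2).continuousAt (by fun_prop)
      exact (((c1.clm_apply (by fun_prop)).mul c4).sub
        (c3.mul (c2.clm_apply (by fun_prop)))).continuousWithinAt
    · intro l hl y hy hy0
      simp only [G, abs_mul]
      have := mul_le_mul (hb1 l hl y (hts y hy) hy0) (hb2 l hl y (hts y hy) hy0) (abs_nonneg _)
        zero_le_one
      linarith
    · intro l hl y hy hy0
      have m1 := mul_le_mul (hd1 l hl y (hts y hy) hy0) (hb2 l hl y (hts y hy) hy0) (abs_nonneg _)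
        hC.le
      have m2 := mul_le_mul (hb1 l hl y (hts y hy) hy0) (hd2 l hl y (hts y hy) hy0) (abs_nonneg _)
        zero_le_one
      refine (abs_sub _ _).trans ?_
      rw [abs_mul, abs_mul]
      linarith
  have hder' : ∀ l ∈ I, |∫ y, G' l y * mol y|
      ≤ C₂ * (ε₁ * exp (κ * l) + ε₂ * exp (-(κ * l))) := by
    intro l hl
    have p1 := h₁.scale (exp_pos l)
    have p2 := h₂.scale (exp_pos (-l))
    rw [← Real.exp_mul, mul_comm l κ] at p1
    rw [← Real.exp_mul, mul_comm (-l) κ, mul_neg] at p2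
    have := ApproxHardy.pair hn hκ0 hκ2 p1 p2 (by rw [lt_div_iff₀ (exp_pos l)]; exact hl.1)
      (by rw [lt_div_iff₀ (exp_pos (-l))]; exact hl.2.1)
      (mul_nonneg hε₁ (exp_pos _).le) (mul_nonneg hε₂ (exp_pos _).le) hl.2.2.1.le hl.2.2.2.le
    refine le_of_eq_of_le (congrArg abs (integral_congr_ae (Eventually.of_forall fun x => ?_))) this
    have q : ∀ (v : Eucl n → ℝ) (s : ℝ), fderiv ℝ (fun x => v (s • x)) x x
        = fderiv ℝ v (s • x) (s • x) := by
      intro v s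
      have := fderiv_comp_affine v 0 s x
      simp only [zero_add] at this
      rw [this]
      simp
    simp only [G', q]
    ring
  have key := image_norm_le_of_norm_deriv_right_le_deriv_boundary'
    (f := fun l => (∫ y, G l y * mol y) - ∫ y, G a y * mol y) (a := a) (b := b)
    (f' := fun l => ∫ y, G' l y * mol y)
    (B := fun l => C₂ / κ * (ε₁ * (exp (κ * l) - exp (κ * a))
      + ε₂ * (exp (-(κ * a)) - exp (-(κ * l)))))
    (B' := fun l => C₂ * (ε₁ * exp (κ * l) + ε₂ * exp (-(κ * l))))
    (fun l hl => ((hder l (hIab l hl)).continuousAt.sub continuousAt_const).continuousWithinAt)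
    (fun l hl => ((hder l (hIab l (Ico_subset_Icc_self hl))).sub_const _).hasDerivWithinAt)
    (by simp) (by fun_prop) (fun l hl => ?_)
    (fun l hl => hder' l (hIab l (Ico_subset_Icc_self hl))) (right_mem_Icc.2 hab)
  · refine le_trans key ?_
    have : 0 ≤ C₂ / κ := by positivity
    refine mul_le_mul_of_nonneg_left ?_ this
    have i1 := mul_nonneg hε₁ (exp_pos (κ * a)).le
    have i2 := mul_nonneg hε₂ (exp_pos (-(κ * b))).le
    linarith
  · have d1 : HasDerivAt (fun l => exp (κ * l)) (exp (κ * l) * (κ * 1)) l :=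
      ((hasDerivAt_id l).const_mul κ).exp
    have d2 : HasDerivAt (fun l => exp (-(κ * l))) (exp (-(κ * l)) * -(κ * 1)) l :=
      ((hasDerivAt_id l).const_mul κ).neg.exp
    refine (((((d1.sub_const (exp (κ * a))).const_mul ε₁).add
      ((d2.const_sub (exp (-(κ * a)))).const_mul ε₂)).const_mul (C₂ / κ)).congr_deriv
        ?_).hasDerivWithinAt
    field_simp

end HardyCorrelation

section HardyBlowup

variable {n : ℕ}

lemma tendsto_integral_mul_mol [NeZero n] {f : ℕ → Eucl n → ℝ} {F : Eucl n → ℝ}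
    (hc : ∀ᶠ j in atTop, ContinuousOn (f j) (Metric.closedBall 0 1 \ {0}))
    (hb : ∀ᶠ j in atTop, ∀ y : Eucl n, ‖y‖ ≤ 1 → y ≠ 0 → |f j y| ≤ 1)
    (hl : ∀ y : Eucl n, ‖y‖ ≤ 1 → y ≠ 0 → Tendsto (fun j => f j y) atTop (nhds (F y))) :
    Tendsto (fun j => ∫ y, f j y * mol y) atTop (nhds (∫ y, F y * mol y)) := by
  refine tendsto_integral_filter_of_dominated_convergence (mol (n := n)) ?_ ?_ integrable_mol ?_
  · filter_upwards [hc] with j hj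
    exact aestronglyMeasurable_mul_weight contDiff_mol.continuous
      (hj.mono (diff_subset_diff_left tsupport_mol))
  · filter_upwards [hb] with j hj
    filter_upwards [ae_ne_zero n] with y hy0
    rw [norm_mul, norm_of_nonneg (mol_nonneg y), Real.norm_eq_abs]
    by_cases hy : ‖y‖ ≤ 1
    · exact mul_le_of_le_one_left (mol_nonneg y) (hj y hy hy0)
    · rw [image_eq_zero_of_notMem_tsupport fun h => hy (mem_closedBall_of_tsupport_mol h), mul_zero]
  · filter_upwards [ae_ne_zero n] with y hy0
    by_cases hy : ‖y‖ ≤ 1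
    · exact (hl y hy hy0).mul_const _
    · rw [image_eq_zero_of_notMem_tsupport fun h => hy (mem_closedBall_of_tsupport_mol h)]
      simp

lemma eq_zero_of_ae_mul_mol {f : Eucl n → ℝ} {x : Eucl n} (hf : ContinuousAt f x) (hx : ‖x‖ < 1)
    (h : ∀ᵐ y, f y * mol y = 0) : f x = 0 := by
  by_contra hne
  have h1 : ∀ᶠ y in nhds x, f y ≠ 0 := hf.eventually_ne hne
  have h2 : ∀ᶠ y in nhds x, ‖y‖ < 1 := continuous_norm.continuousAt.eventually_lt_const hx
  have h3 : {y | ¬ f y * mol y = 0} ∈ nhds x := by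
    filter_upwards [h1, h2] with y hy1 hy2
    exact mul_ne_zero hy1 (mol_pos hy2).ne'
  exact (Measure.measure_pos_of_mem_nhds volume h3).ne' (ae_iff.1 h)

lemma eq_of_midpoint_le_of_bddAbove {H : ℝ → ℝ} {M : ℝ} (hM : ∀ t, H t ≤ M)
    (hc : ∀ t l, 2 * H t ≤ H (t + l) + H (t - l)) (t l : ℝ) : H (t + l) = H t := by
  have key : ∀ t l, H (t + l) ≤ H t := by
    intro t l
    by_contra! hlt
    set d := H (t + l) - H t with hd
    have hd0 : 0 < d := by linarith
    have step : ∀ m : ℕ, d ≤ H (t + (m + 1) * l) - H (t + m * l) := by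
      intro m
      induction m with
      | zero => simp [hd]
      | succ m ih =>
        have h := hc (t + (m + 1) * l) l
        rw [show t + ((m : ℝ) + 1) * l + l = t + ((m : ℝ) + 1 + 1) * l by ring,
          show t + ((m : ℝ) + 1) * l - l = t + (m : ℝ) * l by ring] at h
        push_cast
        linarith
    have grow : ∀ m : ℕ, H t + m * d ≤ H (t + m * l) := by
      intro m
      induction m with
      | zero => simp
      | succ m ih =>
        have := step m
        push_cast
        linarith
    obtain ⟨m, hm⟩ := exists_nat_gt ((M - H t) / d)
    rw [div_lt_iff₀ hd0] at hm
    linarith [grow m, hM (t + m * l)]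
  refine le_antisymm (key t l) ?_
  have := key (t + l) (-l)
  rwa [add_neg_cancel_right] at this

lemma ApproxHardy.continuousOn_scale {γ κ R ε : ℝ} {v : Eucl n → ℝ} (hv : ApproxHardy γ κ R ε v)
    {s : ℝ} (hs : 0 < s) (hsR : s < R) :
    ContinuousOn (fun y => v (s • y)) (Metric.closedBall 0 1 \ {0}) := by
  refine hv.smooth.continuousOn.comp (by fun_prop) fun y hy => ⟨?_, ?_⟩
  · have : ‖y‖ ≤ 1 := by simpa using hy.1
    simp only [Metric.mem_ball, dist_zero_right, norm_smul, norm_of_nonneg hs.le]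
    nlinarith
  · simpa [hs.ne'] using hy.2

lemma ApproxHardy.abs_scale_le {γ κ R ε : ℝ} {v : Eucl n → ℝ} (hv : ApproxHardy γ κ R ε v)
    {s : ℝ} (hs : 0 < s) (hsR : s < R) {y : Eucl n} (hy : ‖y‖ ≤ 1) (hy0 : y ≠ 0) :
    |v (s • y)| ≤ 1 := by
  refine hv.bound _ ?_ (smul_ne_zero hs.ne' hy0)
  simp only [Metric.mem_ball, dist_zero_right, norm_smul, norm_of_nonneg hs.le]
  nlinarith

lemma abs_mul_le_one {a b : ℝ} (ha : |a| ≤ 1) (hb : |b| ≤ 1) : |a * b| ≤ 1 := by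
  rw [abs_mul]
  exact mul_le_one₀ ha (abs_nonneg b) hb

lemma ApproxHardy.locallyLipschitz (n : ℕ) [NeZero n] {γ κ : ℝ} (hκ0 : 0 < κ) (hκ2 : κ < 2)
    {R ε : ℕ → ℝ} {v : ℕ → Eucl n → ℝ} (hv : ∀ j, ApproxHardy γ κ (R j) (ε j) (v j))
    (hε : ∀ j, 0 ≤ ε j) (hR : Tendsto R atTop atTop) (hε0 : Tendsto ε atTop (nhds 0))
    {x : Eucl n} (hx : x ≠ 0) :
    ∃ K : ℝ, 0 < K ∧ ∀ᶠ j in atTop, ∀ y ∈ Metric.ball x (‖x‖ / 2), |v j y - v j x| ≤ K * ‖y - x‖ := by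
  obtain ⟨C, hC, hgrad⟩ := ApproxHardy.gradient n γ κ hκ0 hκ2
  have hxp : 0 < ‖x‖ := norm_pos_iff.2 hx
  refine ⟨C / (‖x‖ / 2), by positivity, ?_⟩
  have e1 : ∀ᶠ j in atTop, 4 * ‖x‖ < R j := hR.eventually_gt_atTop _
  have e2 : ∀ᶠ j in atTop, ε j * (2 * ‖x‖) ^ κ < 1 := by
    have := hε0.mul_const ((2 * ‖x‖) ^ κ)
    rw [zero_mul] at this
    exact this.eventually_lt_const one_pos
  filter_upwards [e1, e2] with j hj1 hj2 y hy
  have hz : ∀ z ∈ Metric.ball x (‖x‖ / 2), ‖x‖ / 2 < ‖z‖ ∧ ‖z‖ < 2 * ‖x‖ := by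
    intro z hz
    have h1 : ‖z - x‖ < ‖x‖ / 2 := by simpa [dist_eq_norm] using hz
    have h2 := norm_sub_norm_le x z
    have h3 := norm_sub_norm_le z x
    rw [norm_sub_rev] at h2
    constructor <;> linarith
  have hz0 : ∀ z ∈ Metric.ball x (‖x‖ / 2), z ≠ 0 := fun z h => by
    rw [← norm_pos_iff]; linarith [(hz z h).1]
  refine (convex_ball x (‖x‖ / 2)).norm_image_sub_le_of_norm_fderiv_le (𝕜 := ℝ) (f := v j)
    (fun z h => ((hv j).contDiffAt (by linarith [(hz z h).2]) (hz0 z h)).differentiableAt_two)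
    (fun z h => ?_) (Metric.mem_ball_self (by positivity)) hy
  refine (hgrad _ _ _ (hv j) (hε j) z (hz0 z h) (by linarith [(hz z h).2]) ?_).trans ?_
  · refine le_trans ?_ hj2.le
    exact mul_le_mul_of_nonneg_left
      (Real.rpow_le_rpow (norm_nonneg z) (hz z h).2.le hκ0.le) (hε j)
  · exact div_le_div_of_nonneg_left hC.le (by positivity) (hz z h).1.le

lemma ApproxHardy.exists_subseq_tendsto_zero (hn : 3 ≤ n) [NeZero n] {γ κ : ℝ} (hκ0 : 0 < κ)
    (hκ2 : κ < 2) {R ε : ℕ → ℝ} {v : ℕ → Eucl n → ℝ}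
    (hv : ∀ j, ApproxHardy γ κ (R j) (ε j) (v j))
    (hε : ∀ j, 0 ≤ ε j) (hR : Tendsto R atTop atTop) (hε0 : Tendsto ε atTop (nhds 0))
    (hv0 : ∀ j, Tendsto (v j) (nhdsWithin 0 {0}ᶜ) (nhds 0)) :
    ∃ φ : ℕ → ℕ, StrictMono φ ∧
      ∀ η > 0, ∀ᶠ j in atTop, ∀ x : Eucl n, ‖x‖ = 1 → |v (φ j) x| ≤ η := by
  have hbd : ∀ x : Eucl n, x ≠ 0 → ∀ᶠ j in atTop, |v j x| ≤ 1 := by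
    intro x hx
    filter_upwards [hR.eventually_gt_atTop ‖x‖] with j hj
    exact (hv j).bound x (by simpa using hj) hx
  have hlip := fun (x : Eucl n) (hx : x ≠ 0) =>
    ApproxHardy.locallyLipschitz n hκ0 hκ2 hv hε hR hε0 hx
  obtain ⟨φ, hφ, W, hW⟩ := exists_subseq_tendstoLocallyUniformlyOn (S := {(0 : Eucl n)}ᶜ) (f := v)
    (fun x hx => ⟨1, hbd x hx⟩) (by
      intro x hx δ hδ
      obtain ⟨K, hK, hl⟩ := hlip x hx
      have hxp : 0 < ‖x‖ := norm_pos_iff.2 hx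
      refine ⟨min (‖x‖ / 2) (δ / K), by positivity, hl.mono fun j hj y hy hd => ?_⟩
      have h1 := hj y (Metric.mem_ball.2 (hd.trans_le (min_le_left _ _)))
      have h2 : ‖y - x‖ ≤ δ / K := by
        rw [← dist_eq_norm]; exact (hd.trans_le (min_le_right _ _)).le
      calc |v j y - v j x| ≤ K * ‖y - x‖ := h1
        _ ≤ K * (δ / K) := by gcongr
        _ = δ := by field_simp)
  refine ⟨φ, hφ, ?_⟩
  have hφt := hφ.tendsto_atTop
  have hpt : ∀ x : Eucl n, x ≠ 0 → Tendsto (fun j => v (φ j) x) atTop (nhds (W x)) :=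
    fun x hx => hW.tendsto_at hx
  have hW1 : ∀ x : Eucl n, x ≠ 0 → |W x| ≤ 1 := fun x hx =>
    le_of_tendsto (hpt x hx).abs (hφt.eventually (hbd x hx))
  have hWc : ∀ x : Eucl n, x ≠ 0 → ContinuousAt W x := by
    intro x hx
    obtain ⟨K, hK, hl⟩ := hlip x hx
    have hxp : 0 < ‖x‖ := norm_pos_iff.2 hx
    have hle : ∀ᶠ y in nhds x, dist (W y) (W x) ≤ K * ‖y - x‖ := by
      filter_upwards [Metric.ball_mem_nhds x (half_pos hxp), isOpen_ne.mem_nhds hx] with y hy hy0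
      refine le_of_tendsto ((hpt y hy0).sub (hpt x hx)).abs ?_
      exact hφt.eventually (hl.mono fun j hj => hj y hy)
    refine tendsto_iff_dist_tendsto_zero.2 (squeeze_zero' (Eventually.of_forall fun _ => dist_nonneg)
      hle ?_)
    have : ContinuousAt (fun y : Eucl n => K * ‖y - x‖) x := by fun_prop
    simpa [ContinuousAt] using this
  have hns : ∀ (t : ℝ) (y : Eucl n), y ≠ 0 → exp t • y ≠ 0 := fun t y hy =>
    smul_ne_zero (exp_pos t).ne' hy
  have hWcon : ∀ t : ℝ, ContinuousOn (fun y => W (exp t • y)) (Metric.closedBall 0 1 \ {0}) := by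
    intro t y hy
    exact (ContinuousAt.comp (f := fun y => exp t • y) (g := W) (hWc _ (hns t y hy.2))
      (by fun_prop)).continuousWithinAt
  obtain ⟨C, hC, hcor⟩ := ApproxHardy.correlation n hn γ κ hκ0 hκ2
  have hRe : ∀ M : ℝ, ∀ᶠ j in atTop, M < R (φ j) := fun M => hφt.eventually
    (hR.eventually_gt_atTop M)
  have hεφ : ∀ M : ℝ, Tendsto (fun j => ε (φ j) * M) atTop (nhds 0) := fun M => by
    simpa using (hε0.comp hφt).mul_const M
  have hWW : ∀ a b : ℝ, Tendsto (fun j => ∫ y, v (φ j) (exp a • y) * v (φ j) (exp b • y) * mol y)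
      atTop (nhds (∫ y, W (exp a • y) * W (exp b • y) * mol y)) := by
    intro a b
    refine tendsto_integral_mul_mol ?_ ?_ ?_
    · filter_upwards [hRe (exp a), hRe (exp b)] with j ha hb
      exact ((hv _).continuousOn_scale (exp_pos a) ha).mul ((hv _).continuousOn_scale (exp_pos b) hb)
    · filter_upwards [hRe (exp a), hRe (exp b)] with j ha hb y hy hy0
      exact abs_mul_le_one ((hv _).abs_scale_le (exp_pos a) ha hy hy0)
        ((hv _).abs_scale_le (exp_pos b) hb hy hy0)
    · exact fun y _ hy0 => (hpt _ (hns a y hy0)).mul (hpt _ (hns b y hy0))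
  let H : ℝ → ℝ := fun t => ∫ y, W (exp t • y) * W (exp t • y) * mol y
  have hH : ∀ t l : ℝ, 0 ≤ l → ∫ y, W (exp (t + l) • y) * W (exp (t - l) • y) * mol y = H t := by
    intro t l hl
    refine tendsto_nhds_unique (hWW (t + l) (t - l)) ?_
    have hdiff : Tendsto (fun j =>
        (∫ y, v (φ j) (exp (t + l) • y) * v (φ j) (exp (t - l) • y) * mol y)
        - ∫ y, v (φ j) (exp t • y) * v (φ j) (exp t • y) * mol y) atTop (nhds 0) := by
      refine squeeze_zero_norm' (a := fun j =>
        C * (ε (φ j) * (exp t ^ κ * exp (κ * l)) + ε (φ j) * (exp t ^ κ))) ?_ ?_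
      · have q1 := (hεφ (exp t ^ κ * exp (κ * l))).eventually_lt_const one_pos
        have q2 := (hεφ (exp t ^ κ)).eventually_lt_const one_pos
        filter_upwards [hRe (2 * exp l * exp t), hRe (2 * exp t), q1, q2] with j r1 r2 q1 q2
        have p := (hv (φ j)).scale (exp_pos t)
        have h := hcor _ _ _ _ _ _ p p (mul_nonneg (hε _) (Real.rpow_nonneg (exp_pos t).le _))
          (mul_nonneg (hε _) (Real.rpow_nonneg (exp_pos t).le _)) 0 l hl
          (by rwa [lt_div_iff₀ (exp_pos t)]) (by
            rw [neg_zero, exp_zero, lt_div_iff₀ (exp_pos t)]; linarith) (by rwa [mul_assoc]) (by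
            rw [mul_zero, neg_zero, exp_zero, mul_one]; exact q2)
        simp only [neg_zero, exp_zero, mul_zero, mul_one, one_smul, smul_smul, ← exp_add] at h
        rw [mul_assoc, ← sub_eq_add_neg] at h
        exact h
      · simpa using ((hεφ (exp t ^ κ * exp (κ * l))).add (hεφ (exp t ^ κ))).const_mul C
    simpa using hdiff.add (hWW t t)
  have hInt : ∀ a b : ℝ, Integrable fun y => W (exp a • y) * W (exp b • y) * mol y := by
    intro a b
    refine (integrable_mol (n := n)).mono' ?_ ?_
    · exact aestronglyMeasurable_mul_weight contDiff_mol.continuous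
        (((hWcon a).mul (hWcon b)).mono (diff_subset_diff_left tsupport_mol))
    · filter_upwards [ae_ne_zero n] with y hy0
      rw [norm_mul, norm_of_nonneg (mol_nonneg y), Real.norm_eq_abs]
      exact mul_le_of_le_one_left (mol_nonneg y)
        (abs_mul_le_one (hW1 _ (hns a y hy0)) (hW1 _ (hns b y hy0)))
  have hsq : ∀ t l : ℝ, 0 ≤ l →
      ∫ y, (W (exp (t + l) • y) - W (exp (t - l) • y)) ^ 2 * mol y
        = H (t + l) + H (t - l) - 2 * H t := by
    intro t l hl
    have e1 := integral_sub ((hInt (t + l) (t + l)).add (hInt (t - l) (t - l)))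
      ((hInt (t + l) (t - l)).const_mul 2)
    rw [integral_add' (hInt _ _) (hInt _ _), integral_const_mul, hH t l hl] at e1
    refine Eq.trans ?_ e1
    refine integral_congr_ae (Eventually.of_forall fun y => ?_)
    simp only [Pi.add_apply]
    ring
  have hHconst : ∀ t l : ℝ, H (t + l) = H t := by
    refine eq_of_midpoint_le_of_bddAbove (M := ∫ y : Eucl n, mol y) (fun t => ?_) ?_
    · refine integral_mono_ae (hInt t t) integrable_mol ?_
      filter_upwards [ae_ne_zero n] with y hy0
      exact mul_le_of_le_one_left (mol_nonneg y)
        (le_of_abs_le (abs_mul_le_one (hW1 _ (hns t y hy0)) (hW1 _ (hns t y hy0))))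
    · have pos : ∀ t l, 0 ≤ l → 2 * H t ≤ H (t + l) + H (t - l) := by
        intro t l hl
        have h1 := hsq t l hl
        have h2 : 0 ≤ ∫ y, (W (exp (t + l) • y) - W (exp (t - l) • y)) ^ 2 * mol y :=
          integral_nonneg fun y => mul_nonneg (sq_nonneg _) (mol_nonneg y)
        linarith
      intro t l
      rcases le_total 0 l with hl | hl
      · exact pos t l hl
      · have := pos t (-l) (by linarith)
        rw [sub_neg_eq_add, ← sub_eq_add_neg] at this
        linarith
  have hhom : ∀ s : ℝ, 0 ≤ s → ∀ᵐ y : Eucl n, W (exp s • y) * mol y = W y * mol y := by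
    intro s hs
    have h1 := hsq (s / 2) (s / 2) (by linarith)
    have e1 : H (s / 2 - s / 2) = H (s / 2) := by rw [sub_eq_add_neg]; exact hHconst _ _
    rw [e1, hHconst] at h1
    have h2 : ∫ y, (W (exp (s / 2 + s / 2) • y) - W (exp (s / 2 - s / 2) • y)) ^ 2 * mol y = 0 := by
      rw [h1]; ring
    rw [integral_eq_zero_iff_of_nonneg (fun y => mul_nonneg (sq_nonneg _) (mol_nonneg y))] at h2
    · filter_upwards [h2] with y hy
      simp only [add_halves, sub_self, exp_zero, one_smul, Pi.zero_apply, mul_eq_zero,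
        pow_eq_zero_iff two_ne_zero] at hy
      rcases hy with hy | hy
      · rw [sub_eq_zero.1 hy]
      · rw [hy, mul_zero, mul_zero]
    · refine (((hInt (s / 2 + s / 2) (s / 2 + s / 2)).add (hInt (s / 2 - s / 2) (s / 2 - s / 2))).sub
        ((hInt (s / 2 + s / 2) (s / 2 - s / 2)).const_mul 2)).congr
        (Eventually.of_forall fun y => ?_)
      simp only [Pi.add_apply, Pi.sub_apply]
      ring
  have hGj : ∀ᶠ j in atTop, |∫ y, v (φ j) y * W y * mol y| ≤ C * ε (φ j) := by
    have q0 := (hεφ 1).eventually_lt_const one_pos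
    filter_upwards [hRe 2, q0] with j hj2 hj1
    rw [mul_one] at hj1
    have hvW : ∀ m : ℕ, |(∫ y, v (φ j) y * W y * mol y)
        - ∫ y, v (φ j) (exp (-m) • y) * W y * mol y| ≤ C * ε (φ j) := by
      intro m
      have hm0 : exp (-(m : ℝ)) ≤ 1 := exp_le_one_iff.2 (by simp)
      have t1 : ∀ a b : ℝ, exp a < R (φ j) → Tendsto (fun i =>
          ∫ y, v (φ j) (exp a • y) * v (φ i) (exp b • y) * mol y) atTop
          (nhds (∫ y, v (φ j) (exp a • y) * W (exp b • y) * mol y)) := by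
        intro a b ha
        refine tendsto_integral_mul_mol ?_ ?_ ?_
        · filter_upwards [hRe (exp b)] with i hb
          exact ((hv _).continuousOn_scale (exp_pos a) ha).mul
            ((hv _).continuousOn_scale (exp_pos b) hb)
        · filter_upwards [hRe (exp b)] with i hb y hy hy0
          exact abs_mul_le_one ((hv _).abs_scale_le (exp_pos a) ha hy hy0)
            ((hv _).abs_scale_le (exp_pos b) hb hy hy0)
        · exact fun y _ hy0 => (hpt _ (hns b y hy0)).const_mul _
      have t2 := ((t1 0 0 (by rw [exp_zero]; linarith)).sub (t1 (-m) m (by linarith))).abs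
      have e : ∫ y, v (φ j) (exp (-m) • y) * W (exp m • y) * mol y
          = ∫ y, v (φ j) (exp (-m) • y) * W y * mol y := by
        refine integral_congr_ae ?_
        filter_upwards [hhom m (Nat.cast_nonneg m)] with y hy
        rw [mul_assoc, hy, mul_assoc]
      rw [e] at t2
      simp only [exp_zero, one_smul] at t2
      have t3 : Tendsto (fun i => C * (ε (φ j) + ε (φ i) * exp (κ * m))) atTop
          (nhds (C * (ε (φ j) + 0))) := ((hεφ (exp (κ * m))).const_add _).const_mul C
      rw [add_zero] at t3
      refine le_of_tendsto_of_tendsto t2 t3 ?_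
      have q2 := (hεφ (exp (κ * m))).eventually_lt_const one_pos
      filter_upwards [hRe (2 * exp m), q2] with i hi1 hi2
      have h := hcor _ _ _ _ _ _ (hv (φ j)) (hv (φ i)) (hε _) (hε _) (-m) 0 (by simp)
        (by rw [exp_zero]; linarith) (by rwa [neg_neg]) (by simpa using hj1) (by simpa using hi2)
      simpa using h
    have hlim : Tendsto (fun m : ℕ => ∫ y, v (φ j) (exp (-m) • y) * W y * mol y) atTop
        (nhds (∫ y : Eucl n, 0 * mol y)) := by
      have hm1 : ∀ m : ℕ, exp (-(m : ℝ)) < R (φ j) := fun m => by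
        have : exp (-(m : ℝ)) ≤ 1 := exp_le_one_iff.2 (by simp)
        linarith
      refine tendsto_integral_mul_mol ?_ ?_ ?_
      · refine Eventually.of_forall fun m => ?_
        have := hWcon 0
        simp only [exp_zero, one_smul] at this
        exact ((hv _).continuousOn_scale (exp_pos _) (hm1 m)).mul this
      · refine Eventually.of_forall fun m y hy hy0 => ?_
        exact abs_mul_le_one ((hv _).abs_scale_le (exp_pos _) (hm1 m) hy hy0) (hW1 y hy0)
      · intro y _ hy0
        rw [← zero_mul (W y)]
        refine Tendsto.mul_const _ ((hv0 (φ j)).comp (tendsto_nhdsWithin_iff.2 ⟨?_, ?_⟩))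
        · have : Tendsto (fun m : ℕ => exp (-(m : ℝ))) atTop (nhds 0) :=
            Real.tendsto_exp_neg_atTop_nhds_zero.comp tendsto_natCast_atTop_atTop
          simpa using this.smul_const y
        · exact Eventually.of_forall fun m => hns _ y hy0
    simp only [zero_mul, integral_zero] at hlim
    have := le_of_tendsto' ((tendsto_const_nhds.sub hlim).abs) hvW
    simpa using this
  have hW2 : H 0 = 0 := by
    have t1 : Tendsto (fun j => ∫ y, v (φ j) y * W y * mol y) atTop
        (nhds (∫ y, W y * W y * mol y)) := by
      have hc0 := hWcon 0
      simp only [exp_zero, one_smul] at hc0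
      refine tendsto_integral_mul_mol ?_ ?_ ?_
      · filter_upwards [hRe 1] with j hj
        have := (hv (φ j)).continuousOn_scale one_pos hj
        simp only [one_smul] at this
        exact this.mul hc0
      · filter_upwards [hRe 1] with j hj y hy hy0
        have := (hv (φ j)).abs_scale_le one_pos hj hy hy0
        rw [one_smul] at this
        exact abs_mul_le_one this (hW1 y hy0)
      · exact fun y _ hy0 => (hpt y hy0).mul_const _
    have t2 : Tendsto (fun j => ∫ y, v (φ j) y * W y * mol y) atTop (nhds 0) := by
      refine squeeze_zero_norm' hGj ?_
      simpa [mul_comm] using hεφ C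
    have := tendsto_nhds_unique t1 t2
    simpa [H] using this
  have hW0 : ∀ x : Eucl n, ‖x‖ = 1 → W x = 0 := by
    intro x hx
    have hx0 : x ≠ 0 := by rw [← norm_pos_iff, hx]; exact one_pos
    have hH1 : H 1 = 0 := by rw [← hW2]; simpa using hHconst 0 1
    have hH1' : ∫ y, W (exp 1 • y) * W (exp 1 • y) * mol y = 0 := hH1
    rw [integral_eq_zero_iff_of_nonneg
      (fun y => mul_nonneg (mul_self_nonneg _) (mol_nonneg y)) (hInt 1 1)] at hH1'
    have hxe : exp 1 • (exp (-1) • x) = x := by rw [smul_smul, ← exp_add]; simp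
    have := eq_zero_of_ae_mul_mol (f := fun y => W (exp 1 • y) * W (exp 1 • y))
      (x := exp (-1) • x) ?_ ?_ hH1'
    · simp only [hxe] at this
      exact mul_self_eq_zero.1 this
    · have : ContinuousAt (fun y => W (exp 1 • y)) (exp (-1) • x) :=
        ContinuousAt.comp (f := fun y => exp 1 • y) (g := W) (by simp only [hxe]; exact hWc x hx0)
          (by fun_prop)
      exact this.mul this
    · rw [norm_smul, norm_of_nonneg (exp_pos _).le, hx, mul_one]
      exact Real.exp_lt_one_iff.2 (by norm_num)
  have hun : TendstoUniformlyOn (fun j => v (φ j)) W atTop (Metric.sphere (0 : Eucl n) 1) := by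
    refine (tendstoLocallyUniformlyOn_iff_tendstoUniformlyOn_of_compact
      (isCompact_sphere 0 1)).1 (hW.mono fun x hx => ?_)
    rintro rfl
    simp at hx
  intro η hη
  filter_upwards [Metric.tendstoUniformlyOn_iff.1 hun η hη] with j hj x hx
  have := hj x (by simpa using hx)
  rw [hW0 x hx, Real.dist_eq, zero_sub, abs_neg] at this
  exact this.le

lemma ApproxHardy.tendsto_zero (hn : 3 ≤ n) [NeZero n] {γ κ : ℝ} (hκ0 : 0 < κ)
    (hκ2 : κ < 2) {R ε : ℕ → ℝ} {v : ℕ → Eucl n → ℝ}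
    (hv : ∀ j, ApproxHardy γ κ (R j) (ε j) (v j))
    (hε : ∀ j, 0 ≤ ε j) (hR : Tendsto R atTop atTop) (hε0 : Tendsto ε atTop (nhds 0))
    (hv0 : ∀ j, Tendsto (v j) (nhdsWithin 0 {0}ᶜ) (nhds 0)) {η : ℝ} (hη : 0 < η) :
    ∀ᶠ j in atTop, ∀ x : Eucl n, ‖x‖ = 1 → |v j x| ≤ η := by
  by_contra hcon
  obtain ⟨ψ, hψ, hfail⟩ := extraction_of_frequently_atTop (not_eventually.1 hcon)
  have hψt := hψ.tendsto_atTop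
  obtain ⟨φ, hφ, h⟩ := ApproxHardy.exists_subseq_tendsto_zero hn hκ0 hκ2 (fun j => hv (ψ j))
    (fun j => hε (ψ j)) (hR.comp hψt) (hε0.comp hψt) (fun j => hv0 (ψ j))
  obtain ⟨j, hj⟩ := (h η hη).exists
  exact hfail (φ j) hj

end HardyBlowup

section NearZero

variable {n : ℕ}

lemma lapl_const_mul_sub_const (a c : ℝ) (u : Eucl n → ℝ) (x : Eucl n) :
    lapl (fun y => a * (u y - c)) x = a * lapl u x := by
  have h1 : fderiv ℝ (fun y => a * (u y - c)) = fun y => a • fderiv ℝ u y := by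
    ext1 y
    have := congrFun (fderiv_const_smul_field (𝕜 := ℝ) (f := fun y => u y - c) a) y
    refine this.trans ?_
    rw [Pi.smul_apply, fderiv_sub_const]
  have h2 : fderiv ℝ (fderiv ℝ fun y => a * (u y - c)) x = a • fderiv ℝ (fderiv ℝ u) x := by
    rw [h1]
    exact congrFun (fderiv_const_smul_field (𝕜 := ℝ) (f := fderiv ℝ u) a) x
  simp only [lapl, h2, smul_apply, smul_eq_mul, Finset.mul_sum]

lemma lapl_lower_bound (n : ℕ) [NeZero n] :
    ∃ C : ℝ, 0 < C ∧ ∀ (w : Eucl n → ℝ) (x : Eucl n) (r A m : ℝ), 0 < r →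
      ContDiffOn ℝ 2 w (Metric.ball x r) → (∀ z ∈ Metric.ball x r, |w z| ≤ A) →
      (∀ z ∈ Metric.ball x r, m ≤ lapl w z) → m ≤ C * A / r ^ 2 := by
  have hmol : ContDiff ℝ (⊤ : ℕ∞) (mol (n := n)) := contDiff_mol
  let D : Fin n → Eucl n → ℝ := fun i y => fderiv ℝ mol y (bvec i)
  let D2 : Fin n → Eucl n → ℝ := fun i y => fderiv ℝ (D i) y (bvec i)
  have hD : ∀ i, ContDiff ℝ (⊤ : ℕ∞) (D i) := fun i => hmol.fderiv_apply_const _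
  have hDc : ∀ i, HasCompactSupport (D i) := fun i => hasCompactSupport_mol.fderiv_apply_const _
  have hD2i : ∀ i, Integrable (D2 i) := fun i =>
    ((hD i).fderiv_apply_const _).continuous.integrable_of_hasCompactSupport
      ((hDc i).fderiv_apply_const _)
  set S := ∑ i, ∫ y, |D2 i y| with hS
  have hS0 : 0 ≤ S := Finset.sum_nonneg fun i _ => integral_nonneg fun y => abs_nonneg _
  have hm0 : 0 < ∫ y : Eucl n, mol y := integral_mol_pos
  refine ⟨4 * (S + 1) / ∫ y : Eucl n, mol y, by positivity, fun w x r A m hr hw hA hm => ?_⟩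
  have hs : 0 < r / 2 := by positivity
  have hA0 : 0 ≤ A := (abs_nonneg _).trans (hA x (Metric.mem_ball_self hr))
  have hmem : ∀ y : Eucl n, ‖y‖ ≤ 1 → x + (r / 2) • y ∈ Metric.ball x r := by
    intro y hy
    rw [mem_ball_iff_norm, add_sub_cancel_left, norm_smul, norm_of_nonneg hs.le]
    nlinarith
  let f : Eucl n → ℝ := fun y => w (x + (r / 2) • y)
  have hf : ∀ y : Eucl n, ‖y‖ ≤ 1 → ContDiffAt ℝ 2 f y := fun y hy =>
    ContDiffAt.comp y (g := w) (hw.contDiffAt_of_isOpen Metric.isOpen_ball (hmem y hy)) (by fun_prop)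
  have hts : ∀ y ∈ tsupport (mol (n := n)), ‖y‖ ≤ 1 := fun y hy => mem_closedBall_of_tsupport_mol hy
  have hts1 : ∀ i, ∀ y ∈ tsupport (D i), ‖y‖ ≤ 1 := fun i y hy =>
    hts y (tsupport_fderiv_const_subset _ _ hy)
  have hts2 : ∀ i y, D2 i y ≠ 0 → ‖y‖ ≤ 1 := fun i y hy =>
    hts1 i y (tsupport_fderiv_const_subset _ _ (subset_tsupport _ hy))
  have hi : ∀ i, ∫ y, fderiv ℝ (fun z => fderiv ℝ f z (bvec i)) y (bvec i) * mol y
      = ∫ y, f y * D2 i y := by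
    intro i
    rw [integral_fderiv_mul_eq_neg (fun y hy =>
      ((hf y (hts y hy)).fderiv_right (m := 1) (by norm_num)).clm_apply contDiffAt_const)
      (hmol.of_le (by simp)) hasCompactSupport_mol]
    rw [integral_fderiv_mul_eq_neg (f := f) (g := D i) (fun y hy =>
      (hf y (hts1 i y hy)).of_le (by norm_num)) ((hD i).of_le (by simp)) (hDc i), neg_neg]
  have hl : ∀ y : Eucl n, ‖y‖ ≤ 1 → ∑ i, fderiv ℝ (fun z => fderiv ℝ f z (bvec i)) y (bvec i)
      = (r / 2) ^ 2 * lapl w (x + (r / 2) • y) := by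
    intro y hy
    rw [← lapl_comp_affine]
    simp only [lapl]
    exact Finset.sum_congr rfl fun i _ => fderiv_fderiv_apply (hf y hy).differentiableAt_fderiv _ _
  have hInt : ∀ i, Integrable fun y => fderiv ℝ (fun z => fderiv ℝ f z (bvec i)) y (bvec i) * mol y :=
    fun i => integrable_mul_of_continuousAt_tsupport (fun y hy =>
      ((((hf y (hts y hy)).fderiv_right (m := 1) (by norm_num)).clm_apply
        contDiffAt_const).fderiv_right (m := 0) (by norm_num)).continuousAt.clm_apply
          continuousAt_const) hmol.continuous hasCompactSupport_mol
  have hup : ∫ y, ∑ i, fderiv ℝ (fun z => fderiv ℝ f z (bvec i)) y (bvec i) * mol y ≤ A * S := by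
    rw [integral_finsetSum _ fun i _ => hInt i, hS, Finset.mul_sum]
    refine Finset.sum_le_sum fun i _ => ?_
    rw [hi]
    exact (le_abs_self _).trans (abs_integral_mul_le (hD2i i) fun y hy => hA _ (hmem y (hts2 i y hy)))
  have hlow : ∫ y : Eucl n, ((r / 2) ^ 2 * m) * mol y
      ≤ ∫ y, ∑ i, fderiv ℝ (fun z => fderiv ℝ f z (bvec i)) y (bvec i) * mol y := by
    refine integral_mono (integrable_mol.const_mul _) (integrable_finsetSum _ fun i _ => hInt i)
      fun y => ?_
    simp only
    rw [← Finset.sum_mul]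
    by_cases hy : ‖y‖ ≤ 1
    · rw [hl y hy]
      exact mul_le_mul_of_nonneg_right
        (mul_le_mul_of_nonneg_left (hm _ (hmem y hy)) (by positivity)) (mol_nonneg y)
    · rw [image_eq_zero_of_notMem_tsupport fun h => hy (hts y h), mul_zero, mul_zero]
  rw [integral_const_mul] at hlow
  have h1 := hlow.trans hup
  rw [div_mul_eq_mul_div, div_div, le_div_iff₀ (by positivity)]
  nlinarith

lemma mul_self_eq_zero_of_hardy [NeZero n] {γ κ A δ : ℝ} (hκ0 : 0 < κ)
    (hδ : 0 < δ) {u : Eucl n → ℝ} (hu : ContDiffOn ℝ 2 u (Metric.ball 0 δ \ {0}))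
    (hc : ContinuousAt u 0) (he : ∀ x ∈ Metric.ball (0 : Eucl n) δ, x ≠ 0 →
      |lapl u x + γ * u x / ‖x‖ ^ 2| ≤ A * ‖x‖ ^ (κ - 2)) : γ * u 0 = 0 := by
  obtain ⟨C, hC, hlow⟩ := lapl_lower_bound n
  have hsg : ∀ σ : ℝ, |σ| = 1 → ¬ 0 < σ * (γ * u 0) := by
    intro σ hσ hpos
    set a := σ * (γ * u 0) with ha
    have hev : ∀ᶠ x in nhdsWithin (0 : Eucl n) {0}ᶜ, a / 2 / ‖x‖ ^ 2 ≤ -(σ * lapl u x) := by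
      have c1 : Tendsto (fun x => σ * (γ * u x) - A * ‖x‖ ^ κ) (nhds 0) (nhds (a - A * 0)) := by
        refine (((hc.tendsto.const_mul γ).const_mul σ)).sub (Tendsto.const_mul A ?_)
        have : Tendsto (fun x : Eucl n => ‖x‖ ^ κ) (nhds 0) (nhds (‖(0 : Eucl n)‖ ^ κ)) :=
          (continuous_norm.rpow_const fun _ => Or.inr hκ0.le).tendsto 0
        rwa [norm_zero, Real.zero_rpow hκ0.ne'] at this
      rw [mul_zero, sub_zero] at c1
      filter_upwards [nhdsWithin_le_nhds (c1.eventually_const_lt (half_lt_self hpos)),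
        nhdsWithin_le_nhds (Metric.ball_mem_nhds (0 : Eucl n) hδ), self_mem_nhdsWithin]
        with x hx hxδ hx0
      have hx0' : x ≠ 0 := hx0
      have hxp : 0 < ‖x‖ := norm_pos_iff.2 hx0'
      have h := he x hxδ hx0'
      rw [Real.rpow_sub hxp, Real.rpow_two] at h
      have h2 : |σ * (lapl u x + γ * u x / ‖x‖ ^ 2)| ≤ A * (‖x‖ ^ κ / ‖x‖ ^ 2) := by
        rw [abs_mul, hσ, one_mul]; exact h
      have h3 := le_of_abs_le h2
      have h4 : a / 2 / ‖x‖ ^ 2 ≤ (σ * (γ * u x) - A * ‖x‖ ^ κ) / ‖x‖ ^ 2 := by gcongr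
      have h5 : (σ * (γ * u x) - A * ‖x‖ ^ κ) / ‖x‖ ^ 2
          = σ * (γ * u x / ‖x‖ ^ 2) - A * (‖x‖ ^ κ / ‖x‖ ^ 2) := by ring
      linarith
    obtain ⟨ρ, hρ, hρa⟩ := Metric.eventually_nhds_iff_ball.1 (eventually_nhdsWithin_iff.1 hev)
    have hη : 0 < a / (C * 36) := by positivity
    obtain ⟨ρ', hρ', hρu⟩ := Metric.continuousAt_iff.1 hc _ hη
    have hr0 : 0 < min δ (min ρ ρ') / 2 := by positivity
    obtain ⟨x, hx⟩ : ∃ x : Eucl n, ‖x‖ = min δ (min ρ ρ') / 2 := by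
      refine ⟨(min δ (min ρ ρ') / 2) • bvec 0, ?_⟩
      rw [norm_smul, norm_bvec, mul_one, norm_of_nonneg hr0.le]
    have hxp : 0 < ‖x‖ := by rw [hx]; exact hr0
    have hz : ∀ z ∈ Metric.ball x (‖x‖ / 2), z ≠ 0 ∧ ‖z‖ < 3 / 2 * ‖x‖ := by
      intro z hz
      have h1 : ‖z - x‖ < ‖x‖ / 2 := by simpa [dist_eq_norm] using hz
      have h2 := norm_sub_norm_le x z
      have h3 := norm_sub_norm_le z x
      rw [norm_sub_rev] at h2
      exact ⟨by rw [← norm_pos_iff]; linarith, by linarith⟩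
    have m1 : min δ (min ρ ρ') ≤ δ := min_le_left _ _
    have m2 : min δ (min ρ ρ') ≤ ρ := (min_le_right _ _).trans (min_le_left _ _)
    have m3 : min δ (min ρ ρ') ≤ ρ' := (min_le_right _ _).trans (min_le_right _ _)
    have h := hlow (fun y => (-σ) * (u y - u 0)) x (‖x‖ / 2) (a / (C * 36))
      (a / 2 / (3 / 2 * ‖x‖) ^ 2) (by positivity) ?_ ?_ ?_
    · rw [show a / 2 / (3 / 2 * ‖x‖) ^ 2 = 2 / 9 * (a / ‖x‖ ^ 2) by field_simp; norm_num,
        show C * (a / (C * 36)) / (‖x‖ / 2) ^ 2 = 1 / 9 * (a / ‖x‖ ^ 2) by field_simp; norm_num] at h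
      have : 0 < a / ‖x‖ ^ 2 := by positivity
      linarith
    · refine contDiffOn_const.mul ((hu.mono fun z hz' => ⟨?_, (hz z hz').1⟩).sub contDiffOn_const)
      simpa using (by linarith [(hz z hz').2] : ‖z‖ < δ)
    · intro z hz'
      have := hρu (x := z) (by simpa using (by linarith [(hz z hz').2] : ‖z‖ < ρ'))
      rw [abs_mul, abs_neg, hσ, one_mul]
      exact (by simpa [Real.dist_eq] using this : |u z - u 0| < _).le
    · intro z hz'
      rw [lapl_const_mul_sub_const, neg_mul]
      have hzp : 0 < ‖z‖ := norm_pos_iff.2 (hz z hz').1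
      refine le_trans ?_ (hρa z (by simpa using (by linarith [(hz z hz').2] : ‖z‖ < ρ)) (hz z hz').1)
      have := (hz z hz').2.le
      gcongr
  rcases lt_trichotomy (γ * u 0) 0 with h | h | h
  · exact (hsg (-1) (by simp) (by linarith)).elim
  · exact h
  · exact (hsg 1 (by simp) (by linarith)).elim

lemma ApproxHardy.exists_radius (hn : 3 ≤ n) [NeZero n] {γ κ A δ : ℝ} (hκ0 : 0 < κ) (hκ2 : κ < 2)
    (hA : 0 ≤ A) (hδ : 0 < δ) {η : ℝ} (hη : 0 < η) :
    ∃ ρ > 0, ∀ w : Eucl n → ℝ, ApproxHardy γ κ δ A w → Tendsto w (nhdsWithin 0 {0}ᶜ) (nhds 0) →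
      ∀ x : Eucl n, x ≠ 0 → ‖x‖ ≤ ρ → |w x| ≤ η := by
  by_contra! hcon
  have hpos : ∀ j : ℕ, (0 : ℝ) < 1 / ((j : ℝ) + 1) := fun j => by positivity
  choose w hw hw0 x hx0 hxj hxη using fun j : ℕ => hcon (1 / ((j : ℝ) + 1)) (hpos j)
  have hxp : ∀ j, 0 < ‖x j‖ := fun j => norm_pos_iff.2 (hx0 j)
  have hxt : Tendsto (fun j => ‖x j‖) atTop (nhds 0) :=
    squeeze_zero (fun j => norm_nonneg _) hxj tendsto_one_div_add_atTop_nhds_zero_nat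
  have hxt' : Tendsto (fun j => ‖x j‖) atTop (nhdsWithin 0 (Ioi 0)) :=
    tendsto_nhdsWithin_iff.2 ⟨hxt, Eventually.of_forall hxp⟩
  have hR : Tendsto (fun j => δ / ‖x j‖) atTop atTop := by
    have := (tendsto_inv_nhdsGT_zero.comp hxt').const_mul_atTop hδ
    simpa [div_eq_mul_inv] using this
  have hε : Tendsto (fun j => A * ‖x j‖ ^ κ) atTop (nhds 0) := by
    have := (hxt.rpow_const (p := κ) (Or.inr hκ0.le)).const_mul A
    rwa [Real.zero_rpow hκ0.ne', mul_zero] at this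
  have hsm : ∀ j, Tendsto (fun y => w j (‖x j‖ • y)) (nhdsWithin 0 {0}ᶜ) (nhds 0) := by
    intro j
    refine (hw0 j).comp (tendsto_nhdsWithin_iff.2 ⟨?_, ?_⟩)
    · have : ContinuousAt (fun y : Eucl n => ‖x j‖ • y) 0 := by fun_prop
      simpa [ContinuousAt] using this.tendsto.mono_left (nhdsWithin_le_nhds (s := {0}ᶜ))
    · filter_upwards [self_mem_nhdsWithin] with y hy
      exact smul_ne_zero (hxp j).ne' hy
  obtain ⟨j, hj⟩ := (ApproxHardy.tendsto_zero hn hκ0 hκ2 (fun j => (hw j).scale (hxp j))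
    (fun j => mul_nonneg hA (Real.rpow_nonneg (hxp j).le _)) hR hε hsm hη).exists
  have := hj (‖x j‖⁻¹ • x j) (by
    rw [norm_smul, norm_inv, norm_norm, inv_mul_cancel₀ (hxp j).ne'])
  rw [smul_smul, mul_inv_cancel₀ (hxp j).ne', one_smul] at this
  exact (hxη j).not_ge this

lemma uniform_control_near_zero (hn : 3 ≤ n) [NeZero n] {γ κ A δ : ℝ} (hκ0 : 0 < κ) (hκ2 : κ < 2)
    (hA : 0 ≤ A) (hδ : 0 < δ) {ι : Type*} {u : ι → Eucl n → ℝ}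
    (hu : ∀ k, ContDiffOn ℝ 2 (u k) (Metric.ball 0 δ \ {0}))
    (hc : ∀ k, ContinuousOn (u k) (Metric.ball 0 δ))
    (he : ∀ k, ∀ x ∈ Metric.ball (0 : Eucl n) δ, x ≠ 0 →
      |lapl (u k) x + γ * u k x / ‖x‖ ^ 2| ≤ A * ‖x‖ ^ (κ - 2) * |u k x|)
    (hloc : ∀ ρ > 0, ∃ B, ∀ k, ∀ x : Eucl n, ρ ≤ ‖x‖ → ‖x‖ < δ → |u k x| ≤ B) :
    (∃ M, ∀ k, ∀ x : Eucl n, ‖x‖ ≤ δ / 2 → |u k x| ≤ M) ∧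
      ∀ η > 0, ∃ ρ > 0, ∀ k, ∀ x : Eucl n, ‖x‖ ≤ ρ → |u k x - u k 0| ≤ η := by
  have hsub : Metric.closedBall (0 : Eucl n) (δ / 2) ⊆ Metric.ball 0 δ :=
    Metric.closedBall_subset_ball (by linarith)
  have hca : ∀ k, ContinuousAt (u k) 0 := fun k =>
    (hc k).continuousAt (Metric.ball_mem_nhds 0 hδ)
  have hmax : ∀ k, ∃ M, 0 ≤ M ∧ (∀ x : Eucl n, ‖x‖ ≤ δ / 2 → |u k x| ≤ M) ∧
      ∃ x : Eucl n, ‖x‖ ≤ δ / 2 ∧ |u k x| = M := by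
    intro k
    obtain ⟨x, hx, hmx⟩ := (isCompact_closedBall (0 : Eucl n) (δ / 2)).exists_isMaxOn
      ⟨0, by simpa using (half_pos hδ).le⟩ ((hc k).mono hsub).abs
    exact ⟨|u k x|, abs_nonneg _, fun y hy => hmx (by simpa using hy), x, by simpa using hx, rfl⟩
  choose M hM0 hMle xm hxm hxmM using hmax
  have hγ : ∀ k, γ * u k 0 = 0 := fun k =>
    mul_self_eq_zero_of_hardy (A := A * M k) hκ0 (half_pos hδ)
      ((hu k).mono (diff_subset_diff_left (Metric.ball_subset_ball (by linarith)))) (hca k)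
      fun x hx hx0 => by
        have hx' : ‖x‖ < δ / 2 := by simpa using hx
        refine (he k x (by simpa using (by linarith : ‖x‖ < δ)) hx0).trans ?_
        have h1 := hMle k x hx'.le
        have h2 : 0 ≤ ‖x‖ ^ (κ - 2) := Real.rpow_nonneg (norm_nonneg x) _
        calc A * ‖x‖ ^ (κ - 2) * |u k x| ≤ A * ‖x‖ ^ (κ - 2) * M k := by gcongr
          _ = _ := by ring
  have hosc : ∀ η > 0, ∃ ρ > 0, ∀ k, ∀ x : Eucl n, ‖x‖ ≤ ρ →
      |u k x - u k 0| ≤ η * (2 * (M k + 1)) := by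
    intro η hη
    obtain ⟨ρ, hρ, h⟩ := ApproxHardy.exists_radius (γ := γ) hn hκ0 hκ2 hA (half_pos hδ) hη
    refine ⟨ρ, hρ, fun k x hx => ?_⟩
    have hMp : 0 < 2 * (M k + 1) := by linarith [hM0 k]
    rcases eq_or_ne x 0 with rfl | hx0
    · simp only [sub_self, abs_zero]; positivity
    have hwx := h (fun y => (2 * (M k + 1))⁻¹ * (u k y - u k 0)) ⟨?_, ?_, ?_⟩ ?_ x hx0 hx
    · rw [abs_mul, abs_inv, abs_of_pos hMp, inv_mul_le_iff₀ hMp] at hwx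
      linarith
    · exact contDiffOn_const.mul (((hu k).mono
        (diff_subset_diff_left (Metric.ball_subset_ball (by linarith)))).sub contDiffOn_const)
    · intro y hy hy0
      rw [abs_mul, abs_inv, abs_of_pos hMp, inv_mul_le_iff₀ hMp]
      have h1 := hMle k y (by simpa using (Metric.mem_ball.1 hy).le)
      have h2 := hMle k 0 (by simpa using (half_pos hδ).le)
      linarith [abs_sub (u k y) (u k 0)]
    · intro y hy hy0
      have hy' : ‖y‖ < δ / 2 := by simpa using hy
      rw [lapl_const_mul_sub_const]
      have e : (2 * (M k + 1))⁻¹ * lapl (u k) y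
          + γ * ((2 * (M k + 1))⁻¹ * (u k y - u k 0)) / ‖y‖ ^ 2
          = (2 * (M k + 1))⁻¹ * (lapl (u k) y + γ * u k y / ‖y‖ ^ 2) := by
        have := hγ k
        linear_combination (-(2 * (M k + 1))⁻¹ / ‖y‖ ^ 2) * this
      rw [e, abs_mul, abs_inv, abs_of_pos hMp, inv_mul_le_iff₀ hMp]
      refine (he k y (by simpa using (by linarith : ‖y‖ < δ)) hy0).trans ?_
      have h1 := hMle k y hy'.le
      have h2 : 0 ≤ A * ‖y‖ ^ (κ - 2) := mul_nonneg hA (Real.rpow_nonneg (norm_nonneg y) _)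
      have h3 : |u k y| ≤ 2 * (M k + 1) := by linarith [hM0 k]
      calc A * ‖y‖ ^ (κ - 2) * |u k y| ≤ A * ‖y‖ ^ (κ - 2) * (2 * (M k + 1)) := by gcongr
        _ = _ := by ring
    · have : ContinuousAt (fun y => (2 * (M k + 1))⁻¹ * (u k y - u k 0)) 0 :=
        continuousAt_const.mul ((hca k).sub continuousAt_const)
      simpa [ContinuousAt] using this.tendsto.mono_left (nhdsWithin_le_nhds (s := {0}ᶜ))
  have hMb : ∃ K, 0 ≤ K ∧ ∀ k, M k ≤ K := by
    obtain ⟨ρ₀, hρ₀, hρ⟩ := hosc (1 / 8) (by norm_num)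
    set ρ := min ρ₀ (δ / 2) with hρd
    have hρp : 0 < ρ := by positivity
    obtain ⟨B, hB⟩ := hloc ρ hρp
    refine ⟨2 * |B| + 1, by positivity, fun k => ?_⟩
    obtain ⟨y, hy⟩ : ∃ y : Eucl n, ‖y‖ = ρ := by
      refine ⟨ρ • bvec 0, ?_⟩
      rw [norm_smul, norm_bvec, mul_one, norm_of_nonneg hρp.le]
    have b1 := hρ k y (hy.le.trans (min_le_left _ _))
    have b2 := hB k y hy.ge (by rw [hy]; linarith [min_le_right ρ₀ (δ / 2)])
    have b3 : |u k 0| ≤ |B| + 1 / 8 * (2 * (M k + 1)) := by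
      have := abs_sub_abs_le_abs_sub (u k 0) (u k y)
      rw [abs_sub_comm] at this
      linarith [le_abs_self B]
    rcases le_or_gt ρ ‖xm k‖ with hge | hlt
    · have := hB k (xm k) hge (by linarith [hxm k])
      rw [hxmM] at this
      linarith [le_abs_self B, abs_nonneg B]
    · have := hρ k (xm k) (hlt.le.trans (min_le_left _ _))
      have h2 := abs_sub_abs_le_abs_sub (u k (xm k)) (u k 0)
      rw [hxmM] at h2
      linarith
  obtain ⟨K, hK0, hK⟩ := hMb
  refine ⟨⟨K, fun k x hx => (hMle k x hx).trans (hK k)⟩, fun η hη => ?_⟩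
  obtain ⟨ρ, hρ, h⟩ := hosc (η / (2 * (K + 1))) (by positivity)
  refine ⟨ρ, hρ, fun k x hx => (h k x hx).trans ?_⟩
  rw [div_mul_eq_mul_div, div_le_iff₀ (by positivity)]
  have := hK k
  gcongr

end NearZero

section Chart

variable {n : ℕ}

/-- The gradient field in coordinates. -/
noncomputable def grd (φ : Eucl n → ℝ) (x : Eucl n) : Eucl n := ∑ i, fderiv ℝ φ x (bvec i) • bvec i

lemma fderiv_fderiv_apply_vec {F : Type*} [NormedAddCommGroup F] [NormedSpace ℝ F]
    {u : Eucl n → F} {x : Eucl n} (hu : DifferentiableAt ℝ (fderiv ℝ u) x) (v w : Eucl n) :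
    fderiv ℝ (fun y => fderiv ℝ u y v) x w = fderiv ℝ (fderiv ℝ u) x w v := by
  have := (hu.hasFDerivAt.clm_apply (hasFDerivAt_const v x)).fderiv
  rw [this]
  simp

lemma map_grd {F : Type*} [NormedAddCommGroup F] [NormedSpace ℝ F] (A : Eucl n →L[ℝ] F)
    (φ : Eucl n → ℝ) (x : Eucl n) :
    A (grd φ x) = ∑ i, fderiv ℝ φ x (bvec i) • A (bvec i) := by
  simp [grd, map_sum]

lemma fderiv_grd (φ : Eucl n → ℝ) (x : Eucl n) :
    fderiv ℝ φ x (grd φ x) = ∑ i, fderiv ℝ φ x (bvec i) ^ 2 := by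
  rw [map_grd]
  exact Finset.sum_congr rfl fun i _ => by rw [smul_eq_mul, sq]

lemma fderiv_grd_pos {φ : Eucl n → ℝ} {x : Eucl n} (h : fderiv ℝ φ x ≠ 0) :
    0 < fderiv ℝ φ x (grd φ x) := by
  rw [fderiv_grd]
  refine lt_of_le_of_ne (Finset.sum_nonneg fun i _ => sq_nonneg _) fun h0 => h ?_
  have h1 := (Finset.sum_eq_zero_iff_of_nonneg fun i _ => sq_nonneg _).1 h0.symm
  ext v
  rw [map_sum_coord (fderiv ℝ φ x) v]
  simp only [zero_apply]
  refine Finset.sum_eq_zero fun i hi => ?_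
  rw [pow_eq_zero_iff two_ne_zero |>.1 (h1 i hi), smul_zero]

lemma ContDiff.grd {φ : Eucl n → ℝ} (hφ : ContDiff ℝ (⊤ : ℕ∞) φ) :
    ContDiff ℝ (⊤ : ℕ∞) (_root_.grd φ) := by
  have : ∀ i : Fin n, ContDiff ℝ (⊤ : ℕ∞) fun x => fderiv ℝ φ x (bvec i) • (bvec i : Eucl n) :=
    fun i => (hφ.fderiv_apply_const (bvec i)).smul contDiff_const
  exact ContDiff.sum fun i _ => this i

lemma ContDiff.lapl {φ : Eucl n → ℝ} (hφ : ContDiff ℝ (⊤ : ℕ∞) φ) :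
    ContDiff ℝ (⊤ : ℕ∞) (_root_.lapl φ) := by
  have h1 : ContDiff ℝ (⊤ : ℕ∞) (fderiv ℝ (fderiv ℝ φ)) :=
    (hφ.fderiv_right (m := (⊤ : ℕ∞)) (by simp)).fderiv_right (m := (⊤ : ℕ∞)) (by simp)
  exact ContDiff.sum fun i _ => (h1.clm_apply contDiff_const).clm_apply contDiff_const

lemma exists_reflection_field {φ : Eucl n → ℝ} (hφ : ContDiff ℝ (⊤ : ℕ∞) φ) {U : Set (Eucl n)}
    (hU : IsOpen U) (hne : ∀ x ∈ U, fderiv ℝ φ x ≠ 0) :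
    ∃ V : Eucl n → Eucl n, ContDiffOn ℝ (⊤ : ℕ∞) V U ∧ ∀ x ∈ U, φ x = 0 →
      V x = (2 / fderiv ℝ φ x (grd φ x)) • grd φ x ∧
      lapl φ x * fderiv ℝ φ x (V x) + 2 * fderiv ℝ φ x (fderiv ℝ V x (grd φ x)) = 0 := by
  have hDφ : ContDiff ℝ (⊤ : ℕ∞) (fderiv ℝ φ) := hφ.fderiv_right (m := (⊤ : ℕ∞)) (by simp)
  set N := grd φ with hN
  have hNs : ContDiff ℝ (⊤ : ℕ∞) N := hφ.grd
  let ν : Eucl n → ℝ := fun x => fderiv ℝ φ x (N x)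
  have hν : ContDiff ℝ (⊤ : ℕ∞) ν := hDφ.clm_apply hNs
  have hν0 : ∀ x ∈ U, ν x ≠ 0 := fun x hx => (fderiv_grd_pos (hne x hx)).ne'
  let X : Eucl n → Eucl n := fun x => (2 / ν x) • N x
  have hX : ContDiffOn ℝ (⊤ : ℕ∞) X U :=
    (contDiffOn_const.div hν.contDiffOn hν0).smul hNs.contDiffOn
  have hDX : ContDiffOn ℝ (⊤ : ℕ∞) (fderiv ℝ X) U :=
    hX.fderiv_of_isOpen hU (m := (⊤ : ℕ∞)) (by simp)
  let c : Eucl n → ℝ := fun x => -(lapl φ x + fderiv ℝ φ x (fderiv ℝ X x (N x))) / ν x ^ 2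
  have hc : ContDiffOn ℝ (⊤ : ℕ∞) c U := by
    refine ContDiffOn.div (ContDiffOn.neg (hφ.lapl.contDiffOn.add
      (hDφ.contDiffOn.clm_apply (hDX.clm_apply hNs.contDiffOn)))) (hν.pow 2).contDiffOn
      fun x hx => pow_ne_zero 2 (hν0 x hx)
  let Y : Eucl n → Eucl n := fun x => c x • N x
  have hY : ContDiffOn ℝ (⊤ : ℕ∞) Y U := hc.smul hNs.contDiffOn
  refine ⟨fun x => X x + φ x • Y x, hX.add (hφ.contDiffOn.smul hY), fun x hx h0 => ?_⟩
  have hXx : DifferentiableAt ℝ X x :=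
    (hX.contDiffAt (hU.mem_nhds hx)).differentiableAt (by simp)
  have hYx : DifferentiableAt ℝ Y x :=
    (hY.contDiffAt (hU.mem_nhds hx)).differentiableAt (by simp)
  have hφx : DifferentiableAt ℝ φ x := hφ.differentiable (by simp) x
  have hD : fderiv ℝ (fun x => X x + φ x • Y x) x
      = fderiv ℝ X x + (fderiv ℝ φ x).smulRight (Y x) := by
    rw [(hXx.hasFDerivAt.fun_add (hφx.hasFDerivAt.fun_smul hYx.hasFDerivAt)).fderiv]
    ext v
    simp [h0]
  refine ⟨by simp [h0, X, ν], ?_⟩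
  have h1 : X x + φ x • Y x = X x := by simp [h0]
  rw [hD]
  beta_reduce
  rw [h1]
  have hν1 : ν x ≠ 0 := hν0 x hx
  have e1 : fderiv ℝ φ x (X x) = 2 := by
    simp only [X, map_smul, smul_eq_mul]
    exact div_mul_cancel₀ 2 hν1
  have e2 : fderiv ℝ φ x (Y x) = c x * ν x := by
    simp only [Y, map_smul, smul_eq_mul, ν]
  simp only [zero_smul, add_zero, zero_add, add_apply, ContinuousLinearMap.smulRight_apply,
    map_add, map_smul, e1, e2, smul_eq_mul]
  have e3 : fderiv ℝ φ x (N x) = ν x := rfl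
  rw [e3]
  simp only [c]
  field_simp
  ring

end Chart

section ChartExists

variable {n : ℕ}

/-- A local defining function and a reflection across the boundary that preserves harmonicity to
first order at the boundary. -/
structure BdryChart (Ω : Set (Eucl n)) (x₀ : Eucl n) (φ : Eucl n → ℝ) (R : Eucl n → Eucl n)
    (ρ₁ ρ₂ K : ℝ) : Prop where
  pos : 0 < ρ₂
  le : ρ₂ ≤ ρ₁
  one_le : 1 ≤ K
  half_lt : ∀ x ∈ Metric.ball x₀ ρ₁, ‖x₀‖ / 2 < ‖x‖
  base : φ x₀ = 0
  smooth : ContDiff ℝ (⊤ : ℕ∞) φ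
  mem_iff : ∀ x ∈ Metric.ball x₀ ρ₁, (x ∈ Ω ↔ φ x < 0)
  mem_closure_iff : ∀ x ∈ Metric.ball x₀ ρ₁, (x ∈ closure Ω ↔ φ x ≤ 0)
  grd_pos : ∀ x ∈ Metric.ball x₀ ρ₁, 0 < fderiv ℝ φ x (grd φ x)
  smooth_refl : ContDiffOn ℝ (⊤ : ℕ∞) R (Metric.ball x₀ ρ₂)
  mapsTo : MapsTo R (Metric.ball x₀ ρ₂) (Metric.ball x₀ ρ₁)
  refl_neg : ∀ x ∈ Metric.ball x₀ ρ₂, 0 < φ x → φ (R x) < 0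
  refl_eq : ∀ x ∈ Metric.ball x₀ ρ₂, φ x = 0 → R x = x
  fderiv_refl : ∀ x ∈ Metric.ball x₀ ρ₂, φ x = 0 → ∀ v, fderiv ℝ R x v
    = v - fderiv ℝ φ x v • ((2 / fderiv ℝ φ x (grd φ x)) • grd φ x)
  lapl_refl : ∀ x ∈ Metric.ball x₀ ρ₂, φ x = 0 →
    fderiv ℝ φ x (∑ i, fderiv ℝ (fderiv ℝ R) x (bvec i) (bvec i)) = 0
  norm_fderiv_le : ∀ x ∈ Metric.ball x₀ ρ₂, ‖fderiv ℝ R x‖ ≤ K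
  norm_fderiv2_le : ∀ x ∈ Metric.ball x₀ ρ₂, ‖fderiv ℝ (fderiv ℝ R) x‖ ≤ K
  lipschitz : ∀ x ∈ Metric.ball x₀ ρ₂, ∀ y ∈ Metric.ball x₀ ρ₂,
    ‖fderiv ℝ (fderiv ℝ R) x - fderiv ℝ (fderiv ℝ R) y‖ ≤ K * ‖x - y‖

lemma BdryChart.zero_notMem {Ω : Set (Eucl n)} {x₀ : Eucl n} {φ : Eucl n → ℝ} {R : Eucl n → Eucl n}
    {ρ₁ ρ₂ K : ℝ} (hch : BdryChart Ω x₀ φ R ρ₁ ρ₂ K) : (0 : Eucl n) ∉ Metric.ball x₀ ρ₁ := fun h => by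
  have h1 := hch.half_lt 0 h
  rw [norm_zero] at h1
  linarith [norm_nonneg x₀]

lemma tendsto_add_smul_nhdsGT (x v : Eucl n) :
    Tendsto (fun t : ℝ => x + t • v) (nhdsWithin 0 (Ioi 0)) (nhds x) := by
  have h : ContinuousAt (fun t : ℝ => x + t • v) 0 := by fun_prop
  have h1 := h.tendsto
  simp only [zero_smul, add_zero] at h1
  exact h1.mono_left nhdsWithin_le_nhds

lemma eventually_neg_of_fderiv_neg {φ : Eucl n → ℝ} {x v : Eucl n} (hφ : DifferentiableAt ℝ φ x)
    (h0 : φ x = 0) (hv : fderiv ℝ φ x v < 0) :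
    ∀ᶠ t : ℝ in nhdsWithin 0 (Ioi 0), φ (x + t • v) < 0 := by
  have hl : HasDerivAt (fun t : ℝ => x + t • v) v 0 := by
    simpa using ((hasDerivAt_id (0 : ℝ)).smul_const v).const_add x
  have h1 : HasDerivAt (fun t : ℝ => φ (x + t • v)) (fderiv ℝ φ x v) 0 := by
    have h2 : HasFDerivAt φ (fderiv ℝ φ x) (x + (0 : ℝ) • v) := by
      simpa using hφ.hasFDerivAt
    exact h2.comp_hasDerivAt (0 : ℝ) hl
  have h4 := h1.hasDerivWithinAt (s := Ioi 0)
  rw [hasDerivWithinAt_iff_tendsto_slope' (by simp)] at h4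
  filter_upwards [h4.eventually_lt_const hv, self_mem_nhdsWithin] with t ht ht0
  rw [slope_def_field] at ht
  simp only [zero_smul, add_zero, h0, sub_zero] at ht
  have ht0' : 0 < t := ht0
  by_contra hcon
  exact absurd ht (not_lt.2 (div_nonneg (not_lt.1 hcon) ht0'.le))

lemma mem_closure_of_fderiv_ne_zero {Ω U : Set (Eucl n)} {φ : Eucl n → ℝ} {x : Eucl n}
    (hU : IsOpen U) (hx : x ∈ U) (hφ : DifferentiableAt ℝ φ x) (h0 : φ x = 0)
    (hne : fderiv ℝ φ x ≠ 0) (hΩ : Ω ∩ U = {y ∈ U | φ y < 0}) : x ∈ closure Ω := by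
  have hN : fderiv ℝ φ x (-grd φ x) < 0 := by
    rw [map_neg]; linarith [fderiv_grd_pos hne]
  have hc := tendsto_add_smul_nhdsGT x (-grd φ x)
  refine mem_closure_of_tendsto hc ?_
  filter_upwards [eventually_neg_of_fderiv_neg hφ h0 hN, hc.eventually (hU.mem_nhds hx)]
    with t ht htU
  have : x + t • (-grd φ x) ∈ Ω ∩ U := by rw [hΩ]; exact ⟨htU, ht⟩
  exact this.1

lemma fderiv_sub_smul_apply {φ : Eucl n → ℝ} {V : Eucl n → Eucl n} {x : Eucl n}
    (hφ : DifferentiableAt ℝ φ x) (hV : DifferentiableAt ℝ V x) (v : Eucl n) :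
    fderiv ℝ (fun x => x - φ x • V x) x v
      = v - (φ x • fderiv ℝ V x v + fderiv ℝ φ x v • V x) := by
  have h : HasFDerivAt (fun x => x - φ x • V x) _ x :=
    (hasFDerivAt_id x).fun_sub (hφ.hasFDerivAt.fun_smul hV.hasFDerivAt)
  rw [h.fderiv]
  rfl

lemma fderiv_sub_smul_add_apply {φ ψ : Eucl n → ℝ} {V W : Eucl n → Eucl n} {x : Eucl n}
    (hφ : DifferentiableAt ℝ φ x) (hV : DifferentiableAt ℝ V x)
    (hψ : DifferentiableAt ℝ ψ x) (hW : DifferentiableAt ℝ W x) (e v : Eucl n) :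
    fderiv ℝ (fun x => e - (φ x • V x + ψ x • W x)) x v
      = -(φ x • fderiv ℝ V x v + fderiv ℝ φ x v • V x
        + (ψ x • fderiv ℝ W x v + fderiv ℝ ψ x v • W x)) := by
  rw [((hasFDerivAt_const e x).fun_sub ((hφ.hasFDerivAt.fun_smul hV.hasFDerivAt).fun_add
    (hψ.hasFDerivAt.fun_smul hW.hasFDerivAt))).fderiv]
  rw [zero_sub]
  rfl

lemma ContinuousAt.eventually_norm_lt {X F : Type*} [TopologicalSpace X]
    [SeminormedAddCommGroup F] {f : X → F} {x : X} (h : ContinuousAt f x) :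
    ∀ᶠ y in nhds x, ‖f y‖ < ‖f x‖ + 1 :=
  h.norm.tendsto.eventually_lt_const (lt_add_one _)

set_option maxHeartbeats 1000000 in
lemma exists_bdryChart {Ω : Set (Eucl n)} (hΩ : SmoothDomain Ω) (h0 : (0 : Eucl n) ∈ Ω)
    {x₀ : Eucl n} (hx₀ : x₀ ∈ frontier Ω) : ∃ φ R ρ₁ ρ₂ K, BdryChart Ω x₀ φ R ρ₁ ρ₂ K := by
  obtain ⟨hopen, -, hloc⟩ := hΩ
  obtain ⟨U, φ, hU, hxU, hφ, hne, hΩU⟩ := hloc x₀ hx₀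
  have hx₀n : x₀ ∉ Ω := by
    have := hx₀.2; rwa [hopen.interior_eq] at this
  have hx₀0 : x₀ ≠ 0 := fun h => hx₀n (h ▸ h0)
  have hφd : Differentiable ℝ φ := hφ.differentiable (by simp)
  have mem1 : ∀ x ∈ U, (x ∈ Ω ↔ φ x < 0) := fun x hx => by
    constructor
    · intro h
      have : x ∈ Ω ∩ U := ⟨h, hx⟩
      rw [hΩU] at this
      exact this.2
    · intro h
      have : x ∈ {y ∈ U | φ y < 0} := ⟨hx, h⟩
      rw [← hΩU] at this
      exact this.1
  have mem2 : ∀ x ∈ U, (x ∈ closure Ω ↔ φ x ≤ 0) := fun x hx => by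
    constructor
    · intro h
      by_contra hcon
      push Not at hcon
      have : U ∩ φ ⁻¹' (Ioi 0) ∈ nhds x :=
        inter_mem (hU.mem_nhds hx) (hφd.continuous.continuousAt.preimage_mem_nhds (Ioi_mem_nhds hcon))
      obtain ⟨y, hy, hyΩ⟩ := mem_closure_iff_nhds.1 h _ this
      have h1 := (mem1 y hy.1).1 hyΩ
      have h2 : 0 < φ y := hy.2
      linarith
    · intro h
      rcases h.lt_or_eq with h | h
      · exact subset_closure ((mem1 x hx).2 h)
      · exact mem_closure_of_fderiv_ne_zero hU hx (hφd x) h (hne x hx) hΩU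
  have hb0 : φ x₀ = 0 := le_antisymm ((mem2 x₀ hxU).1 hx₀.1)
    (not_lt.1 fun h => hx₀n ((mem1 x₀ hxU).2 h))
  obtain ⟨V, hV, hVp⟩ := exists_reflection_field hφ hU hne
  set R : Eucl n → Eucl n := fun x => x - φ x • V x with hR
  have hRs : ContDiffOn ℝ (⊤ : ℕ∞) R U := contDiffOn_id.sub (hφ.contDiffOn.smul hV)
  have hVd : ∀ x ∈ U, DifferentiableAt ℝ V x := fun x hx =>
    (hV.contDiffAt (hU.mem_nhds hx)).differentiableAt (by simp)
  have hDR : ∀ x ∈ U, ∀ v, fderiv ℝ R x v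
      = v - (φ x • fderiv ℝ V x v + fderiv ℝ φ x v • V x) := fun x hx v => by
    exact fderiv_sub_smul_apply (hφd x) (hVd x hx) v
  have hV' : ContDiffOn ℝ (⊤ : ℕ∞) (fderiv ℝ V) U :=
    hV.fderiv_of_isOpen hU (m := (⊤ : ℕ∞)) (by simp)
  have hR' : ContDiffOn ℝ (⊤ : ℕ∞) (fderiv ℝ R) U :=
    hRs.fderiv_of_isOpen hU (m := (⊤ : ℕ∞)) (by simp)
  have hR'' : ContDiffOn ℝ (⊤ : ℕ∞) (fderiv ℝ (fderiv ℝ R)) U :=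
    hR'.fderiv_of_isOpen hU (m := (⊤ : ℕ∞)) (by simp)
  have hφ' : Differentiable ℝ (fderiv ℝ φ) :=
    (hφ.fderiv_right (m := (⊤ : ℕ∞)) (by simp)).differentiable (by simp)
  have hlap : ∀ x ∈ U, φ x = 0 →
      fderiv ℝ φ x (∑ i, fderiv ℝ (fderiv ℝ R) x (bvec i) (bvec i)) = 0 := fun x hx hx0 => by
    have h1 : ∀ e : Eucl n, fderiv ℝ (fderiv ℝ R) x e e
        = -((2 * fderiv ℝ φ x e) • fderiv ℝ V x e + fderiv ℝ (fderiv ℝ φ) x e e • V x) :=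
      fun e => by
      have hd : DifferentiableAt ℝ (fderiv ℝ R) x :=
        (hR'.contDiffAt (hU.mem_nhds hx)).differentiableAt (by simp)
      have hdV : DifferentiableAt ℝ (fderiv ℝ V) x :=
        (hV'.contDiffAt (hU.mem_nhds hx)).differentiableAt (by simp)
      rw [← fderiv_fderiv_apply_vec hd e e]
      have he : (fun y => fderiv ℝ R y e) =ᶠ[nhds x]
          fun y => e - (φ y • fderiv ℝ V y e + fderiv ℝ φ y e • V y) := by
        filter_upwards [hU.mem_nhds hx] with y hy using hDR y hy e
      rw [he.fderiv_eq]
      rw [fderiv_sub_smul_add_apply (hφd x) (hdV.clm_apply (differentiableAt_const e))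
        ((hφ' x).clm_apply (differentiableAt_const e)) (hVd x hx) e e,
        fderiv_fderiv_apply_vec (hφ' x), hx0, zero_smul, zero_add]
      module
    rw [map_sum]
    have h3 := (hVp x hx hx0).2
    rw [map_grd (fderiv ℝ V x) φ x, map_sum] at h3
    simp only [h1, map_neg, map_add, map_smul, smul_eq_mul, Finset.sum_neg_distrib,
      Finset.sum_add_distrib, neg_eq_zero] at h3 ⊢
    rw [lapl, Finset.sum_mul, Finset.mul_sum] at h3
    rw [add_comm, ← h3]
    congr 1
    exact Finset.sum_congr rfl fun i _ => by ring
  -- the reflection maps the outside to the inside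
  have hRc : ContinuousAt R x₀ := hRs.continuousOn.continuousAt (hU.mem_nhds hxU)
  have hVc : ContinuousAt V x₀ := hV.continuousOn.continuousAt (hU.mem_nhds hxU)
  have hR0 : R x₀ = x₀ := by simp [hR, hb0]
  have hneg : ∀ᶠ x in nhds x₀, 0 < φ x → φ (R x) < 0 := by
    have hst : HasStrictFDerivAt φ (fderiv ℝ φ x₀) x₀ :=
      hφ.contDiffAt.hasStrictFDerivAt (by simp)
    set L := ‖V x₀‖ + 1
    have hL : 0 < L := by positivity
    have hlo := hst.isLittleO.def (c := 1 / (4 * L)) (by positivity)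
    have ht : Tendsto (fun x => (R x, x)) (nhds x₀) (nhds (x₀, x₀)) := by
      have := hRc.tendsto
      rw [hR0] at this
      exact this.prodMk_nhds tendsto_id
    have hV2 : fderiv ℝ φ x₀ (V x₀) = 2 := by
      rw [(hVp x₀ hxU hb0).1, map_smul, smul_eq_mul]
      exact div_mul_cancel₀ _ (fderiv_grd_pos (hne x₀ hxU)).ne'
    have e1 : ∀ᶠ x in nhds x₀, 7 / 4 < fderiv ℝ φ x₀ (V x) := by
      have : Tendsto (fun x => fderiv ℝ φ x₀ (V x)) (nhds x₀) (nhds (fderiv ℝ φ x₀ (V x₀))) :=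
        (fderiv ℝ φ x₀).continuous.continuousAt.tendsto.comp hVc.tendsto
      rw [hV2] at this
      exact this.eventually_const_lt (by norm_num)
    have e2 : ∀ᶠ x in nhds x₀, ‖V x‖ < L := hVc.norm.tendsto.eventually_lt_const (by simp [L])
    filter_upwards [ht.eventually hlo, e1, e2] with x hx1 hx2 hx3 hpos
    simp only [hR, sub_sub_cancel_left, map_neg, map_smul, smul_eq_mul, norm_neg, norm_smul,
      Real.norm_eq_abs, abs_of_pos hpos] at hx1
    have h4 := (abs_le.1 hx1).2
    have h5 : 1 / (4 * L) * (φ x * ‖V x‖) ≤ φ x / 4 := by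
      rw [div_mul_eq_mul_div, div_le_div_iff₀ (by positivity) (by norm_num)]
      nlinarith
    simp only [hR]
    nlinarith
  -- choice of the radii
  obtain ⟨ρ₁, hρ₁, hb1⟩ := Metric.eventually_nhds_iff_ball.1
    ((hU.eventually_mem hxU).and (continuous_norm.continuousAt.eventually_const_lt
      (half_lt_self (norm_pos_iff.2 hx₀0))))
  have hbound1 : ∀ᶠ x in nhds x₀, ‖fderiv ℝ R x‖ < ‖fderiv ℝ R x₀‖ + 1 :=
    (hR'.continuousOn.continuousAt (hU.mem_nhds hxU)).eventually_norm_lt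
  have hbound2 : ∀ᶠ x in nhds x₀, ‖fderiv ℝ (fderiv ℝ R) x‖ < ‖fderiv ℝ (fderiv ℝ R) x₀‖ + 1 :=
    (hR''.continuousOn.continuousAt (hU.mem_nhds hxU)).eventually_norm_lt
  obtain ⟨L, t, ht, hLip⟩ := ((hR''.contDiffAt (hU.mem_nhds hxU)).of_le
    (m := 1) (by exact_mod_cast le_top)).exists_lipschitzOnWith
  have hmaps : ∀ᶠ x in nhds x₀, R x ∈ Metric.ball x₀ ρ₁ := by
    have := hRc.tendsto
    rw [hR0] at this
    exact this.eventually (Metric.ball_mem_nhds x₀ hρ₁)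
  obtain ⟨ρ, hρ, hb2⟩ := Metric.eventually_nhds_iff_ball.1
    (hneg.and (hbound1.and (hbound2.and (hmaps.and (eventually_mem_set.2 ht)))))
  have hsub : ∀ x ∈ Metric.ball x₀ (min ρ ρ₁), x ∈ Metric.ball x₀ ρ ∧ x ∈ U := fun x hx =>
    ⟨Metric.ball_subset_ball (min_le_left _ _) hx,
      (hb1 x (Metric.ball_subset_ball (min_le_right _ _) hx)).1⟩
  refine ⟨φ, R, ρ₁, min ρ ρ₁, max 1 (max (‖fderiv ℝ R x₀‖ + 1)
    (max (‖fderiv ℝ (fderiv ℝ R) x₀‖ + 1) L)), ?_⟩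
  refine
    { pos := lt_min hρ hρ₁
      le := min_le_right _ _
      one_le := le_max_left _ _
      half_lt := fun x hx => (hb1 x hx).2
      base := hb0
      smooth := hφ
      mem_iff := fun x hx => mem1 x (hb1 x hx).1
      mem_closure_iff := fun x hx => mem2 x (hb1 x hx).1
      grd_pos := fun x hx => fderiv_grd_pos (hne x (hb1 x hx).1)
      smooth_refl := hRs.mono fun x hx => (hsub x hx).2
      mapsTo := fun x hx => (hb2 x (hsub x hx).1).2.2.2.1
      refl_neg := fun x hx => (hb2 x (hsub x hx).1).1
      refl_eq := fun x _ h => by simp [hR, h]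
      fderiv_refl := fun x hx h v => by
        rw [hDR x (hsub x hx).2, h, zero_smul, zero_add, (hVp x (hsub x hx).2 h).1]
      lapl_refl := fun x hx h => hlap x (hsub x hx).2 h
      norm_fderiv_le := fun x hx => ?_
      norm_fderiv2_le := fun x hx => ?_
      lipschitz := fun x hx y hy => ?_ }
  · exact (hb2 x (hsub x hx).1).2.1.le.trans ((le_max_left _ _).trans (le_max_right _ _))
  · exact (hb2 x (hsub x hx).1).2.2.1.le.trans
      (((le_max_left _ _).trans (le_max_right _ _)).trans (le_max_right _ _))
  · have := hLip.dist_le_mul x (hb2 x (hsub x hx).1).2.2.2.2 y (hb2 y (hsub y hy).1).2.2.2.2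
    rw [dist_eq_norm, dist_eq_norm] at this
    exact this.trans (mul_le_mul_of_nonneg_right
      (((le_max_right _ _).trans (le_max_right _ _)).trans (le_max_right _ _)) (norm_nonneg _))

end ChartExists

section Glue

variable {n : ℕ}

lemma apply_eq_zero_of_tangent {F : Type*} [NormedAddCommGroup F] [NormedSpace ℝ F]
    {φ : Eucl n → ℝ} {x : Eucl n} (hφ : ContDiff ℝ (⊤ : ℕ∞) φ) (hne : fderiv ℝ φ x ≠ 0)
    (hx : φ x = 0) {S : Set (Eucl n)} {f : Eucl n → F} {A : Eucl n →L[ℝ] F}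
    (hf : HasFDerivWithinAt f A S x) (hS : ∀ᶠ y in nhds x, φ y = 0 → y ∈ S ∧ f y = 0)
    {v : Eucl n} (hv : fderiv ℝ φ x v = 0) : A v = 0 := by
  have hst : HasStrictFDerivAt φ (fderiv ℝ φ x) x := hφ.contDiffAt.hasStrictFDerivAt (by simp)
  have hr : (fderiv ℝ φ x).range = ⊤ := by
    rw [LinearMap.range_eq_top]
    obtain ⟨w, hw⟩ : ∃ w, fderiv ℝ φ x w ≠ 0 := by
      by_contra hcon
      push Not at hcon
      exact hne (ContinuousLinearMap.ext hcon)
    intro t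
    refine ⟨(t / fderiv ℝ φ x w) • w, ?_⟩
    simp [hw]
  let v' : (fderiv ℝ φ x).ker := ⟨v, hv⟩
  let g := hst.implicitFunction φ (fderiv ℝ φ x) hr (φ x)
  have hg : HasStrictFDerivAt g (fderiv ℝ φ x).ker.subtypeL 0 := hst.to_implicitFunction hr
  have hg0 : g 0 = x := hst.implicitFunction_apply_image hr
  have hl : HasDerivAt (fun t : ℝ => t • v') v' 0 := by
    simpa using (hasDerivAt_id (0 : ℝ)).smul_const v'
  have hc : HasDerivAt (fun t : ℝ => g (t • v')) v 0 := by
    have h1 : HasFDerivAt g (fderiv ℝ φ x).ker.subtypeL ((0 : ℝ) • v') := by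
      rw [zero_smul]; exact hg.hasFDerivAt
    exact h1.comp_hasDerivAt (0 : ℝ) hl
  have hc0 : g ((0 : ℝ) • v') = x := by rw [zero_smul, hg0]
  have hlev : ∀ᶠ t : ℝ in nhds 0, φ (g (t • v')) = 0 := by
    have h1 := hst.map_implicitFunction_eq hr
    have h2 : Tendsto (fun t : ℝ => (φ x, t • v')) (nhds 0) (nhds (φ x, 0)) := by
      have := (continuousAt_const (y := φ x)).prodMk hl.continuousAt
      have := this.tendsto
      simpa using this
    filter_upwards [h2.eventually h1] with t ht
    exact ht.trans hx
  have hct : Tendsto (fun t : ℝ => g (t • v')) (nhds 0) (nhds x) := by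
    have := hc.continuousAt.tendsto
    rwa [hc0] at this
  have hev : ∀ᶠ t : ℝ in nhds 0, g (t • v') ∈ S ∧ f (g (t • v')) = 0 := by
    filter_upwards [hlev, hct.eventually hS] with t ht1 ht2 using ht2 ht1
  have hfx : HasFDerivWithinAt f A S (g ((0 : ℝ) • v')) := by rw [hc0]; exact hf
  have hmem : {t : ℝ | g (t • v') ∈ S} ∈ nhds (0 : ℝ) := hev.mono fun t ht => ht.1
  have h1 : HasDerivAt (f ∘ fun t : ℝ => g (t • v')) (A v) 0 :=
    (hfx.comp_hasDerivWithinAt (0 : ℝ) (hc.hasDerivWithinAt (s := {t : ℝ | g (t • v') ∈ S}))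
      fun t ht => ht).hasDerivAt hmem
  have h2 : HasDerivAt (f ∘ fun t : ℝ => g (t • v')) 0 0 :=
    (hasDerivAt_const (0 : ℝ) (0 : F)).congr_of_eventuallyEq (hev.mono fun t ht => ht.2)
  exact h1.unique h2

open Classical in
/-- Glue two functions along the zero level of `φ`. -/
noncomputable def glue {F : Type*} (φ : Eucl n → ℝ) (f g : Eucl n → F) (x : Eucl n) : F :=
  if φ x ≤ 0 then f x else g x

lemma glue_of_nonpos {F : Type*} {φ : Eucl n → ℝ} {f g : Eucl n → F} {x : Eucl n} (h : φ x ≤ 0) :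
    glue φ f g x = f x := if_pos h

lemma glue_of_pos {F : Type*} {φ : Eucl n → ℝ} {f g : Eucl n → F} {x : Eucl n} (h : 0 < φ x) :
    glue φ f g x = g x := if_neg (not_le.2 h)

lemma glue_of_nonneg {F : Type*} {φ : Eucl n → ℝ} {f g : Eucl n → F} {x : Eucl n} (h : 0 ≤ φ x)
    (hfg : φ x = 0 → f x = g x) : glue φ f g x = g x := by
  rcases h.lt_or_eq with h | h
  · exact glue_of_pos h
  · rw [glue_of_nonpos h.ge, hfg h.symm]

lemma hasFDerivAt_glue {F : Type*} [NormedAddCommGroup F] [NormedSpace ℝ F] {φ : Eucl n → ℝ}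
    (hφ : Continuous φ) {B : Set (Eucl n)} (hB : IsOpen B) {f g : Eucl n → F}
    {f' g' : Eucl n → Eucl n →L[ℝ] F}
    (hf : ∀ x ∈ B, φ x ≤ 0 → HasFDerivWithinAt f (f' x) ({y | φ y ≤ 0} ∩ B) x)
    (hg : ∀ x ∈ B, 0 ≤ φ x → HasFDerivWithinAt g (g' x) ({y | 0 ≤ φ y} ∩ B) x)
    (hfg : ∀ x ∈ B, φ x = 0 → f x = g x) (hfg' : ∀ x ∈ B, φ x = 0 → f' x = g' x)
    {x : Eucl n} (hx : x ∈ B) : HasFDerivAt (glue φ f g) (glue φ f' g' x) x := by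
  have hP : φ x ≤ 0 → HasFDerivWithinAt (glue φ f g) (f' x) ({y | φ y ≤ 0} ∩ B) x := fun h =>
    (hf x hx h).congr (fun y hy => glue_of_nonpos hy.1) (glue_of_nonpos h)
  have hQ : 0 ≤ φ x → HasFDerivWithinAt (glue φ f g) (g' x) ({y | 0 ≤ φ y} ∩ B) x := fun h =>
    (hg x hx h).congr (fun y hy => glue_of_nonneg hy.1 (hfg y hy.2))
      (glue_of_nonneg h (hfg x hx))
  rcases lt_trichotomy (φ x) 0 with h | h | h
  · rw [glue_of_nonpos h.le]
    refine (hP h.le).hasFDerivAt (inter_mem ?_ (hB.mem_nhds hx))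
    exact mem_of_superset (hφ.continuousAt.preimage_mem_nhds (Iio_mem_nhds h))
      fun y (hy : φ y < 0) => hy.le
  · rw [glue_of_nonpos h.le]
    have h2 := hQ h.ge
    rw [← hfg' x hx h] at h2
    refine ((hP h.le).union h2).hasFDerivAt (mem_of_superset (hB.mem_nhds hx) fun y hy => ?_)
    rcases le_total (φ y) 0 with hy' | hy'
    · exact Or.inl ⟨hy', hy⟩
    · exact Or.inr ⟨hy', hy⟩
  · rw [glue_of_pos h]
    refine (hQ h.le).hasFDerivAt (inter_mem ?_ (hB.mem_nhds hx))
    exact mem_of_superset (hφ.continuousAt.preimage_mem_nhds (Ioi_mem_nhds h))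
      fun y (hy : 0 < φ y) => hy.le

lemma continuousOn_glue {F : Type*} [TopologicalSpace F] {φ : Eucl n → ℝ} (hφ : Continuous φ)
    {B : Set (Eucl n)} {f g : Eucl n → F}
    (hf : ContinuousOn f ({y | φ y ≤ 0} ∩ B)) (hg : ContinuousOn g ({y | 0 ≤ φ y} ∩ B))
    (hfg : ∀ x ∈ B, φ x = 0 → f x = g x) : ContinuousOn (glue φ f g) B := by
  have h1 : ContinuousOn (glue φ f g) ({y | φ y ≤ 0} ∩ B) :=
    hf.congr fun y hy => glue_of_nonpos hy.1
  have h2 : ContinuousOn (glue φ f g) ({y | 0 ≤ φ y} ∩ B) :=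
    hg.congr fun y hy => glue_of_nonneg hy.1 (hfg y hy.2)
  have hcov : B = ({y | φ y ≤ 0} ∩ B) ∪ ({y | 0 ≤ φ y} ∩ B) := by
    ext y
    constructor
    · intro hy
      rcases le_total (φ y) 0 with h | h
      · exact Or.inl ⟨h, hy⟩
      · exact Or.inr ⟨h, hy⟩
    · rintro (h | h) <;> exact h.2
  intro x hx
  rw [hcov]
  refine ContinuousWithinAt.union ?_ ?_
  · by_cases h : φ x ≤ 0
    · exact h1 x ⟨h, hx⟩
    · refine continuousWithinAt_of_notMem_closure fun hcl => h ?_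
      exact (isClosed_le hφ continuous_const).closure_subset (closure_mono inter_subset_left hcl)
  · by_cases h : 0 ≤ φ x
    · exact h2 x ⟨h, hx⟩
    · refine continuousWithinAt_of_notMem_closure fun hcl => h ?_
      exact (isClosed_le continuous_const hφ).closure_subset (closure_mono inter_subset_left hcl)

lemma SmoothDomain.uniqueDiffOn {Ω : Set (Eucl n)} (hΩ : SmoothDomain Ω) (h0 : (0 : Eucl n) ∈ Ω) :
    UniqueDiffOn ℝ (closure Ω \ {0}) := by
  intro x hx
  by_cases hxΩ : x ∈ Ω
  · have : closure Ω \ {0} ∈ nhds x := by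
      refine mem_of_superset ((hΩ.1.sdiff isClosed_singleton).mem_nhds ⟨hxΩ, hx.2⟩) ?_
      exact diff_subset_diff_left subset_closure
    exact uniqueDiffWithinAt_of_mem_nhds this
  have hxf : x ∈ frontier Ω := ⟨hx.1, fun h => hxΩ (interior_subset h)⟩
  obtain ⟨φ, R, ρ₁, ρ₂, K, hch⟩ := exists_bdryChart hΩ h0 hxf
  have hxb : x ∈ Metric.ball x ρ₁ := Metric.mem_ball_self (hch.pos.trans_le hch.le)
  have hφ : DifferentiableAt ℝ φ x := hch.smooth.differentiable (by simp) x
  have hcone : ∀ v, fderiv ℝ φ x v < 0 → v ∈ tangentConeAt ℝ (closure Ω \ {0}) x := fun v hv => by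
    refine mem_tangentConeAt_of_add_smul_mem (l := nhdsWithin (0 : ℝ) (Ioi 0)) (c := id)
      (tendsto_id.mono_left (nhdsWithin_mono _ fun t ht => (ne_of_gt ht : t ≠ 0))) ?_
    filter_upwards [eventually_neg_of_fderiv_neg hφ hch.base hv,
      (tendsto_add_smul_nhdsGT x v).eventually
        (Metric.isOpen_ball.mem_nhds hxb)] with t ht htb
    refine ⟨subset_closure ((hch.mem_iff _ htb).2 ht), fun h => hch.zero_notMem ?_⟩
    rw [mem_singleton_iff] at h
    exact h ▸ htb
  refine ⟨?_, subset_closure hx⟩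
  have htop : Submodule.span ℝ (tangentConeAt ℝ (closure Ω \ {0}) x) = ⊤ := by
    rw [eq_top_iff]
    intro v _
    set N := grd φ x
    have hN : 0 < fderiv ℝ φ x N := hch.grd_pos x hxb
    obtain ⟨t, ht⟩ : ∃ t : ℝ, fderiv ℝ φ x v / fderiv ℝ φ x N < t := exists_gt _
    rw [div_lt_iff₀ hN] at ht
    have h1 : v - t • N ∈ tangentConeAt ℝ (closure Ω \ {0}) x := by
      apply hcone
      rw [map_sub, map_smul, smul_eq_mul]
      linarith
    have h2 : -N ∈ tangentConeAt ℝ (closure Ω \ {0}) x := by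
      apply hcone
      rw [map_neg]; linarith
    have : v = (v - t • N) + (-t) • (-N) := by module
    rw [this]
    exact Submodule.add_mem _ (Submodule.subset_span h1)
      (Submodule.smul_mem _ _ (Submodule.subset_span h2))
  rw [htop]
  simp

end Glue

section Reflect

variable {n : ℕ}

/-- First derivative of the odd reflection. -/
noncomputable def refl1 (R : Eucl n → Eucl n) (w' : Eucl n → Eucl n →L[ℝ] ℝ) (x : Eucl n) :
    Eucl n →L[ℝ] ℝ := -(w' (R x)).comp (fderiv ℝ R x)

/-- Second derivative of the odd reflection. -/
noncomputable def refl2 (R : Eucl n → Eucl n) (w' : Eucl n → Eucl n →L[ℝ] ℝ)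
    (w'' : Eucl n → Eucl n →L[ℝ] Eucl n →L[ℝ] ℝ) (x : Eucl n) : Eucl n →L[ℝ] Eucl n →L[ℝ] ℝ :=
  -((ContinuousLinearMap.compL ℝ (Eucl n) (Eucl n) ℝ (w' (R x))).comp (fderiv ℝ (fderiv ℝ R) x)
    + ((ContinuousLinearMap.compL ℝ (Eucl n) (Eucl n) ℝ).flip (fderiv ℝ R x)).comp
      ((w'' (R x)).comp (fderiv ℝ R x)))

lemma refl2_apply (R : Eucl n → Eucl n) (w' : Eucl n → Eucl n →L[ℝ] ℝ)
    (w'' : Eucl n → Eucl n →L[ℝ] Eucl n →L[ℝ] ℝ) (x u v : Eucl n) :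
    refl2 R w' w'' x u v = -(w' (R x) (fderiv ℝ (fderiv ℝ R) x u v)
      + w'' (R x) (fderiv ℝ R x u) (fderiv ℝ R x v)) := rfl

/-- A `C²` function on the chart side of a domain, with its two derivatives, vanishing together
with its Laplacian on the boundary. -/
structure DirichletJet (D : Set (Eucl n)) (φ w : Eucl n → ℝ) (w' : Eucl n → Eucl n →L[ℝ] ℝ)
    (w'' : Eucl n → Eucl n →L[ℝ] Eucl n →L[ℝ] ℝ) : Prop where
  deriv : ∀ x ∈ D, HasFDerivWithinAt w (w' x) D x
  deriv2 : ∀ x ∈ D, HasFDerivWithinAt w' (w'' x) D x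
  cont : ContinuousOn w'' D
  symm : ∀ x ∈ D, ∀ u v, w'' x u v = w'' x v u
  zero : ∀ x ∈ D, φ x = 0 → w x = 0
  trace : ∀ x ∈ D, φ x = 0 → ∑ i, w'' x (bvec i) (bvec i) = 0

variable {Ω : Set (Eucl n)} {x₀ : Eucl n} {φ : Eucl n → ℝ} {R : Eucl n → Eucl n} {ρ₁ ρ₂ K : ℝ}
  {w : Eucl n → ℝ} {w' : Eucl n → Eucl n →L[ℝ] ℝ} {w'' : Eucl n → Eucl n →L[ℝ] Eucl n →L[ℝ] ℝ}

namespace BdryChart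

/-- The part of the chart lying in the closed domain. -/
def side (_ : BdryChart Ω x₀ φ R ρ₁ ρ₂ K) : Set (Eucl n) := {y | φ y ≤ 0} ∩ Metric.ball x₀ ρ₁

variable (hch : BdryChart Ω x₀ φ R ρ₁ ρ₂ K)
include hch

lemma ball_subset : Metric.ball x₀ ρ₂ ⊆ Metric.ball x₀ ρ₁ := Metric.ball_subset_ball hch.le

lemma mapsTo_side : MapsTo R ({y | 0 ≤ φ y} ∩ Metric.ball x₀ ρ₂) hch.side := fun x hx => by
  refine ⟨?_, hch.mapsTo hx.2⟩
  rcases (show 0 ≤ φ x from hx.1).lt_or_eq with h | h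
  · exact (hch.refl_neg x hx.2 h).le
  · rw [hch.refl_eq x hx.2 h.symm]; exact h.ge

lemma fderiv_ne {x : Eucl n} (hx : x ∈ Metric.ball x₀ ρ₁) : fderiv ℝ φ x ≠ 0 := fun h => by
  have := hch.grd_pos x hx
  rw [h] at this
  simp at this

lemma hasFDerivAt_refl {x : Eucl n} (hx : x ∈ Metric.ball x₀ ρ₂) :
    HasFDerivAt R (fderiv ℝ R x) x :=
  ((hch.smooth_refl.contDiffAt (Metric.isOpen_ball.mem_nhds hx)).differentiableAt
    (by simp)).hasFDerivAt

lemma contDiffOn_fderiv_refl : ContDiffOn ℝ (⊤ : ℕ∞) (fderiv ℝ R) (Metric.ball x₀ ρ₂) :=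
  hch.smooth_refl.fderiv_of_isOpen Metric.isOpen_ball (m := (⊤ : ℕ∞)) (by simp)

lemma hasFDerivAt_fderiv_refl {x : Eucl n} (hx : x ∈ Metric.ball x₀ ρ₂) :
    HasFDerivAt (fderiv ℝ R) (fderiv ℝ (fderiv ℝ R) x) x :=
  ((hch.contDiffOn_fderiv_refl.contDiffAt (Metric.isOpen_ball.mem_nhds hx)).differentiableAt
    (by simp)).hasFDerivAt

lemma continuousOn_fderiv2_refl :
    ContinuousOn (fderiv ℝ (fderiv ℝ R)) (Metric.ball x₀ ρ₂) :=
  (hch.contDiffOn_fderiv_refl.fderiv_of_isOpen Metric.isOpen_ball (m := (⊤ : ℕ∞))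
    (by simp)).continuousOn

lemma apply_of_tangent {F : Type*} [NormedAddCommGroup F] [NormedSpace ℝ F] {x : Eucl n}
    (hx : x ∈ Metric.ball x₀ ρ₁) {A : Eucl n →L[ℝ] F}
    (hA : ∀ v, fderiv ℝ φ x v = 0 → A v = 0) (v : Eucl n) :
    A v = (fderiv ℝ φ x v / fderiv ℝ φ x (grd φ x)) • A (grd φ x) := by
  have hN := hch.grd_pos x hx
  have h := hA (v - (fderiv ℝ φ x v / fderiv ℝ φ x (grd φ x)) • grd φ x) (by
    rw [map_sub, map_smul, smul_eq_mul, div_mul_cancel₀ _ hN.ne', sub_self])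
  rw [map_sub, map_smul, sub_eq_zero] at h
  exact h

lemma deriv_tangent (hw : DirichletJet hch.side φ w w' w'') {x : Eucl n}
    (hx : x ∈ Metric.ball x₀ ρ₁) (h0 : φ x = 0) (v : Eucl n) (hv : fderiv ℝ φ x v = 0) :
    w' x v = 0 := by
  refine apply_eq_zero_of_tangent hch.smooth (hch.fderiv_ne hx) h0 (hw.deriv x ⟨h0.le, hx⟩) ?_ hv
  filter_upwards [Metric.isOpen_ball.mem_nhds hx] with y hy hy0
  exact ⟨⟨hy0.le, hy⟩, hw.zero y ⟨hy0.le, hy⟩ hy0⟩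

lemma refl1_eq (hw : DirichletJet hch.side φ w w' w'') {x : Eucl n}
    (hx : x ∈ Metric.ball x₀ ρ₂) (h0 : φ x = 0) : w' x = refl1 R w' x := by
  have hx1 := hch.ball_subset hx
  have hN := hch.grd_pos x hx1
  ext v
  have h1 := hch.apply_of_tangent hx1 (hch.deriv_tangent hw hx1 h0) v
  have h2 : refl1 R w' x v = -(w' x v - fderiv ℝ φ x v * ((2 / fderiv ℝ φ x (grd φ x)) *
      w' x (grd φ x))) := by
    simp only [refl1, neg_apply, ContinuousLinearMap.comp_apply, hch.refl_eq x hx h0,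
      hch.fderiv_refl x hx h0, map_sub, map_smul, smul_eq_mul]
  rw [h2, h1, smul_eq_mul]
  field_simp
  ring

lemma deriv_lapl_refl (hw : DirichletJet hch.side φ w w' w'') {x : Eucl n}
    (hx : x ∈ Metric.ball x₀ ρ₂) (h0 : φ x = 0) :
    w' x (∑ i, fderiv ℝ (fderiv ℝ R) x (bvec i) (bvec i)) = 0 :=
  hch.deriv_tangent hw (hch.ball_subset hx) h0 _ (hch.lapl_refl x hx h0)

omit hch in
lemma sum_bvec_bilin (A : Eucl n →L[ℝ] Eucl n →L[ℝ] ℝ) (φ : Eucl n → ℝ) (x : Eucl n) :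
    ∑ i, fderiv ℝ φ x (bvec i) * A (bvec i) (grd φ x) = A (grd φ x) (grd φ x) := by
  have h := map_grd A φ x
  have h2 := congrArg (fun L : Eucl n →L[ℝ] ℝ => L (grd φ x)) h
  simp only [sum_apply, smul_apply, smul_eq_mul] at h2
  exact h2.symm

omit hch in
lemma sum_bvec_bilin' (A : Eucl n →L[ℝ] Eucl n →L[ℝ] ℝ) (φ : Eucl n → ℝ) (x : Eucl n) :
    ∑ i, fderiv ℝ φ x (bvec i) * A (grd φ x) (bvec i) = A (grd φ x) (grd φ x) := by
  have h := map_grd (A (grd φ x)) φ x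
  simp only [smul_eq_mul] at h
  exact h.symm

lemma trace_reflect {x : Eucl n} (hx : x ∈ Metric.ball x₀ ρ₂) (h0 : φ x = 0)
    (A : Eucl n →L[ℝ] Eucl n →L[ℝ] ℝ) :
    ∑ i, A (fderiv ℝ R x (bvec i)) (fderiv ℝ R x (bvec i)) = ∑ i, A (bvec i) (bvec i) := by
  have hN := hch.grd_pos x (hch.ball_subset hx)
  set ν := fderiv ℝ φ x (grd φ x) with hν
  have h1 : ∀ i : Fin n, A (fderiv ℝ R x (bvec i)) (fderiv ℝ R x (bvec i))
      = A (bvec i) (bvec i)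
        - (2 / ν) * (fderiv ℝ φ x (bvec i) * A (bvec i) (grd φ x))
        - (2 / ν) * (fderiv ℝ φ x (bvec i) * A (grd φ x) (bvec i))
        + (2 / ν) ^ 2 * A (grd φ x) (grd φ x) * fderiv ℝ φ x (bvec i) ^ 2 := fun i => by
    simp only [hch.fderiv_refl x hx h0, map_sub, map_smul, smul_eq_mul, sub_apply, smul_apply]
    ring
  simp only [h1, Finset.sum_add_distrib, Finset.sum_sub_distrib, ← Finset.mul_sum]
  rw [sum_bvec_bilin, sum_bvec_bilin', ← fderiv_grd, ← hν]
  field_simp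
  ring

lemma hasFDerivWithinAt_refl1 (hw : DirichletJet hch.side φ w w' w'') {x : Eucl n}
    (hx : x ∈ Metric.ball x₀ ρ₂) (h0 : 0 ≤ φ x) :
    HasFDerivWithinAt (refl1 R w') (refl2 R w' w'' x) ({y | 0 ≤ φ y} ∩ Metric.ball x₀ ρ₂) x := by
  have h1 : HasFDerivWithinAt (fun y => w' (R y)) ((w'' (R x)).comp (fderiv ℝ R x))
      ({y | 0 ≤ φ y} ∩ Metric.ball x₀ ρ₂) x :=
    (hw.deriv2 (R x) (hch.mapsTo_side ⟨h0, hx⟩)).comp x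
      (hch.hasFDerivAt_refl hx).hasFDerivWithinAt hch.mapsTo_side
  exact (h1.clm_comp (hch.hasFDerivAt_fderiv_refl hx).hasFDerivWithinAt).fun_neg

lemma refl2_symm (hw : DirichletJet hch.side φ w w' w'') {x : Eucl n}
    (hx : x ∈ Metric.ball x₀ ρ₂) (h0 : 0 ≤ φ x) (u v : Eucl n) :
    refl2 R w' w'' x u v = refl2 R w' w'' x v u := by
  have hR : ContDiffAt ℝ 2 R x :=
    (hch.smooth_refl.contDiffAt (Metric.isOpen_ball.mem_nhds hx)).of_le two_le_infty
  have hs : fderiv ℝ (fderiv ℝ R) x u v = fderiv ℝ (fderiv ℝ R) x v u :=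
    (hR.isSymmSndFDerivAt (by simp)).eq u v
  rw [refl2_apply, refl2_apply, hs, hw.symm (R x) (hch.mapsTo_side ⟨h0, hx⟩)]

lemma refl2_eq (hw : DirichletJet hch.side φ w w' w'') {x : Eucl n}
    (hx : x ∈ Metric.ball x₀ ρ₂) (h0 : φ x = 0) : w'' x = refl2 R w' w'' x := by
  have hx1 := hch.ball_subset hx
  have hN := hch.grd_pos x hx1
  set J := w'' x - refl2 R w' w'' x with hJ
  have hJt : ∀ v, fderiv ℝ φ x v = 0 → J v = 0 := fun v hv => by
    have h1 : HasFDerivWithinAt (fun y => w' y - refl1 R w' y) J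
        ({y | φ y = 0} ∩ Metric.ball x₀ ρ₂) x :=
      ((hw.deriv2 x ⟨h0.le, hx1⟩).mono fun y hy =>
        ⟨le_of_eq (show φ y = 0 from hy.1), hch.ball_subset hy.2⟩).fun_sub
      ((hch.hasFDerivWithinAt_refl1 hw hx h0.ge).mono fun y hy =>
        ⟨ge_of_eq (show φ y = 0 from hy.1), hy.2⟩)
    refine apply_eq_zero_of_tangent hch.smooth (hch.fderiv_ne hx1) h0 h1 ?_ hv
    filter_upwards [Metric.isOpen_ball.mem_nhds hx] with y hy hy0
    exact ⟨⟨hy0, hy⟩, sub_eq_zero.2 (hch.refl1_eq hw hy hy0)⟩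
  have hJs : ∀ u v, J u v = J v u := fun u v => by
    simp only [hJ, sub_apply, hw.symm x ⟨h0.le, hx1⟩ u v, hch.refl2_symm hw hx h0.ge u v]
  have h2 : ∀ u v, J u v = fderiv ℝ φ x u * fderiv ℝ φ x v *
      (J (grd φ x) (grd φ x) / fderiv ℝ φ x (grd φ x) ^ 2) := fun u v => by
    have e1 := congrArg (fun L : Eucl n →L[ℝ] ℝ => L v) (hch.apply_of_tangent hx1 hJt u)
    have e2 := congrArg (fun L : Eucl n →L[ℝ] ℝ => L (grd φ x)) (hch.apply_of_tangent hx1 hJt v)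
    simp only [smul_apply, smul_eq_mul] at e1 e2
    rw [e1, hJs (grd φ x) v, e2]
    field_simp
  have htr : ∑ i, J (bvec i) (bvec i) = 0 := by
    have e1 : ∀ i : Fin n, J (bvec i) (bvec i) = w'' x (bvec i) (bvec i)
        + (w' x (fderiv ℝ (fderiv ℝ R) x (bvec i) (bvec i))
          + w'' x (fderiv ℝ R x (bvec i)) (fderiv ℝ R x (bvec i))) := fun i => by
      simp only [hJ, sub_apply, refl2_apply, hch.refl_eq x hx h0, sub_neg_eq_add]
    simp only [e1, Finset.sum_add_distrib]
    rw [hch.trace_reflect hx h0, ← map_sum, hch.deriv_lapl_refl hw hx h0,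
      hw.trace x ⟨h0.le, hx1⟩ h0]
    simp
  have hJN : J (grd φ x) (grd φ x) / fderiv ℝ φ x (grd φ x) ^ 2 = 0 := by
    have e1 : ∀ i : Fin n, J (bvec i) (bvec i) = fderiv ℝ φ x (bvec i) ^ 2 *
      (J (grd φ x) (grd φ x) / fderiv ℝ φ x (grd φ x) ^ 2) := fun i => by
      rw [h2]; ring
    simp only [e1, ← Finset.sum_mul] at htr
    rw [← fderiv_grd] at htr
    exact (mul_eq_zero.1 htr).resolve_left hN.ne'
  refine sub_eq_zero.1 ?_
  ext u v
  show J u v = 0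
  rw [h2, hJN, mul_zero]

/-- The odd reflection of `w` through the boundary. -/
theorem hasFDerivAt_reflect (hw : DirichletJet hch.side φ w w' w'') {x : Eucl n}
    (hx : x ∈ Metric.ball x₀ ρ₂) :
    HasFDerivAt (glue φ w fun y => -w (R y)) (glue φ w' (refl1 R w') x) x := by
  refine hasFDerivAt_glue hch.smooth.continuous Metric.isOpen_ball ?_ ?_ ?_ ?_ hx
  · intro y hy h
    exact (hw.deriv y ⟨h, hch.ball_subset hy⟩).mono fun z hz => ⟨hz.1, hch.ball_subset hz.2⟩
  · intro y hy h
    exact ((hw.deriv (R y) (hch.mapsTo_side ⟨h, hy⟩)).comp y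
      (hch.hasFDerivAt_refl hy).hasFDerivWithinAt hch.mapsTo_side).fun_neg
  · intro y hy h
    rw [hch.refl_eq y hy h, hw.zero y ⟨h.le, hch.ball_subset hy⟩ h, neg_zero]
  · exact fun y hy h => hch.refl1_eq hw hy h

theorem hasFDerivAt_reflect1 (hw : DirichletJet hch.side φ w w' w'') {x : Eucl n}
    (hx : x ∈ Metric.ball x₀ ρ₂) :
    HasFDerivAt (glue φ w' (refl1 R w')) (glue φ w'' (refl2 R w' w'') x) x := by
  refine hasFDerivAt_glue hch.smooth.continuous Metric.isOpen_ball ?_ ?_ ?_ ?_ hx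
  · intro y hy h
    exact (hw.deriv2 y ⟨h, hch.ball_subset hy⟩).mono fun z hz => ⟨hz.1, hch.ball_subset hz.2⟩
  · exact fun y hy h => hch.hasFDerivWithinAt_refl1 hw hy h
  · exact fun y hy h => hch.refl1_eq hw hy h
  · exact fun y hy h => hch.refl2_eq hw hy h

theorem continuousOn_reflect2 (hw : DirichletJet hch.side φ w w' w'') :
    ContinuousOn (glue φ w'' (refl2 R w' w'')) (Metric.ball x₀ ρ₂) := by
  refine continuousOn_glue hch.smooth.continuous
    (hw.cont.mono fun z hz => ⟨hz.1, hch.ball_subset hz.2⟩) ?_ fun y hy h => hch.refl2_eq hw hy h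
  have hsub : ({y | 0 ≤ φ y} ∩ Metric.ball x₀ ρ₂) ⊆ Metric.ball x₀ ρ₂ := inter_subset_right
  have hR0 : ContinuousOn R ({y | 0 ≤ φ y} ∩ Metric.ball x₀ ρ₂) :=
    hch.smooth_refl.continuousOn.mono hsub
  have hR1 : ContinuousOn (fderiv ℝ R) ({y | 0 ≤ φ y} ∩ Metric.ball x₀ ρ₂) :=
    hch.contDiffOn_fderiv_refl.continuousOn.mono hsub
  have hR2 : ContinuousOn (fderiv ℝ (fderiv ℝ R)) ({y | 0 ≤ φ y} ∩ Metric.ball x₀ ρ₂) :=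
    hch.continuousOn_fderiv2_refl.mono hsub
  have hw1' : ContinuousOn w' hch.side := fun y hy => (hw.deriv2 y hy).continuousWithinAt
  have hw1 : ContinuousOn (fun y => w' (R y)) ({y | 0 ≤ φ y} ∩ Metric.ball x₀ ρ₂) :=
    hw1'.comp hR0 hch.mapsTo_side
  have hw2 : ContinuousOn (fun y => w'' (R y)) ({y | 0 ≤ φ y} ∩ Metric.ball x₀ ρ₂) :=
    hw.cont.comp hR0 hch.mapsTo_side
  exact ((((ContinuousLinearMap.continuous _).comp_continuousOn hw1).clm_comp hR2).add
    (((ContinuousLinearMap.continuous _).comp_continuousOn hR1).clm_comp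
      (hw2.clm_comp hR1))).neg

end BdryChart

end Reflect

section ReflectEstimate

variable {n : ℕ}

lemma norm_sum_bvec_le {F : Type*} [NormedAddCommGroup F] [NormedSpace ℝ F]
    (A : Eucl n →L[ℝ] Eucl n →L[ℝ] F) : ‖∑ i, A (bvec i) (bvec i)‖ ≤ n * ‖A‖ := by
  refine (norm_sum_le _ _).trans ?_
  have : ∀ i ∈ (Finset.univ : Finset (Fin n)), ‖A (bvec i) (bvec i)‖ ≤ ‖A‖ := fun i _ => by
    have := A.le_opNorm₂ (bvec i) (bvec i)
    rwa [norm_bvec, mul_one, mul_one] at this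
  refine (Finset.sum_le_sum this).trans ?_
  simp

/-- Bounds for a Dirichlet jet on one side of a chart. -/
structure DirichletJet.Bound (D : Set (Eucl n)) (w : Eucl n → ℝ) (w' : Eucl n → Eucl n →L[ℝ] ℝ)
    (w'' : Eucl n → Eucl n →L[ℝ] Eucl n →L[ℝ] ℝ) (A M : ℝ) : Prop where
  nonneg : 0 ≤ M
  val : ∀ x ∈ D, |w x| ≤ A
  deriv : ∀ x ∈ D, ‖w' x‖ ≤ M
  deriv2 : ∀ x ∈ D, ‖w'' x‖ ≤ M

variable {Ω : Set (Eucl n)} {x₀ : Eucl n} {φ : Eucl n → ℝ} {R : Eucl n → Eucl n} {ρ₁ ρ₂ K : ℝ}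
  {w : Eucl n → ℝ} {w' : Eucl n → Eucl n →L[ℝ] ℝ} {w'' : Eucl n → Eucl n →L[ℝ] Eucl n →L[ℝ] ℝ}
  {A M : ℝ}

namespace BdryChart

variable (hch : BdryChart Ω x₀ φ R ρ₁ ρ₂ K)
include hch

lemma norm_refl_sub_le {x y : Eucl n} (hx : x ∈ Metric.ball x₀ ρ₂) (hy : y ∈ Metric.ball x₀ ρ₂) :
    ‖R x - R y‖ ≤ K * ‖x - y‖ :=
  (convex_ball x₀ ρ₂).norm_image_sub_le_of_norm_hasFDerivWithin_le
    (fun z hz => (hch.hasFDerivAt_refl hz).hasFDerivWithinAt)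
    (fun z hz => hch.norm_fderiv_le z hz) hy hx

lemma norm_fderiv_refl_sub_le {x y : Eucl n} (hx : x ∈ Metric.ball x₀ ρ₂)
    (hy : y ∈ Metric.ball x₀ ρ₂) : ‖fderiv ℝ R x - fderiv ℝ R y‖ ≤ K * ‖x - y‖ :=
  (convex_ball x₀ ρ₂).norm_image_sub_le_of_norm_hasFDerivWithin_le
    (fun z hz => (hch.hasFDerivAt_fderiv_refl hz).hasFDerivWithinAt)
    (fun z hz => hch.norm_fderiv2_le z hz) hy hx

lemma refl_mem_side {x : Eucl n} (hx : x ∈ Metric.ball x₀ ρ₂) (h : 0 < φ x) : R x ∈ hch.side :=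
  hch.mapsTo_side ⟨h.le, hx⟩

lemma norm_reflect_le (hb : DirichletJet.Bound hch.side w w' w'' A M) {x : Eucl n}
    (hx : x ∈ Metric.ball x₀ ρ₂) : |glue φ w (fun y => -w (R y)) x| ≤ A := by
  rcases le_or_gt (φ x) 0 with h | h
  · rw [glue_of_nonpos h]; exact hb.val x ⟨h, hch.ball_subset hx⟩
  · rw [glue_of_pos h, abs_neg]; exact hb.val _ (hch.refl_mem_side hx h)

lemma norm_reflect1_le (hb : DirichletJet.Bound hch.side w w' w'' A M) {x : Eucl n}
    (hx : x ∈ Metric.ball x₀ ρ₂) : ‖glue φ w' (refl1 R w') x‖ ≤ M * K := by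
  rcases le_or_gt (φ x) 0 with h | h
  · rw [glue_of_nonpos h]
    exact (hb.deriv x ⟨h, hch.ball_subset hx⟩).trans (le_mul_of_one_le_right hb.nonneg hch.one_le)
  · rw [glue_of_pos h, refl1, norm_neg]
    refine (ContinuousLinearMap.opNorm_comp_le _ _).trans ?_
    exact mul_le_mul (hb.deriv _ (hch.refl_mem_side hx h)) (hch.norm_fderiv_le x hx)
      (norm_nonneg _) hb.nonneg

lemma norm_reflect2_le (hb : DirichletJet.Bound hch.side w w' w'' A M) {x : Eucl n}
    (hx : x ∈ Metric.ball x₀ ρ₂) : ‖glue φ w'' (refl2 R w' w'') x‖ ≤ 2 * K ^ 2 * M := by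
  have hK := hch.one_le
  have hM := hb.nonneg
  rcases le_or_gt (φ x) 0 with h | h
  · rw [glue_of_nonpos h]
    refine (hb.deriv2 x ⟨h, hch.ball_subset hx⟩).trans ?_
    nlinarith [mul_nonneg hM (by nlinarith : 0 ≤ K ^ 2 - 1)]
  · rw [glue_of_pos h]
    have hs := hch.refl_mem_side hx h
    have h1 := hb.deriv _ hs
    have h2 := hb.deriv2 _ hs
    have h3 := hch.norm_fderiv_le x hx
    have h4 := hch.norm_fderiv2_le x hx
    refine ContinuousLinearMap.opNorm_le_bound₂ _ (by positivity) fun u v => ?_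
    rw [refl2_apply, norm_neg]
    refine (norm_add_le _ _).trans ?_
    have e1 : ‖w' (R x) (fderiv ℝ (fderiv ℝ R) x u v)‖ ≤ M * (K * ‖u‖ * ‖v‖) := by
      refine (ContinuousLinearMap.le_opNorm _ _).trans ?_
      refine mul_le_mul h1 ((ContinuousLinearMap.le_opNorm₂ _ u v).trans ?_) (norm_nonneg _) hM
      gcongr
    have e2 : ‖w'' (R x) (fderiv ℝ R x u) (fderiv ℝ R x v)‖ ≤ M * (K * ‖u‖) * (K * ‖v‖) := by
      refine (ContinuousLinearMap.le_opNorm₂ _ _ _).trans ?_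
      have e3 : ‖fderiv ℝ R x u‖ ≤ K * ‖u‖ :=
        (ContinuousLinearMap.le_opNorm _ _).trans (by gcongr)
      have e4 : ‖fderiv ℝ R x v‖ ≤ K * ‖v‖ :=
        (ContinuousLinearMap.le_opNorm _ _).trans (by gcongr)
      gcongr
    have e5 : M * (K * ‖u‖ * ‖v‖) ≤ M * K ^ 2 * ‖u‖ * ‖v‖ := by
      have : K ≤ K ^ 2 := by nlinarith
      have h6 : K * ‖u‖ * ‖v‖ ≤ K ^ 2 * ‖u‖ * ‖v‖ := by gcongr
      calc M * (K * ‖u‖ * ‖v‖) ≤ M * (K ^ 2 * ‖u‖ * ‖v‖) := by gcongr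
        _ = _ := by ring
    linarith

lemma norm_reflect1_sub_le (hw : DirichletJet hch.side φ w w' w'')
    (hb : DirichletJet.Bound hch.side w w' w'' A M) {x y : Eucl n}
    (hx : x ∈ Metric.ball x₀ ρ₂) (hy : y ∈ Metric.ball x₀ ρ₂) :
    ‖glue φ w' (refl1 R w') x - glue φ w' (refl1 R w') y‖ ≤ 2 * K ^ 2 * M * ‖x - y‖ :=
  (convex_ball x₀ ρ₂).norm_image_sub_le_of_norm_hasFDerivWithin_le
    (fun z hz => (hch.hasFDerivAt_reflect1 hw hz).hasFDerivWithinAt)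
    (fun z hz => hch.norm_reflect2_le hb hz) hy hx

lemma fderiv_reflect (hw : DirichletJet hch.side φ w w' w'') {x : Eucl n}
    (hx : x ∈ Metric.ball x₀ ρ₂) :
    fderiv ℝ (glue φ w fun y => -w (R y)) x = glue φ w' (refl1 R w') x :=
  (hch.hasFDerivAt_reflect hw hx).fderiv

lemma fderiv2_reflect (hw : DirichletJet hch.side φ w w' w'') {x : Eucl n}
    (hx : x ∈ Metric.ball x₀ ρ₂) :
    fderiv ℝ (fderiv ℝ (glue φ w fun y => -w (R y))) x = glue φ w'' (refl2 R w' w'') x := by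
  have : fderiv ℝ (glue φ w fun y => -w (R y)) =ᶠ[nhds x] glue φ w' (refl1 R w') := by
    filter_upwards [Metric.isOpen_ball.mem_nhds hx] with y hy using hch.fderiv_reflect hw hy
  rw [this.fderiv_eq]
  exact (hch.hasFDerivAt_reflect1 hw hx).fderiv

lemma contDiffOn_reflect (hw : DirichletJet hch.side φ w w' w'') :
    ContDiffOn ℝ 2 (glue φ w fun y => -w (R y)) (Metric.ball x₀ ρ₂) := by
  have h2 : ContDiffOn ℝ 1 (glue φ w' (refl1 R w')) (Metric.ball x₀ ρ₂) := by
    rw [show (1 : WithTop ℕ∞) = 0 + 1 from (zero_add 1).symm,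
      contDiffOn_succ_iff_hasFDerivWithinAt_of_uniqueDiffOn Metric.isOpen_ball.uniqueDiffOn]
    exact ⟨by simp, _, contDiffOn_zero.2 (hch.continuousOn_reflect2 hw),
      fun x hx => (hch.hasFDerivAt_reflect1 hw hx).hasFDerivWithinAt⟩
  rw [show (2 : WithTop ℕ∞) = 1 + 1 from one_add_one_eq_two.symm,
    contDiffOn_succ_iff_hasFDerivWithinAt_of_uniqueDiffOn Metric.isOpen_ball.uniqueDiffOn]
  exact ⟨by simp, _, h2, fun x hx => (hch.hasFDerivAt_reflect hw hx).hasFDerivWithinAt⟩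

lemma mem_ball_of_div {x : Eucl n} (hx : x ∈ Metric.ball x₀ (ρ₂ / K)) : x ∈ Metric.ball x₀ ρ₂ :=
  Metric.ball_subset_ball (div_le_self hch.pos.le hch.one_le) hx

lemma refl_mem_ball {x : Eucl n} (hx : x ∈ Metric.ball x₀ (ρ₂ / K)) :
    R x ∈ Metric.ball x₀ ρ₂ := by
  have h0 := Metric.mem_ball_self (x := x₀) hch.pos
  have h1 := hch.norm_refl_sub_le (hch.mem_ball_of_div hx) h0
  rw [hch.refl_eq x₀ h0 hch.base] at h1
  rw [mem_ball_iff_norm] at hx ⊢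
  have hK : 0 < K := zero_lt_one.trans_le hch.one_le
  rw [lt_div_iff₀ hK] at hx
  linarith

lemma exists_zero_segment {x y : Eucl n} {ρ : ℝ} (hx : x ∈ Metric.ball x₀ ρ)
    (hy : y ∈ Metric.ball x₀ ρ) (hx0 : φ x ≤ 0) (hy0 : 0 < φ y) :
    ∃ z ∈ Metric.ball x₀ ρ, φ z = 0 ∧ ‖y - z‖ ≤ ‖y - x‖ ∧ ‖x - z‖ ≤ ‖y - x‖ := by
  have hpre : IsPreconnected (segment ℝ x y) := (convex_segment x y).isPreconnected
  obtain ⟨z, hz, hz0⟩ := hpre.intermediate_value (left_mem_segment ℝ x y)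
    (right_mem_segment ℝ x y) hch.smooth.continuous.continuousOn ⟨hx0, hy0.le⟩
  refine ⟨z, (convex_ball x₀ ρ).segment_subset hx hy hz, hz0, ?_, ?_⟩
  · have h1 : z ∈ segment ℝ y x := by rwa [segment_symm]
    have := norm_sub_le_of_mem_segment h1
    rwa [norm_sub_rev z y, norm_sub_rev x y] at this
  · have := norm_sub_le_of_mem_segment hz
    rwa [norm_sub_rev z x] at this

lemma trace_reflect2_sub_le (hw : DirichletJet hch.side φ w w' w'')
    (hb : DirichletJet.Bound hch.side w w' w'' A M)
    (hL : ∀ x ∈ hch.side, ∀ y ∈ hch.side,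
      |∑ i, w'' x (bvec i) (bvec i) - ∑ i, w'' y (bvec i) (bvec i)| ≤ M * ‖x - y‖)
    {x y : Eucl n} (hx : x ∈ Metric.ball x₀ (ρ₂ / K)) (hx0 : φ x ≤ 0)
    (hy : y ∈ Metric.ball x₀ (ρ₂ / K)) :
    |∑ i, glue φ w'' (refl2 R w' w'') y (bvec i) (bvec i)
      - ∑ i, glue φ w'' (refl2 R w' w'') x (bvec i) (bvec i)|
      ≤ (5 * n + 2) * K ^ 4 * M * ‖y - x‖ := by
  have hK := hch.one_le
  have hM := hb.nonneg
  have hK4 : K ≤ K ^ 4 := le_self_pow₀ hK (by norm_num)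
  have hK2 : K ^ 2 ≤ K ^ 4 := pow_le_pow_right₀ hK (by norm_num)
  have hn : (0 : ℝ) ≤ n := Nat.cast_nonneg n
  have hx2 := hch.mem_ball_of_div hx
  have hy2 := hch.mem_ball_of_div hy
  have hxs : x ∈ hch.side := ⟨hx0, hch.ball_subset hx2⟩
  simp only [glue_of_nonpos hx0]
  rcases le_or_gt (φ y) 0 with h | h
  · simp only [glue_of_nonpos h]
    refine (hL y ⟨h, hch.ball_subset hy2⟩ x hxs).trans ?_
    have : 1 ≤ (5 * n + 2) * K ^ 4 := by nlinarith
    have h5 := mul_le_mul_of_nonneg_right this (mul_nonneg hM (norm_nonneg (y - x)))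
    linarith
  simp only [glue_of_pos h]
  obtain ⟨z, hz, hz0, hyz, hxz⟩ := hch.exists_zero_segment hx hy hx0 h
  have hz2 := hch.mem_ball_of_div hz
  have hzs : z ∈ hch.side := ⟨hz0.le, hch.ball_subset hz2⟩
  have hRs := hch.refl_mem_side hy2 h
  have hRz : ‖R y - z‖ ≤ K * ‖y - z‖ := by
    have := hch.norm_refl_sub_le hy2 hz2
    rwa [hch.refl_eq z hz2 hz0] at this
  set LR : Eucl n → Eucl n := fun y => ∑ i, fderiv ℝ (fderiv ℝ R) y (bvec i) (bvec i) with hLR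
  have hLz : ‖LR z‖ ≤ n * K := (norm_sum_bvec_le _).trans (by
    gcongr; exact hch.norm_fderiv2_le z hz2)
  have hLyz : ‖LR y - LR z‖ ≤ n * (K * ‖y - z‖) := by
    have : LR y - LR z = ∑ i, (fderiv ℝ (fderiv ℝ R) y - fderiv ℝ (fderiv ℝ R) z)
        (bvec i) (bvec i) := by
      simp only [hLR, sub_apply, Finset.sum_sub_distrib]
    rw [this]
    refine (norm_sum_bvec_le _).trans ?_
    gcongr
    exact hch.lipschitz y hy2 z hz2
  have hT : ∑ i, refl2 R w' w'' y (bvec i) (bvec i)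
      = -(w' (R y) (LR y) + ∑ i, w'' (R y) (fderiv ℝ R y (bvec i)) (fderiv ℝ R y (bvec i))) := by
    simp only [refl2_apply, hLR, map_sum, Finset.sum_neg_distrib, Finset.sum_add_distrib]
  have t1 : |w' (R y) (LR y)| ≤ 3 * n * K ^ 4 * M * ‖y - z‖ := by
    have e0 : w' (R y) (LR y) = w' (R y) (LR y - LR z) + (w' (R y) - w' z) (LR z) := by
      have := hch.deriv_lapl_refl hw hz2 hz0
      simp only [map_sub, sub_apply]
      rw [show w' z (LR z) = 0 from this]
      ring
    have e1 : |w' (R y) (LR y - LR z)| ≤ M * (n * (K * ‖y - z‖)) :=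
      ((w' (R y)).le_opNorm _).trans
        (mul_le_mul (hb.deriv _ hRs) hLyz (norm_nonneg _) hM)
    have e2 : ‖w' (R y) - w' z‖ ≤ 2 * K ^ 2 * M * (K * ‖y - z‖) := by
      have := hch.norm_reflect1_sub_le hw hb (hch.refl_mem_ball hy) hz2
      rw [glue_of_nonpos hRs.1, glue_of_nonpos hz0.le] at this
      exact this.trans (by gcongr)
    have e3 : |(w' (R y) - w' z) (LR z)| ≤ 2 * K ^ 2 * M * (K * ‖y - z‖) * (n * K) :=
      ((w' (R y) - w' z).le_opNorm _).trans
        (mul_le_mul e2 hLz (norm_nonneg _) (by positivity))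
    rw [e0]
    refine (abs_add_le _ _).trans ((add_le_add e1 e3).trans ?_)
    have e4 : K * (n * M * ‖y - z‖) ≤ K ^ 4 * (n * M * ‖y - z‖) := by gcongr
    linarith
  have t2 : |∑ i, w'' (R y) (fderiv ℝ R y (bvec i)) (fderiv ℝ R y (bvec i))
      - ∑ i, w'' (R y) (fderiv ℝ R z (bvec i)) (fderiv ℝ R z (bvec i))|
      ≤ 2 * n * K ^ 4 * M * ‖y - z‖ := by
    rw [← Finset.sum_sub_distrib]
    refine (Finset.abs_sum_le_sum_abs _ _).trans ?_
    have : ∀ i ∈ (Finset.univ : Finset (Fin n)),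
        |w'' (R y) (fderiv ℝ R y (bvec i)) (fderiv ℝ R y (bvec i))
        - w'' (R y) (fderiv ℝ R z (bvec i)) (fderiv ℝ R z (bvec i))|
        ≤ 2 * K ^ 2 * M * ‖y - z‖ := fun i _ => by
      have f0 : w'' (R y) (fderiv ℝ R y (bvec i)) (fderiv ℝ R y (bvec i))
          - w'' (R y) (fderiv ℝ R z (bvec i)) (fderiv ℝ R z (bvec i))
          = w'' (R y) ((fderiv ℝ R y - fderiv ℝ R z) (bvec i)) (fderiv ℝ R y (bvec i))
          + w'' (R y) (fderiv ℝ R z (bvec i)) ((fderiv ℝ R y - fderiv ℝ R z) (bvec i)) := by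
        simp only [map_sub, sub_apply]; ring
      have f1 : ∀ (L : Eucl n →L[ℝ] Eucl n), ‖L (bvec i)‖ ≤ ‖L‖ := fun L => by
        have := L.le_opNorm (bvec i); rwa [norm_bvec, mul_one] at this
      have f2 := (f1 (fderiv ℝ R y)).trans (hch.norm_fderiv_le y hy2)
      have f3 := (f1 (fderiv ℝ R z)).trans (hch.norm_fderiv_le z hz2)
      have f4 := (f1 (fderiv ℝ R y - fderiv ℝ R z)).trans (hch.norm_fderiv_refl_sub_le hy2 hz2)
      have f5 := hb.deriv2 _ hRs
      rw [f0]
      refine (abs_add_le _ _).trans ?_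
      have g1 : |w'' (R y) ((fderiv ℝ R y - fderiv ℝ R z) (bvec i)) (fderiv ℝ R y (bvec i))|
          ≤ M * (K * ‖y - z‖) * K := ((w'' (R y)).le_opNorm₂ _ _).trans (by gcongr)
      have g2 : |w'' (R y) (fderiv ℝ R z (bvec i)) ((fderiv ℝ R y - fderiv ℝ R z) (bvec i))|
          ≤ M * K * (K * ‖y - z‖) := ((w'' (R y)).le_opNorm₂ _ _).trans (by gcongr)
      linarith
    refine (Finset.sum_le_sum this).trans ?_
    rw [Finset.sum_const, Finset.card_univ, Fintype.card_fin, nsmul_eq_mul]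
    have e4 : K ^ 2 * (n * M * ‖y - z‖) ≤ K ^ 4 * (n * M * ‖y - z‖) := by gcongr
    linarith
  have hz3 := hw.trace z hzs hz0
  have t3 : |∑ i, w'' (R y) (fderiv ℝ R z (bvec i)) (fderiv ℝ R z (bvec i))|
      ≤ K ^ 4 * M * ‖y - z‖ := by
    rw [hch.trace_reflect hz2 hz0]
    have := hL _ hRs z hzs
    rw [hz3, sub_zero] at this
    refine this.trans ?_
    have e4 : K * (M * ‖y - z‖) ≤ K ^ 4 * (M * ‖y - z‖) := by gcongr
    have e5 : M * ‖R y - z‖ ≤ M * (K * ‖y - z‖) := by gcongr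
    linarith
  have t4 : |∑ i, w'' x (bvec i) (bvec i)| ≤ K ^ 4 * M * ‖y - x‖ := by
    have := hL x hxs z hzs
    rw [hz3, sub_zero] at this
    refine this.trans ?_
    have e4 : 1 * (M * ‖y - x‖) ≤ K ^ 4 * (M * ‖y - x‖) := by
      gcongr; linarith
    have e5 : M * ‖x - z‖ ≤ M * ‖y - x‖ := by gcongr
    linarith
  have e6 : (5 * n + 1) * K ^ 4 * M * ‖y - z‖ ≤ (5 * n + 1) * K ^ 4 * M * ‖y - x‖ := by gcongr
  rw [hT]
  rw [abs_le] at *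
  constructor <;> linarith [t1.1, t1.2, t2.1, t2.2, t3.1, t3.2, t4.1, t4.2]

theorem estimate [NeZero n] : ∃ C > 0, ∀ (w : Eucl n → ℝ) (w' : Eucl n → Eucl n →L[ℝ] ℝ)
    (w'' : Eucl n → Eucl n →L[ℝ] Eucl n →L[ℝ] ℝ) (A M : ℝ),
    DirichletJet hch.side φ w w' w'' → DirichletJet.Bound hch.side w w' w'' A M →
    (∀ x ∈ hch.side, ∀ y ∈ hch.side,
      |∑ i, w'' x (bvec i) (bvec i) - ∑ i, w'' y (bvec i) (bvec i)| ≤ M * ‖x - y‖) →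
    ∀ x ∈ Metric.ball x₀ (ρ₂ / K / 2), φ x ≤ 0 → ∀ r, 0 < r → r ≤ 1 → r ≤ ρ₂ / K / 2 →
      ‖w' x‖ + ‖w'' x‖ ≤ C * (A / r ^ 2 + r * M) := by
  obtain ⟨C₁, hC₁, h₁⟩ := gradient_estimate n
  obtain ⟨C₂, hC₂, h₂⟩ := hessian_estimate n
  have hK := hch.one_le
  refine ⟨C₁ * (2 * n * K ^ 2 + 1) + C₂ * ((5 * n + 2) * K ^ 4 + 1), by positivity,
    fun w w' w'' A M hw hb hL x hx hx0 r hr hr1 hr2 => ?_⟩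
  have hM := hb.nonneg
  have hxK : x ∈ Metric.ball x₀ (ρ₂ / K) :=
    Metric.ball_subset_ball (half_le_self (by have := hch.pos; positivity)) hx
  have hx2 := hch.mem_ball_of_div hxK
  have hA : 0 ≤ A := (abs_nonneg _).trans (hb.val x ⟨hx0, hch.ball_subset hx2⟩)
  have hsubK : Metric.ball x r ⊆ Metric.ball x₀ (ρ₂ / K) := by
    refine Metric.ball_subset_ball' ?_
    rw [Metric.mem_ball] at hx
    linarith
  have hsub : Metric.ball x r ⊆ Metric.ball x₀ ρ₂ := fun y hy => hch.mem_ball_of_div (hsubK hy)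
  have hcd := (hch.contDiffOn_reflect hw).mono hsub
  have hl : ∀ y ∈ Metric.ball x₀ ρ₂, lapl (glue φ w fun y => -w (R y)) y
      = ∑ i, glue φ w'' (refl2 R w' w'') y (bvec i) (bvec i) := fun y hy => by
    rw [lapl, hch.fderiv2_reflect hw hy]
  have g1 := h₁ _ x r A (n * (2 * K ^ 2 * M)) hr hcd
    (fun y hy => hch.norm_reflect_le hb (hsub hy)) (fun y hy => by
      rw [hl y (hsub hy), ← Real.norm_eq_abs]
      refine (norm_sum_bvec_le (F := ℝ) (glue φ w'' (refl2 R w' w'') y)).trans ?_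
      gcongr
      exact hch.norm_reflect2_le hb (hsub hy))
  have g2 := h₂ _ x r A ((5 * n + 2) * K ^ 4 * M) hr hcd (by positivity)
    (fun y hy => hch.norm_reflect_le hb (hsub hy)) (fun y hy => by
      rw [hl y (hsub hy), hl x hx2]
      exact hch.trace_reflect2_sub_le hw hb hL hxK hx0 (hsubK hy))
  rw [hch.fderiv_reflect hw hx2, glue_of_nonpos hx0] at g1
  rw [hch.fderiv2_reflect hw hx2, glue_of_nonpos hx0] at g2
  have e1 : A / r ≤ A / r ^ 2 := by
    rw [div_le_div_iff₀ hr (by positivity)]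
    have : r ^ 2 ≤ r := by nlinarith
    gcongr
  have e2 : A / r + r * (n * (2 * K ^ 2 * M)) ≤ (2 * n * K ^ 2 + 1) * (A / r ^ 2 + r * M) := by
    have : 0 ≤ A / r ^ 2 := by positivity
    have h3 : 0 ≤ 2 * n * K ^ 2 * (A / r ^ 2) := by positivity
    have h4 : 0 ≤ r * M := by positivity
    linarith
  have e3 : A / r ^ 2 + r * ((5 * n + 2) * K ^ 4 * M)
      ≤ ((5 * n + 2) * K ^ 4 + 1) * (A / r ^ 2 + r * M) := by
    have h3 : 0 ≤ (5 * n + 2) * K ^ 4 * (A / r ^ 2) := by positivity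
    have h4 : 0 ≤ r * M := by positivity
    linarith
  have e4 := mul_le_mul_of_nonneg_left e2 hC₁.le
  have e5 := mul_le_mul_of_nonneg_left e3 hC₂.le
  linarith

end BdryChart

end ReflectEstimate

set_option maxSynthPendingDepth 3

section DomainJets

variable {n : ℕ}

lemma contDiffOn_two_of_hasFDerivWithinAt {S : Set (Eucl n)} (hS : UniqueDiffOn ℝ S)
    {w : Eucl n → ℝ} {w' : Eucl n → Eucl n →L[ℝ] ℝ} {w'' : Eucl n → Eucl n →L[ℝ] Eucl n →L[ℝ] ℝ}
    (h1 : ∀ x ∈ S, HasFDerivWithinAt w (w' x) S x)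
    (h2 : ∀ x ∈ S, HasFDerivWithinAt w' (w'' x) S x) (h3 : ContinuousOn w'' S) :
    ContDiffOn ℝ 2 w S := by
  have h4 : ContDiffOn ℝ 1 w' S := by
    rw [show (1 : WithTop ℕ∞) = 0 + 1 from (zero_add 1).symm,
      contDiffOn_succ_iff_hasFDerivWithinAt_of_uniqueDiffOn hS]
    exact ⟨by simp, _, contDiffOn_zero.2 h3, h2⟩
  rw [show (2 : WithTop ℕ∞) = 1 + 1 from one_add_one_eq_two.symm,
    contDiffOn_succ_iff_hasFDerivWithinAt_of_uniqueDiffOn hS]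
  exact ⟨by simp, _, h4, h1⟩

/-- A function on the punctured closed domain with its first two derivatives, vanishing on the
boundary together with its Laplacian. -/
structure DomainJet (Ω : Set (Eucl n)) (w : Eucl n → ℝ) (w' : Eucl n → Eucl n →L[ℝ] ℝ)
    (w'' : Eucl n → Eucl n →L[ℝ] Eucl n →L[ℝ] ℝ) : Prop where
  deriv : ∀ x ∈ closure Ω \ {0}, HasFDerivWithinAt w (w' x) (closure Ω \ {0}) x
  deriv2 : ∀ x ∈ closure Ω \ {0}, HasFDerivWithinAt w' (w'' x) (closure Ω \ {0}) x
  cont : ContinuousOn w'' (closure Ω \ {0})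
  symm : ∀ x ∈ closure Ω \ {0}, ∀ u v, w'' x u v = w'' x v u
  zero : ∀ x ∈ frontier Ω, w x = 0
  trace : ∀ x ∈ frontier Ω, ∑ i, w'' x (bvec i) (bvec i) = 0

variable {Ω : Set (Eucl n)} {w v : Eucl n → ℝ} {w' v' : Eucl n → Eucl n →L[ℝ] ℝ}
  {w'' v'' : Eucl n → Eucl n →L[ℝ] Eucl n →L[ℝ] ℝ}

namespace DomainJet

lemma sub (hw : DomainJet Ω w w' w'') (hv : DomainJet Ω v v' v'') :
    DomainJet Ω (fun x => w x - v x) (fun x => w' x - v' x) (fun x => w'' x - v'' x) where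
  deriv x hx := (hw.deriv x hx).fun_sub (hv.deriv x hx)
  deriv2 x hx := (hw.deriv2 x hx).fun_sub (hv.deriv2 x hx)
  cont := hw.cont.sub hv.cont
  symm x hx a b := by simp only [sub_apply]; rw [hw.symm x hx, hv.symm x hx]
  zero x hx := by rw [hw.zero x hx, hv.zero x hx, sub_zero]
  trace x hx := by
    simp only [sub_apply, Finset.sum_sub_distrib]
    rw [hw.trace x hx, hv.trace x hx, sub_zero]

lemma mem_nhds_of_mem (hΩ : IsOpen Ω) {x : Eucl n} (hx : x ∈ Ω \ {0}) :
    closure Ω \ {0} ∈ nhds x :=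
  mem_of_superset ((hΩ.sdiff isClosed_singleton).mem_nhds hx)
    (diff_subset_diff_left subset_closure)

lemma hasFDerivAt (hw : DomainJet Ω w w' w'') (hΩ : IsOpen Ω) {x : Eucl n} (hx : x ∈ Ω \ {0}) :
    HasFDerivAt w (w' x) x :=
  (hw.deriv x ⟨subset_closure hx.1, hx.2⟩).hasFDerivAt (mem_nhds_of_mem hΩ hx)

lemma hasFDerivAt2 (hw : DomainJet Ω w w' w'') (hΩ : IsOpen Ω) {x : Eucl n} (hx : x ∈ Ω \ {0}) :
    HasFDerivAt w' (w'' x) x :=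
  (hw.deriv2 x ⟨subset_closure hx.1, hx.2⟩).hasFDerivAt (mem_nhds_of_mem hΩ hx)

lemma fderiv_eq (hw : DomainJet Ω w w' w'') (hΩ : IsOpen Ω) {x : Eucl n} (hx : x ∈ Ω \ {0}) :
    fderiv ℝ w x = w' x := (hw.hasFDerivAt hΩ hx).fderiv

lemma fderiv2_eq (hw : DomainJet Ω w w' w'') (hΩ : IsOpen Ω) {x : Eucl n} (hx : x ∈ Ω \ {0}) :
    fderiv ℝ (fderiv ℝ w) x = w'' x := by
  have : fderiv ℝ w =ᶠ[nhds x] w' := by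
    filter_upwards [(hΩ.sdiff isClosed_singleton).mem_nhds hx] with y hy using hw.fderiv_eq hΩ hy
  rw [this.fderiv_eq, (hw.hasFDerivAt2 hΩ hx).fderiv]

lemma lapl_eq (hw : DomainJet Ω w w' w'') (hΩ : IsOpen Ω) {x : Eucl n} (hx : x ∈ Ω \ {0}) :
    lapl w x = ∑ i, w'' x (bvec i) (bvec i) := by
  rw [lapl, hw.fderiv2_eq hΩ hx]

lemma contDiffOn (hw : DomainJet Ω w w' w'') (hS : UniqueDiffOn ℝ (closure Ω \ {0})) :
    ContDiffOn ℝ 2 w (closure Ω \ {0}) :=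
  contDiffOn_two_of_hasFDerivWithinAt hS hw.deriv hw.deriv2 hw.cont

end DomainJet

namespace BdryChart

variable {x₀ : Eucl n} {φ : Eucl n → ℝ} {R : Eucl n → Eucl n} {ρ₁ ρ₂ K : ℝ}

lemma side_eq (hch : BdryChart Ω x₀ φ R ρ₁ ρ₂ K) :
    hch.side = closure Ω ∩ Metric.ball x₀ ρ₁ := by
  ext x
  constructor
  · rintro ⟨h1, h2⟩
    exact ⟨(hch.mem_closure_iff x h2).2 h1, h2⟩
  · rintro ⟨h1, h2⟩
    exact ⟨(hch.mem_closure_iff x h2).1 h1, h2⟩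

lemma side_subset (hch : BdryChart Ω x₀ φ R ρ₁ ρ₂ K) : hch.side ⊆ closure Ω \ {0} := by
  rw [hch.side_eq]
  refine fun x hx => ⟨hx.1, fun h => hch.zero_notMem ?_⟩
  rw [mem_singleton_iff] at h
  exact h ▸ hx.2

lemma mem_frontier (hch : BdryChart Ω x₀ φ R ρ₁ ρ₂ K) {x : Eucl n} (hx : x ∈ hch.side)
    (h : φ x = 0) : x ∈ frontier Ω :=
  ⟨(hch.side_subset hx).1, fun h1 => ((hch.mem_iff x hx.2).1 (interior_subset h1)).ne h⟩

lemma dirichletJet (hch : BdryChart Ω x₀ φ R ρ₁ ρ₂ K) (hw : DomainJet Ω w w' w'') :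
    DirichletJet hch.side φ w w' w'' where
  deriv x hx := (hw.deriv x (hch.side_subset hx)).mono hch.side_subset
  deriv2 x hx := (hw.deriv2 x (hch.side_subset hx)).mono hch.side_subset
  cont := hw.cont.mono hch.side_subset
  symm x hx := hw.symm x (hch.side_subset hx)
  zero x hx h := hw.zero x (hch.mem_frontier hx h)
  trace x hx h := hw.trace x (hch.mem_frontier hx h)

end BdryChart

theorem exists_local_estimate [NeZero n] (hΩ : SmoothDomain Ω) (h0 : (0 : Eucl n) ∈ Ω)
    {x₀ : Eucl n} (hx₀ : x₀ ∈ closure Ω \ {0}) :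
    ∃ ρ > 0, ∃ ρ' > 0, ∃ C > 0, (∀ x ∈ Metric.ball x₀ ρ', ‖x₀‖ / 2 < ‖x‖) ∧
      ∀ (w : Eucl n → ℝ) (w' : Eucl n → Eucl n →L[ℝ] ℝ)
        (w'' : Eucl n → Eucl n →L[ℝ] Eucl n →L[ℝ] ℝ) (A M : ℝ), DomainJet Ω w w' w'' →
        DirichletJet.Bound (closure Ω ∩ Metric.ball x₀ ρ') w w' w'' A M →
        (∀ x ∈ closure Ω ∩ Metric.ball x₀ ρ', ∀ y ∈ closure Ω ∩ Metric.ball x₀ ρ',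
          |∑ i, w'' x (bvec i) (bvec i) - ∑ i, w'' y (bvec i) (bvec i)| ≤ M * ‖x - y‖) →
        ∀ x ∈ closure Ω ∩ Metric.ball x₀ ρ, ∀ r, 0 < r → r ≤ ρ →
          ‖w' x‖ + ‖w'' x‖ ≤ C * (A / r ^ 2 + r * M) := by
  by_cases hxΩ : x₀ ∈ Ω
  · obtain ⟨C₁, hC₁, h₁⟩ := gradient_estimate n
    obtain ⟨C₂, hC₂, h₂⟩ := hessian_estimate n
    obtain ⟨ρ', hρ', hb⟩ := Metric.eventually_nhds_iff_ball.1
      ((hΩ.1.eventually_mem hxΩ).and (continuous_norm.continuousAt.eventually_const_lt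
      (half_lt_self (norm_pos_iff.2 hx₀.2))))
    have hsub : Metric.ball x₀ ρ' ⊆ Ω \ {0} := fun x hx => ⟨(hb x hx).1, fun h => by
      have h2 := (hb x hx).2
      rw [mem_singleton_iff] at h
      rw [h, norm_zero] at h2
      linarith [norm_nonneg x₀]⟩
    refine ⟨min (ρ' / 2) 1, by positivity, ρ', hρ', C₁ * (n + 1) + C₂, by positivity,
      fun x hx => (hb x hx).2, fun w w' w'' A M hw hB hL x hx r hr hrρ => ?_⟩
    have hr1 : r ≤ 1 := hrρ.trans (min_le_right _ _)
    have hr2 : r ≤ ρ' / 2 := hrρ.trans (min_le_left _ _)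
    have hball : Metric.ball x r ⊆ Metric.ball x₀ ρ' := by
      refine Metric.ball_subset_ball' ?_
      have := Metric.mem_ball.1 (Metric.ball_subset_ball (min_le_left _ _) hx.2)
      linarith
    have hcl : ∀ y ∈ Metric.ball x r, y ∈ closure Ω ∩ Metric.ball x₀ ρ' := fun y hy =>
      ⟨subset_closure (hsub (hball hy)).1, hball hy⟩
    have hxx : x ∈ Metric.ball x r := Metric.mem_ball_self hr
    have hxΩ0 := hsub (hball hxx)
    have hcd : ContDiffOn ℝ 2 w (Metric.ball x r) := (hw.contDiffOn (hΩ.uniqueDiffOn h0)).mono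
      fun y hy => ⟨(hcl y hy).1, (hsub (hball hy)).2⟩
    have hM := hB.nonneg
    have hA : 0 ≤ A := (abs_nonneg _).trans (hB.val x (hcl x hxx))
    have g1 := h₁ w x r A (n * M) hr hcd (fun y hy => hB.val y (hcl y hy)) (fun y hy => by
      rw [hw.lapl_eq hΩ.1 (hsub (hball hy)), ← Real.norm_eq_abs]
      refine (norm_sum_bvec_le (F := ℝ) (w'' y)).trans ?_
      gcongr
      exact hB.deriv2 y (hcl y hy))
    have g2 := h₂ w x r A M hr hcd hM (fun y hy => hB.val y (hcl y hy)) (fun y hy => by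
      rw [hw.lapl_eq hΩ.1 (hsub (hball hy)), hw.lapl_eq hΩ.1 hxΩ0]
      exact hL y (hcl y hy) x (hcl x hxx))
    rw [hw.fderiv_eq hΩ.1 hxΩ0] at g1
    rw [hw.fderiv2_eq hΩ.1 hxΩ0] at g2
    have e1 : A / r ≤ A / r ^ 2 := by
      rw [div_le_div_iff₀ hr (by positivity)]
      have : r ^ 2 ≤ r := by nlinarith
      gcongr
    have e2 : A / r + r * (n * M) ≤ (n + 1) * (A / r ^ 2 + r * M) := by
      have : 0 ≤ n * (A / r ^ 2) := by positivity
      have h4 : 0 ≤ r * M := by positivity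
      linarith
    have e4 := mul_le_mul_of_nonneg_left e2 hC₁.le
    linarith
  · have hxf : x₀ ∈ frontier Ω := ⟨hx₀.1, fun h => hxΩ (interior_subset h)⟩
    obtain ⟨φ, R, ρ₁, ρ₂, K, hch⟩ := exists_bdryChart hΩ h0 hxf
    obtain ⟨C, hC, hest⟩ := hch.estimate
    have hK := zero_lt_one.trans_le hch.one_le
    have hρ₂ := hch.pos
    refine ⟨min (ρ₂ / K / 2) 1, by positivity, ρ₁, hch.pos.trans_le hch.le, C, hC,
      hch.half_lt, fun w w' w'' A M hw hB hL x hx r hr hrρ => ?_⟩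
    rw [← hch.side_eq] at hB hL
    have hxb : x ∈ Metric.ball x₀ (ρ₂ / K / 2) :=
      Metric.ball_subset_ball (min_le_left _ _) hx.2
    have hxb1 : x ∈ Metric.ball x₀ ρ₁ := hch.ball_subset (hch.mem_ball_of_div
      (Metric.ball_subset_ball (half_le_self (by positivity)) hxb))
    exact hest w w' w'' A M (hch.dirichletJet hw) hB hL x hxb ((hch.mem_closure_iff x hxb1).1 hx.1)
      r hr (hrρ.trans (min_le_right _ _)) (hrρ.trans (min_le_left _ _))

end DomainJets

section Family

variable {n : ℕ} {Ω : Set (Eucl n)}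

lemma abs_sub_le_of_segment {f : Eucl n → ℝ} {M : ℝ} {x y : Eucl n}
    (hc : ContinuousOn f (segment ℝ x y))
    (hd : ∀ z ∈ openSegment ℝ x y, ∃ f' : Eucl n →L[ℝ] ℝ, HasFDerivAt f f' z ∧ ‖f'‖ ≤ M) :
    |f x - f y| ≤ M * ‖x - y‖ := by
  have hl : ∀ t : ℝ, HasDerivAt (fun t : ℝ => x + t • (y - x)) (y - x) t := fun t => by
    simpa using ((hasDerivAt_id t).smul_const (y - x)).const_add x
  have hseg : ∀ t ∈ Icc (0 : ℝ) 1, x + t • (y - x) ∈ segment ℝ x y := fun t ht => by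
    rw [segment_eq_image']; exact ⟨t, ht, rfl⟩
  have hopen : ∀ t ∈ Ioo (0 : ℝ) 1, x + t • (y - x) ∈ openSegment ℝ x y := fun t ht => by
    rw [openSegment_eq_image']; exact ⟨t, ht, rfl⟩
  choose! f' hf' hM using hd
  obtain ⟨t, ht, he⟩ := exists_hasDerivAt_eq_slope (fun t : ℝ => f (x + t • (y - x)))
    (fun t => f' (x + t • (y - x)) (y - x)) zero_lt_one
    (hc.comp (fun t _ => (hl t).continuousAt.continuousWithinAt) hseg)
    fun t ht => (hf' _ (hopen t ht)).comp_hasDerivAt t (hl t)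
  simp only [one_smul, add_sub_cancel, zero_smul, add_zero, sub_zero, div_one] at he
  rw [abs_sub_comm, ← he, norm_sub_rev x y]
  exact ((f' _).le_opNorm _).trans (by gcongr; exact hM _ (hopen t ht))

lemma abs_sub_le_of_zero_frontier (hΩ : IsOpen Ω) {B : Set (Eucl n)} (hB : Convex ℝ B)
    {f : Eucl n → ℝ} {M : ℝ} (hM : 0 ≤ M) (hc : ContinuousOn f (closure Ω ∩ B))
    (hd : ∀ z ∈ Ω ∩ B, ∃ f' : Eucl n →L[ℝ] ℝ, HasFDerivAt f f' z ∧ ‖f'‖ ≤ M)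
    (hz : ∀ z ∈ frontier Ω, f z = 0) {x y : Eucl n} (hx : x ∈ closure Ω ∩ B)
    (hy : y ∈ closure Ω ∩ B) : |f x - f y| ≤ M * ‖x - y‖ := by
  have key : ∀ x ∈ closure Ω ∩ B, ∀ z ∈ B, z ∉ Ω → |f x| ≤ M * ‖x - z‖ := by
    intro x hx z hzB hzΩ
    have hcl : Continuous fun t : ℝ => x + t • (z - x) := by fun_prop
    have hcomp : IsCompact (Icc (0 : ℝ) 1 ∩ (fun t : ℝ => x + t • (z - x)) ⁻¹' Ωᶜ) :=
      isCompact_Icc.inter_right (hΩ.isClosed_compl.preimage hcl)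
    obtain ⟨t, ⟨ht, htΩ⟩, hle⟩ := hcomp.exists_isLeast ⟨1, ⟨zero_le_one, le_rfl⟩, by simpa⟩
    have hin : ∀ r ∈ Ico 0 t, x + r • (z - x) ∈ Ω := fun r hr => by
      by_contra h
      exact not_le.2 hr.2 (hle ⟨⟨hr.1, hr.2.le.trans ht.2⟩, h⟩)
    have hBt : ∀ r ∈ Icc (0 : ℝ) 1, x + r • (z - x) ∈ B := fun r hr =>
      hB.segment_subset hx.2 hzB (by rw [segment_eq_image']; exact ⟨r, hr, rfl⟩)
    have htcl : x + t • (z - x) ∈ closure Ω := by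
      rcases ht.1.eq_or_lt with h | h
      · rw [← h]; simpa using hx.1
      · have h1 : t ∈ closure (Ico 0 t) := by
          rw [closure_Ico h.ne]; exact ⟨h.le, le_rfl⟩
        exact map_mem_closure (f := fun t : ℝ => x + t • (z - x)) hcl h1 hin
    have hf0 : f (x + t • (z - x)) = 0 := hz _ ⟨htcl, fun h => htΩ (interior_subset h)⟩
    have h1 : |f x - f (x + t • (z - x))| ≤ M * ‖x - (x + t • (z - x))‖ := by
      have hsm : ∀ r : ℝ, x + r • (x + t • (z - x) - x) = x + (r * t) • (z - x) := fun r => by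
        module
      rcases ht.1.eq_or_lt with ht0 | ht0
      · rw [← ht0]; simp
      refine abs_sub_le_of_segment (hc.mono ?_) fun w hw => hd w ?_
      · rw [segment_eq_image']
        rintro _ ⟨r, hr, rfl⟩
        simp only [hsm]
        have hrt : r * t ≤ t := mul_le_of_le_one_left ht.1 hr.2
        refine ⟨?_, hBt _ ⟨mul_nonneg hr.1 ht.1, hrt.trans ht.2⟩⟩
        rcases hrt.eq_or_lt with h | h
        · rw [h]; exact htcl
        · exact subset_closure (hin _ ⟨mul_nonneg hr.1 ht.1, h⟩)
      · rw [openSegment_eq_image'] at hw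
        obtain ⟨r, hr, rfl⟩ := hw
        simp only [hsm]
        exact ⟨hin _ ⟨mul_nonneg hr.1.le ht.1, mul_lt_of_lt_one_left ht0 hr.2⟩,
          hBt _ ⟨mul_nonneg hr.1.le ht.1, (mul_le_of_le_one_left ht.1 hr.2.le).trans ht.2⟩⟩
    rw [hf0, sub_zero, sub_add_cancel_left, norm_neg, norm_smul, Real.norm_eq_abs,
      abs_of_nonneg ht.1, norm_sub_rev] at h1
    refine h1.trans ?_
    gcongr
    exact mul_le_of_le_one_left (norm_nonneg _) ht.2
  by_cases h : ∀ z ∈ segment ℝ x y, z ∈ Ω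
  · exact abs_sub_le_of_segment
      (hc.mono fun z hz => ⟨subset_closure (h z hz), hB.segment_subset hx.2 hy.2 hz⟩)
      fun z hz => hd z ⟨h z (openSegment_subset_segment ℝ x y hz),
        hB.segment_subset hx.2 hy.2 (openSegment_subset_segment ℝ x y hz)⟩
  · push Not at h
    obtain ⟨z, hz, hzΩ⟩ := h
    have hzB := hB.segment_subset hx.2 hy.2 hz
    have h1 := key x hx z hzB hzΩ
    have h2 := key y hy z hzB hzΩ
    have h3 := dist_add_dist_of_mem_segment hz
    rw [dist_eq_norm, dist_eq_norm, dist_eq_norm] at h3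
    rw [← h3, mul_add, norm_sub_rev z y]
    exact (abs_sub _ _).trans (add_le_add h1 h2)

lemma diff_subset_closure_diff : closure Ω \ {0} ⊆ closure (Ω \ {0}) := fun x hx => by
  have := (isClosed_singleton (x := (0 : Eucl n))).isOpen_compl.inter_closure (t := Ω) ⟨hx.2, hx.1⟩
  rwa [inter_comm] at this

lemma SmoothDomain.isCompact_closure (hΩ : SmoothDomain Ω) : IsCompact (closure Ω) :=
  Metric.isCompact_of_isClosed_isBounded isClosed_closure hΩ.2.1.closure

lemma SmoothDomain.isCompact_annulus (hΩ : SmoothDomain Ω) (d : ℝ) :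
    IsCompact (closure Ω ∩ {x | d ≤ ‖x‖}) :=
  hΩ.isCompact_closure.inter_right (isClosed_le continuous_const continuous_norm)

lemma annulus_subset {d : ℝ} (hd : 0 < d) :
    closure Ω ∩ {x : Eucl n | d ≤ ‖x‖} ⊆ closure Ω \ {0} := fun x hx => ⟨hx.1, fun h => by
  have h2 : d ≤ ‖x‖ := hx.2
  rw [mem_singleton_iff.1 h, norm_zero] at h2
  linarith⟩

lemma frontier_subset (hΩ : SmoothDomain Ω) (h0 : (0 : Eucl n) ∈ Ω) {x : Eucl n}
    (hx : x ∈ frontier Ω) : x ∈ closure Ω \ {0} := by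
  refine ⟨hx.1, fun h => ?_⟩
  rw [mem_singleton_iff] at h
  rw [hΩ.1.frontier_eq, h] at hx
  exact hx.2 h0

lemma DomainJet.of_contDiffOn (hΩ : SmoothDomain Ω) (h0 : (0 : Eucl n) ∈ Ω) {w : Eucl n → ℝ}
    (hw : ContDiffOn ℝ 2 w (closure Ω \ {0})) (hz : ∀ x ∈ frontier Ω, w x = 0)
    {f : Eucl n → ℝ} (hf : ContinuousOn f (closure Ω \ {0}))
    (hl : ∀ x ∈ Ω \ {0}, lapl w x = f x) (hfz : ∀ x ∈ frontier Ω, f x = 0) :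
    DomainJet Ω w (fderivWithin ℝ w (closure Ω \ {0}))
      (fderivWithin ℝ (fderivWithin ℝ w (closure Ω \ {0})) (closure Ω \ {0})) ∧
    ∀ x ∈ closure Ω \ {0}, ∑ i, fderivWithin ℝ (fderivWithin ℝ w (closure Ω \ {0}))
      (closure Ω \ {0}) x (bvec i) (bvec i) = f x := by
  have hu := hΩ.uniqueDiffOn h0
  set S := closure Ω \ {0} with hS
  have h1 : ContDiffOn ℝ 1 (fderivWithin ℝ w S) S := hw.fderivWithin hu (by norm_num)
  have hd1 : ∀ x ∈ S, HasFDerivWithinAt w (fderivWithin ℝ w S x) S x := fun x hx =>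
    ((hw x hx).differentiableWithinAt (by norm_num)).hasFDerivWithinAt
  have hd2 : ∀ x ∈ S, HasFDerivWithinAt (fderivWithin ℝ w S)
      (fderivWithin ℝ (fderivWithin ℝ w S) S x) S x := fun x hx =>
    ((h1 x hx).differentiableWithinAt (by norm_num)).hasFDerivWithinAt
  have hc : ContinuousOn (fderivWithin ℝ (fderivWithin ℝ w S) S) S :=
    h1.continuousOn_fderivWithin hu le_rfl
  have hsub : Ω \ {0} ⊆ S := diff_subset_diff_left subset_closure
  have hopen := hΩ.1.sdiff (isClosed_singleton (x := (0 : Eucl n)))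
  have htr : ∀ x ∈ S, ∑ i, fderivWithin ℝ (fderivWithin ℝ w S) S x (bvec i) (bvec i) = f x := by
    have : EqOn (fun x => ∑ i, fderivWithin ℝ (fderivWithin ℝ w S) S x (bvec i) (bvec i)) f S := by
      refine EqOn.of_subset_closure (s := Ω \ {0}) (fun x hx => ?_) ?_ hf hsub
        diff_subset_closure_diff
      · have e1 : fderiv ℝ w =ᶠ[nhds x] fderivWithin ℝ w S := by
          filter_upwards [hopen.mem_nhds hx] with y hy
          exact ((hd1 y (hsub hy)).hasFDerivAt (DomainJet.mem_nhds_of_mem hΩ.1 hy)).fderiv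
        rw [← hl x hx, lapl, e1.fderiv_eq,
          ((hd2 x (hsub hx)).hasFDerivAt (DomainJet.mem_nhds_of_mem hΩ.1 hx)).fderiv]
      · exact continuousOn_finsetSum _ fun i _ =>
          (hc.clm_apply continuousOn_const).clm_apply continuousOn_const
    exact this
  refine ⟨⟨hd1, hd2, hc, fun x hx a b => ?_, hz, fun x hx => ?_⟩, htr⟩
  · refine ((hw x hx).isSymmSndFDerivWithinAt (by simp) hu ?_ hx).eq a b
    exact closure_mono (hopen.subset_interior_iff.2 hsub) (diff_subset_closure_diff hx)
  · rw [htr x (frontier_subset hΩ h0 hx), hfz x hx]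

/-- A sequence of solutions of `-Δ u = F₁ u + F₂ g(u)` with Dirichlet condition, bounded away from
the origin. -/
structure DirichletFamily (Ω : Set (Eucl n)) (u : ℕ → Eucl n → ℝ) (F₁ F₂ : Eucl n → ℝ)
    (g g' : ℕ → ℝ → ℝ) : Prop where
  domain : SmoothDomain Ω
  zero_mem : (0 : Eucl n) ∈ Ω
  coeff₁ : ContDiffOn ℝ 1 F₁ (closure Ω \ {0})
  coeff₂ : ContDiffOn ℝ 1 F₂ (closure Ω \ {0})
  hasDerivAt : ∀ k t, HasDerivAt (g k) (g' k t) t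
  map_zero : ∀ k, g k 0 = 0
  nonlin_bound : ∀ B, ∃ L, ∀ k t, |t| ≤ B → |g k t| ≤ L ∧ |g' k t| ≤ L
  smooth : ∀ k, ContDiffOn ℝ 2 (u k) (closure Ω \ {0})
  zero : ∀ k, ∀ x ∈ frontier Ω, u k x = 0
  eqn : ∀ k, ∀ x ∈ Ω \ {0}, lapl (u k) x = -(F₁ x * u k x + F₂ x * g k (u k x))
  bound : ∀ d > 0, ∃ B, ∀ k, ∀ x ∈ closure Ω, d ≤ ‖x‖ → |u k x| ≤ B

lemma exists_bound_of_contDiffOn_one (hΩ : SmoothDomain Ω) (h0 : (0 : Eucl n) ∈ Ω)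
    {F : Eucl n → ℝ} (hF : ContDiffOn ℝ 1 F (closure Ω \ {0})) {d : ℝ} (hd : 0 < d) :
    ∃ C, 0 ≤ C ∧ ∀ x ∈ closure Ω, d ≤ ‖x‖ →
      |F x| ≤ C ∧ ‖fderivWithin ℝ F (closure Ω \ {0}) x‖ ≤ C := by
  have hK := hΩ.isCompact_annulus d
  obtain ⟨C₁, h1⟩ := hK.exists_bound_of_continuousOn (hF.continuousOn.mono (annulus_subset hd))
  obtain ⟨C₂, h2⟩ := hK.exists_bound_of_continuousOn
    ((hF.continuousOn_fderivWithin (hΩ.uniqueDiffOn h0) le_rfl).mono (annulus_subset hd))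
  refine ⟨max (max C₁ C₂) 0, le_max_right _ _, fun x hx hdx => ⟨?_, ?_⟩⟩
  · exact (h1 x ⟨hx, hdx⟩).trans ((le_max_left _ _).trans (le_max_left _ _))
  · exact (h2 x ⟨hx, hdx⟩).trans ((le_max_right _ _).trans (le_max_left _ _))

namespace DirichletFamily

variable {u : ℕ → Eucl n → ℝ} {F₁ F₂ : Eucl n → ℝ} {g g' : ℕ → ℝ → ℝ}

/-- The gradient up to the boundary. -/
noncomputable def du (_ : DirichletFamily Ω u F₁ F₂ g g') (k : ℕ) : Eucl n → Eucl n →L[ℝ] ℝ :=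
  fderivWithin ℝ (u k) (closure Ω \ {0})

/-- The Hessian up to the boundary. -/
noncomputable def ddu (_ : DirichletFamily Ω u F₁ F₂ g g') (k : ℕ) :
    Eucl n → Eucl n →L[ℝ] Eucl n →L[ℝ] ℝ :=
  fderivWithin ℝ (fderivWithin ℝ (u k) (closure Ω \ {0})) (closure Ω \ {0})

variable (H : DirichletFamily Ω u F₁ F₂ g g')
include H

lemma continuousOn_rhs (k : ℕ) :
    ContinuousOn (fun x => -(F₁ x * u k x + F₂ x * g k (u k x))) (closure Ω \ {0}) := by
  have hg : Continuous (g k) := continuous_iff_continuousAt.2 fun t => (H.hasDerivAt k t).continuousAt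
  have hu := (H.smooth k).continuousOn
  exact ((H.coeff₁.continuousOn.mul hu).add
    (H.coeff₂.continuousOn.mul (hg.comp_continuousOn hu))).neg

lemma jet (k : ℕ) : DomainJet Ω (u k) (H.du k) (H.ddu k) :=
  (DomainJet.of_contDiffOn H.domain H.zero_mem (H.smooth k) (H.zero k) (H.continuousOn_rhs k)
    (H.eqn k) fun x hx => by simp [H.zero k x hx, H.map_zero k]).1

lemma trace_eq (k : ℕ) {x : Eucl n} (hx : x ∈ closure Ω \ {0}) :
    ∑ i, H.ddu k x (bvec i) (bvec i) = -(F₁ x * u k x + F₂ x * g k (u k x)) :=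
  (DomainJet.of_contDiffOn H.domain H.zero_mem (H.smooth k) (H.zero k) (H.continuousOn_rhs k)
    (H.eqn k) fun x hx => by simp [H.zero k x hx, H.map_zero k]).2 x hx

lemma exists_rhs_bound {d : ℝ} (hd : 0 < d) : ∃ C, 1 ≤ C ∧
    (∀ k, ∀ x ∈ closure Ω, d ≤ ‖x‖ → |u k x| ≤ C ∧ |F₁ x * u k x + F₂ x * g k (u k x)| ≤ C) ∧
    ∀ k, ∀ x ∈ Ω, d ≤ ‖x‖ → ∃ f' : Eucl n →L[ℝ] ℝ,
      HasFDerivAt (fun x => -(F₁ x * u k x + F₂ x * g k (u k x))) f' x ∧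
      ‖f'‖ ≤ C * (1 + ‖H.du k x‖) := by
  obtain ⟨B, hB⟩ := H.bound d hd
  obtain ⟨L, hL⟩ := H.nonlin_bound B
  obtain ⟨C₁, hC₁, h1⟩ := exists_bound_of_contDiffOn_one H.domain H.zero_mem H.coeff₁ hd
  obtain ⟨C₂, hC₂, h2⟩ := exists_bound_of_contDiffOn_one H.domain H.zero_mem H.coeff₂ hd
  set B' := max B 0
  set L' := max L 0
  have hB0 : 0 ≤ B' := le_max_right _ _
  have hL0 : 0 ≤ L' := le_max_right _ _
  have hB' : ∀ k, ∀ x ∈ closure Ω, d ≤ ‖x‖ → |u k x| ≤ B' := fun k x hx hdx =>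
    (hB k x hx hdx).trans (le_max_left _ _)
  have hL1 : ∀ k, ∀ x ∈ closure Ω, d ≤ ‖x‖ → |g k (u k x)| ≤ L' := fun k x hx hdx =>
    (hL k _ (hB k x hx hdx)).1.trans (le_max_left _ _)
  have hL2 : ∀ k, ∀ x ∈ closure Ω, d ≤ ‖x‖ → |g' k (u k x)| ≤ L' := fun k x hx hdx =>
    (hL k _ (hB k x hx hdx)).2.trans (le_max_left _ _)
  have p1 : 0 ≤ C₁ * B' := by positivity
  have p2 : 0 ≤ C₂ * L' := by positivity
  refine ⟨C₁ * B' + C₂ * L' + C₁ + B' + 1, by linarith, fun k x hx hdx => ⟨?_, ?_⟩,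
    fun k x hx hdx => ?_⟩
  · linarith [hB' k x hx hdx]
  · refine (abs_add_le _ _).trans ?_
    rw [abs_mul, abs_mul]
    have e1 : |F₁ x| * |u k x| ≤ C₁ * B' :=
      mul_le_mul (h1 x hx hdx).1 (hB' k x hx hdx) (abs_nonneg _) hC₁
    have e2 : |F₂ x| * |g k (u k x)| ≤ C₂ * L' :=
      mul_le_mul (h2 x hx hdx).1 (hL1 k x hx hdx) (abs_nonneg _) hC₂
    linarith
  · have hx' := subset_closure hx
    have hx0 : x ∈ Ω \ {0} := ⟨hx, (annulus_subset hd ⟨hx', hdx⟩).2⟩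
    have hn := DomainJet.mem_nhds_of_mem H.domain.1 hx0
    have d1 : HasFDerivAt F₁ (fderivWithin ℝ F₁ (closure Ω \ {0}) x) x :=
      ((H.coeff₁ x ⟨hx', hx0.2⟩).differentiableWithinAt (by norm_num)).hasFDerivWithinAt.hasFDerivAt
        hn
    have d2 : HasFDerivAt F₂ (fderivWithin ℝ F₂ (closure Ω \ {0}) x) x :=
      ((H.coeff₂ x ⟨hx', hx0.2⟩).differentiableWithinAt (by norm_num)).hasFDerivWithinAt.hasFDerivAt
        hn
    have d3 : HasFDerivAt (u k) (H.du k x) x := (H.jet k).hasFDerivAt H.domain.1 hx0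
    have d4 : HasFDerivAt (fun x => g k (u k x)) (g' k (u k x) • H.du k x) x :=
      (H.hasDerivAt k (u k x)).comp_hasFDerivAt x d3
    refine ⟨_, ((d1.fun_mul d3).fun_add (d2.fun_mul d4)).fun_neg, ?_⟩
    rw [norm_neg]
    refine (norm_add_le _ _).trans ?_
    have e1 : ‖F₁ x • H.du k x + u k x • fderivWithin ℝ F₁ (closure Ω \ {0}) x‖
        ≤ C₁ * ‖H.du k x‖ + B' * C₁ := by
      refine (norm_add_le _ _).trans ?_
      rw [norm_smul, norm_smul]
      gcongr
      · exact (h1 x hx' hdx).1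
      · exact hB' k x hx' hdx
      · exact (h1 x hx' hdx).2
    have e2 : ‖F₂ x • g' k (u k x) • H.du k x
        + g k (u k x) • fderivWithin ℝ F₂ (closure Ω \ {0}) x‖
        ≤ C₂ * (L' * ‖H.du k x‖) + L' * C₂ := by
      refine (norm_add_le _ _).trans ?_
      rw [norm_smul, norm_smul, norm_smul]
      gcongr
      · exact (h2 x hx' hdx).1
      · exact hL2 k x hx' hdx
      · exact hL1 k x hx' hdx
      · exact (h2 x hx' hdx).2
    refine (add_le_add e1 e2).trans ?_
    nlinarith [norm_nonneg (H.du k x), mul_nonneg p1 (norm_nonneg (H.du k x)),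
      mul_nonneg hB0 (norm_nonneg (H.du k x))]

lemma exists_trace_lipschitz {d : ℝ} (hd : 0 < d) : ∃ C, 1 ≤ C ∧
    (∀ k, ∀ x ∈ closure Ω, d ≤ ‖x‖ → |u k x| ≤ C) ∧
    ∀ k N x₀ ρ, 0 ≤ N → (∀ x ∈ Metric.ball x₀ ρ, d ≤ ‖x‖) →
      (∀ x ∈ closure Ω ∩ Metric.ball x₀ ρ, ‖H.du k x‖ ≤ N) →
      ∀ x ∈ closure Ω ∩ Metric.ball x₀ ρ, ∀ y ∈ closure Ω ∩ Metric.ball x₀ ρ,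
        |∑ i, H.ddu k x (bvec i) (bvec i) - ∑ i, H.ddu k y (bvec i) (bvec i)|
          ≤ C * (1 + N) * ‖x - y‖ := by
  obtain ⟨C, hC, hu, hf⟩ := H.exists_rhs_bound hd
  refine ⟨C, hC, fun k x hx hdx => (hu k x hx hdx).1, fun k N x₀ ρ hN hball hdu x hx y hy => ?_⟩
  have hS : closure Ω ∩ Metric.ball x₀ ρ ⊆ closure Ω \ {0} := fun z hz =>
    annulus_subset hd ⟨hz.1, hball z hz.2⟩
  rw [H.trace_eq k (hS hx), H.trace_eq k (hS hy)]
  refine abs_sub_le_of_zero_frontier H.domain.1 (convex_ball x₀ ρ)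
    (f := fun x => -(F₁ x * u k x + F₂ x * g k (u k x))) (by positivity)
    ((H.continuousOn_rhs k).mono hS) (fun z hz => ?_)
    (fun z hz => by simp [H.zero k z hz, H.map_zero k]) hx hy
  obtain ⟨f', h1, h2⟩ := hf k z hz.1 (hball z hz.2)
  refine ⟨f', h1, h2.trans ?_⟩
  gcongr
  exact hdu z ⟨subset_closure hz.1, hz.2⟩

end DirichletFamily

end Family

section DerivBound

variable {n : ℕ} {Ω : Set (Eucl n)}

namespace DirichletFamily

variable {u : ℕ → Eucl n → ℝ} {F₁ F₂ : Eucl n → ℝ} {g g' : ℕ → ℝ → ℝ}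
  (H : DirichletFamily Ω u F₁ F₂ g g')
include H

lemma exists_interior_bound [NeZero n] {K : Set (Eucl n)} (hK : IsCompact K) (hKΩ : K ⊆ Ω \ {0}) :
    ∃ C, ∀ k, ∀ x ∈ K, ‖H.du k x‖ + ‖H.ddu k x‖ ≤ C := by
  refine hK.induction_on (p := fun s => ∃ C, ∀ k, ∀ x ∈ s, ‖H.du k x‖ + ‖H.ddu k x‖ ≤ C)
    ⟨0, by simp⟩ (fun s t hst ⟨C, h⟩ => ⟨C, fun k x hx => h k x (hst hx)⟩)
    (fun s t ⟨C, h⟩ ⟨C', h'⟩ => ⟨max C C', fun k x hx => ?_⟩) fun x₀ hx₀ => ?_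
  · rcases hx with hx | hx
    · exact (h k x hx).trans (le_max_left _ _)
    · exact (h' k x hx).trans (le_max_right _ _)
  obtain ⟨C₁, hC₁, h₁⟩ := gradient_estimate n
  obtain ⟨C₂, hC₂, h₂⟩ := hessian_estimate n
  have hΩ := H.domain.1
  have hnorm : 0 < ‖x₀‖ := norm_pos_iff.2 (hKΩ hx₀).2
  obtain ⟨ρ', hρ', hb⟩ := Metric.eventually_nhds_iff_ball.1
    ((hΩ.eventually_mem (hKΩ hx₀).1).and (continuous_norm.continuousAt.eventually_const_lt
    (half_lt_self hnorm)))
  obtain ⟨ρ, hρ, hρe⟩ : ∃ ρ > 0, 4 * ρ = ρ' := ⟨ρ' / 4, by positivity, by ring⟩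
  obtain ⟨C, hC, hu, -⟩ := H.exists_rhs_bound (half_pos hnorm)
  obtain ⟨L, hL, -, hlip⟩ := H.exists_trace_lipschitz (half_pos hnorm)
  have hmem : ∀ x ∈ Metric.ball x₀ ρ', x ∈ Ω \ {0} := fun x hx =>
    ⟨(hb x hx).1, (annulus_subset (half_pos hnorm)
      ⟨subset_closure (hb x hx).1, (hb x hx).2.le⟩).2⟩
  have hsm : ∀ k, ContDiffOn ℝ 2 (u k) (Metric.ball x₀ ρ') := fun k =>
    (H.smooth k).mono fun x hx => ⟨subset_closure (hmem x hx).1, (hmem x hx).2⟩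
  have hbd : ∀ k, ∀ x ∈ Metric.ball x₀ ρ', |u k x| ≤ C := fun k x hx =>
    (hu k x (subset_closure (hmem x hx).1) (hb x hx).2.le).1
  have hbl : ∀ k, ∀ x ∈ Metric.ball x₀ ρ', |lapl (u k) x| ≤ C := fun k x hx => by
    rw [H.eqn k x (hmem x hx), abs_neg]
    exact (hu k x (subset_closure (hmem x hx).1) (hb x hx).2.le).2
  have hsub : ∀ x ∈ Metric.ball x₀ (2 * ρ), Metric.ball x ρ ⊆ Metric.ball x₀ ρ' := fun x hx => by
    refine Metric.ball_subset_ball' ?_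
    rw [Metric.mem_ball] at hx
    linarith
  have hgrad : ∀ k, ∀ x ∈ Metric.ball x₀ (2 * ρ), ‖H.du k x‖ ≤ C₁ * (C / ρ + ρ * C) :=
    fun k x hx => by
    have := h₁ (u k) x ρ C C hρ ((hsm k).mono (hsub x hx)) (fun z hz => hbd k z (hsub x hx hz))
      (fun z hz => hbl k z (hsub x hx hz))
    rwa [(H.jet k).fderiv_eq hΩ (hmem x (hsub x hx (Metric.mem_ball_self hρ)))] at this
  have hGpos : 0 ≤ C₁ * (C / ρ + ρ * C) := by positivity
  set G := C₁ * (C / ρ + ρ * C)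
  refine ⟨Metric.ball x₀ ρ, mem_nhdsWithin_of_mem_nhds (Metric.ball_mem_nhds _ hρ),
    G + C₂ * (C / ρ ^ 2 + ρ * (L * (1 + G))), fun k x hx => ?_⟩
  have hx2 : x ∈ Metric.ball x₀ (2 * ρ) := Metric.ball_subset_ball (by linarith) hx
  have hsub2 : Metric.ball x ρ ⊆ Metric.ball x₀ (2 * ρ) := by
    refine Metric.ball_subset_ball' ?_
    rw [Metric.mem_ball] at hx
    linarith
  have h4 : Metric.ball x₀ (2 * ρ) ⊆ Metric.ball x₀ ρ' := Metric.ball_subset_ball (by linarith)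
  have hx4 := hmem x (h4 hx2)
  have := h₂ (u k) x ρ C (L * (1 + G)) hρ ((hsm k).mono (hsub x hx2)) (by positivity)
    (fun z hz => hbd k z (hsub x hx2 hz)) (fun z hz => by
      have hz2 := hsub2 hz
      have hz4 := hmem z (h4 hz2)
      rw [(H.jet k).lapl_eq hΩ hz4, (H.jet k).lapl_eq hΩ hx4]
      exact hlip k G x₀ (2 * ρ) hGpos (fun y hy => (hb y (h4 hy)).2.le)
        (fun y hy => hgrad k y hy.2) z ⟨subset_closure hz4.1, hz2⟩ x ⟨subset_closure hx4.1, hx2⟩)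
  rw [(H.jet k).fderiv2_eq hΩ hx4] at this
  exact add_le_add (hgrad k x hx2) this

/-- Estimates up to the boundary, with the derivatives on a larger set absorbed. -/
lemma exists_absorbing_bound [NeZero n] {d : ℝ} (hd : 0 < d) :
    ∃ C, ∀ k N, 0 ≤ N → (∀ y ∈ closure Ω, d / 2 ≤ ‖y‖ → ‖H.du k y‖ + ‖H.ddu k y‖ ≤ N) →
      ∀ x ∈ closure Ω, d ≤ ‖x‖ → ‖H.du k x‖ + ‖H.ddu k x‖ ≤ C + N / 2 := by
  suffices h : ∃ C, ∀ k N, 0 ≤ N →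
      (∀ y ∈ closure Ω, d / 2 ≤ ‖y‖ → ‖H.du k y‖ + ‖H.ddu k y‖ ≤ N) →
      ∀ x ∈ closure Ω ∩ {x | d ≤ ‖x‖}, x ∈ closure Ω → ‖H.du k x‖ + ‖H.ddu k x‖ ≤ C + N / 2 by
    obtain ⟨C, h⟩ := h
    exact ⟨C, fun k N hN hy x hx hdx => h k N hN hy x ⟨hx, hdx⟩ hx⟩
  refine (H.domain.isCompact_annulus d).induction_on (p := fun s => ∃ C, ∀ k N, 0 ≤ N →
      (∀ y ∈ closure Ω, d / 2 ≤ ‖y‖ → ‖H.du k y‖ + ‖H.ddu k y‖ ≤ N) →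
      ∀ x ∈ s, x ∈ closure Ω → ‖H.du k x‖ + ‖H.ddu k x‖ ≤ C + N / 2)
    ⟨0, by simp⟩ (fun s t hst ⟨C, h⟩ => ⟨C, fun k N hN hy x hx => h k N hN hy x (hst hx)⟩)
    (fun s t ⟨C, h⟩ ⟨C', h'⟩ => ⟨max C C', fun k N hN hy x hx hxc => ?_⟩) fun x₀ hx₀ => ?_
  · rcases hx with hx | hx
    · linarith [h k N hN hy x hx hxc, le_max_left C C']
    · linarith [h' k N hN hy x hx hxc, le_max_right C C']
  obtain ⟨ρ, hρ, ρ', hρ', C, hC, hhalf, hest⟩ :=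
    exists_local_estimate H.domain H.zero_mem (annulus_subset hd hx₀)
  obtain ⟨L, hL, hbd, hlip⟩ := H.exists_trace_lipschitz (half_pos hd)
  have hL0 : 0 < L := by linarith
  have hball : ∀ x ∈ Metric.ball x₀ ρ', d / 2 ≤ ‖x‖ := fun x hx => by
    have h1 := hhalf x hx
    have h2 : d ≤ ‖x₀‖ := hx₀.2
    linarith
  set r := min ρ (1 / (2 * C * L)) with hr
  have hr0 : 0 < r := by positivity
  have hrC : C * (r * L) ≤ 1 / 2 := by
    have h1 : r ≤ 1 / (2 * C * L) := min_le_right _ _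
    rw [le_div_iff₀ (by positivity)] at h1
    linarith
  refine ⟨Metric.ball x₀ ρ, mem_nhdsWithin_of_mem_nhds (Metric.ball_mem_nhds _ hρ),
    C * (L / r ^ 2) + 1 / 2, fun k N hN hy x hx hxc => ?_⟩
  have hNL : N ≤ L * (1 + N) := by nlinarith
  have := hest (u k) (H.du k) (H.ddu k) L (L * (1 + N)) (H.jet k)
    ⟨by positivity, fun y hy' => hbd k y hy'.1 (hball y hy'.2),
      fun y hy' => ((le_add_of_nonneg_right (norm_nonneg _)).trans
        (hy y hy'.1 (hball y hy'.2))).trans hNL,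
      fun y hy' => ((le_add_of_nonneg_left (norm_nonneg _)).trans
        (hy y hy'.1 (hball y hy'.2))).trans hNL⟩
    (hlip k N x₀ ρ' hN hball fun y hy' => (le_add_of_nonneg_right (norm_nonneg _)).trans
        (hy y hy'.1 (hball y hy'.2))) x ⟨hxc, hx⟩ r hr0 (min_le_left _ _)
  have h3 := mul_le_mul_of_nonneg_right hrC (show 0 ≤ 1 + N by linarith)
  linarith

theorem exists_deriv_bound [NeZero n] {d : ℝ} (hd : 0 < d) :
    ∃ C, ∀ k, ∀ x ∈ closure Ω, d ≤ ‖x‖ → ‖H.du k x‖ + ‖H.ddu k x‖ ≤ C := by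
  obtain ⟨δ, hδ, hball⟩ := Metric.isOpen_iff.1 H.domain.1 0 H.zero_mem
  set e := min d (δ / 2) with he
  have he0 : 0 < e := by positivity
  obtain ⟨C, hC⟩ := H.exists_absorbing_bound he0
  have hcpt : IsCompact (Metric.closedBall (0 : Eucl n) e ∩ {x | e / 2 ≤ ‖x‖}) :=
    (isCompact_closedBall _ _).inter_right (isClosed_le continuous_const continuous_norm)
  obtain ⟨C', hC'⟩ := H.exists_interior_bound hcpt fun x hx => by
    have h1 : x ∈ Ω := hball (Metric.closedBall_subset_ball
      ((min_le_right _ _).trans_lt (half_lt_self hδ)) hx.1)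
    exact ⟨h1, (annulus_subset (half_pos he0) ⟨subset_closure h1, hx.2⟩).2⟩
  refine ⟨max C' (2 * C), fun k x hx hdx => ?_⟩
  have hX := H.domain.isCompact_annulus (e / 2)
  have hxe : e / 2 ≤ ‖x‖ := by
    have : e ≤ d := min_le_left _ _
    linarith
  have hcont : ContinuousOn (fun x => ‖H.du k x‖ + ‖H.ddu k x‖)
      (closure Ω ∩ {x | e / 2 ≤ ‖x‖}) := by
    have h1 : ContinuousOn (H.du k) (closure Ω ∩ {x | e / 2 ≤ ‖x‖}) := fun y hy =>
      (((H.jet k).deriv2 y (annulus_subset (half_pos he0) hy)).continuousWithinAt).mono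
        (annulus_subset (half_pos he0))
    exact h1.norm.add ((H.jet k).cont.mono (annulus_subset (half_pos he0))).norm
  obtain ⟨z, hz, hmax⟩ := hX.exists_isMaxOn ⟨x, hx, hxe⟩ hcont
  have hmax' : ∀ y ∈ closure Ω, e / 2 ≤ ‖y‖ →
      ‖H.du k y‖ + ‖H.ddu k y‖ ≤ ‖H.du k z‖ + ‖H.ddu k z‖ := fun y hy hye => hmax ⟨hy, hye⟩
  refine (hmax' x hx hxe).trans ?_
  by_cases hze : e ≤ ‖z‖
  · have := hC k _ (by positivity) hmax' z hz.1 hze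
    refine le_trans ?_ (le_max_right _ _)
    linarith
  · refine le_trans (hC' k z ⟨?_, hz.2⟩) (le_max_left _ _)
    rw [mem_closedBall_zero_iff]
    exact (not_le.1 hze).le

end DirichletFamily

end DerivBound

section Differences

variable {n : ℕ} {Ω : Set (Eucl n)}

namespace DirichletFamily

variable {u : ℕ → Eucl n → ℝ} {F₁ F₂ : Eucl n → ℝ} {g g' : ℕ → ℝ → ℝ}
  (H : DirichletFamily Ω u F₁ F₂ g g')
include H

/-- A family which is uniformly Cauchy away from the origin is so together with its first and
second derivatives. -/
theorem exists_deriv_cauchy [NeZero n]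
    (hu : ∀ d > 0, ∀ η > 0, ∃ N : ℕ, ∀ k ≥ N, ∀ l ≥ N, ∀ x ∈ closure Ω, d ≤ ‖x‖ →
      |u k x - u l x| ≤ η) {d η : ℝ} (hd : 0 < d) (hη : 0 < η) :
    ∃ N : ℕ, ∀ k ≥ N, ∀ l ≥ N, ∀ x ∈ closure Ω, d ≤ ‖x‖ →
      ‖H.du k x - H.du l x‖ + ‖H.ddu k x - H.ddu l x‖ ≤ η := by
  suffices h : ∃ N : ℕ, ∀ k ≥ N, ∀ l ≥ N, ∀ x ∈ closure Ω ∩ {x | d ≤ ‖x‖}, x ∈ closure Ω →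
      ‖H.du k x - H.du l x‖ + ‖H.ddu k x - H.ddu l x‖ ≤ η by
    obtain ⟨N, h⟩ := h
    exact ⟨N, fun k hk l hl x hx hdx => h k hk l hl x ⟨hx, hdx⟩ hx⟩
  refine (H.domain.isCompact_annulus d).induction_on (p := fun s => ∃ N : ℕ, ∀ k ≥ N, ∀ l ≥ N,
      ∀ x ∈ s, x ∈ closure Ω → ‖H.du k x - H.du l x‖ + ‖H.ddu k x - H.ddu l x‖ ≤ η)
    ⟨0, by simp⟩ (fun s t hst ⟨N, h⟩ => ⟨N, fun k hk l hl x hx => h k hk l hl x (hst hx)⟩)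
    (fun s t ⟨N, h⟩ ⟨N', h'⟩ => ⟨max N N', fun k hk l hl x hx hxc => ?_⟩) fun x₀ hx₀ => ?_
  · rcases hx with hx | hx
    · exact h k (le_of_max_le_left hk) l (le_of_max_le_left hl) x hx hxc
    · exact h' k (le_of_max_le_right hk) l (le_of_max_le_right hl) x hx hxc
  obtain ⟨ρ, hρ, ρ', hρ', C, hC, hhalf, hest⟩ :=
    exists_local_estimate H.domain H.zero_mem (annulus_subset hd hx₀)
  obtain ⟨L, hL, -, hlip⟩ := H.exists_trace_lipschitz (half_pos hd)
  obtain ⟨D, hD⟩ := H.exists_deriv_bound (half_pos hd)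
  have hball : ∀ x ∈ Metric.ball x₀ ρ', d / 2 ≤ ‖x‖ := fun x hx => by
    have h1 := hhalf x hx
    have h2 : d ≤ ‖x₀‖ := hx₀.2
    linarith
  set N := max D 0
  have hN : ∀ k, ∀ x ∈ closure Ω ∩ Metric.ball x₀ ρ', ‖H.du k x‖ + ‖H.ddu k x‖ ≤ N :=
    fun k x hx => (hD k x hx.1 (hball x hx.2)).trans (le_max_left _ _)
  have hN0 : 0 ≤ N := le_max_right _ _
  set M := 2 * (L * (1 + N)) with hM
  have hM0 : 0 < M := by positivity
  have hNM : 2 * N ≤ M := by rw [hM]; nlinarith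
  set r := min ρ (η / (2 * C * M)) with hr
  have hr0 : 0 < r := by positivity
  have hrC : C * (r * M) ≤ η / 2 := by
    have h1 : r ≤ η / (2 * C * M) := min_le_right _ _
    rw [le_div_iff₀ (by positivity)] at h1
    linarith
  obtain ⟨N₀, hN₀⟩ := hu (d / 2) (half_pos hd) (η * r ^ 2 / (2 * C)) (by positivity)
  refine ⟨Metric.ball x₀ ρ, mem_nhdsWithin_of_mem_nhds (Metric.ball_mem_nhds _ hρ),
    N₀, fun k hk l hl x hx hxc => ?_⟩
  have := hest _ _ _ (η * r ^ 2 / (2 * C)) M ((H.jet k).sub (H.jet l))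
    ⟨hM0.le, fun y hy => hN₀ k hk l hl y hy.1 (hball y hy.2),
      fun y hy => by
        have h1 := hN k y hy
        have h2 := hN l y hy
        have h3 := norm_sub_le (H.du k y) (H.du l y)
        have h4 := norm_nonneg (H.ddu k y)
        have h5 := norm_nonneg (H.ddu l y)
        linarith,
      fun y hy => by
        have h1 := hN k y hy
        have h2 := hN l y hy
        have h3 := norm_sub_le (H.ddu k y) (H.ddu l y)
        have h4 := norm_nonneg (H.du k y)
        have h5 := norm_nonneg (H.du l y)
        linarith⟩
    (fun y hy z hz => by
      have h1 := fun k => hlip k N x₀ ρ' hN0 hball (fun y hy =>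
        (le_add_of_nonneg_right (norm_nonneg _)).trans (hN k y hy)) y hy z hz
      have h2 := abs_sub_le_iff.1 (h1 k)
      have h3 := abs_sub_le_iff.1 (h1 l)
      simp only [sub_apply, Finset.sum_sub_distrib]
      rw [abs_sub_le_iff, hM]
      constructor <;> linarith [h2.1, h2.2, h3.1, h3.2]) x ⟨hxc, hx⟩ r hr0 (min_le_left _ _)
  refine this.trans ?_
  have h4 : C * (η * r ^ 2 / (2 * C) / r ^ 2) = η / 2 := by field_simp
  rw [mul_add, h4]
  linarith

end DirichletFamily

end Differences

section Limit

variable {n : ℕ} {Ω : Set (Eucl n)} {u : ℕ → Eucl n → ℝ} {v : Eucl n → ℝ}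
  {u' : ℕ → Eucl n → Eucl n →L[ℝ] ℝ} {v' : Eucl n → Eucl n →L[ℝ] ℝ}
  {u'' : ℕ → Eucl n → Eucl n →L[ℝ] Eucl n →L[ℝ] ℝ} {v'' : Eucl n → Eucl n →L[ℝ] Eucl n →L[ℝ] ℝ}

lemma glue_sub {F : Type*} [AddGroup F] (φ : Eucl n → ℝ) (f₁ f₂ g₁ g₂ : Eucl n → F) (x : Eucl n) :
    glue φ f₁ g₁ x - glue φ f₂ g₂ x = glue φ (f₁ - f₂) (g₁ - g₂) x := by
  unfold glue; split_ifs <;> rfl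

lemma refl1_sub (R : Eucl n → Eucl n) (a b : Eucl n → Eucl n →L[ℝ] ℝ) :
    refl1 R a - refl1 R b = refl1 R (a - b) := by
  ext x z
  simp [refl1]
  ring

lemma refl2_sub (R : Eucl n → Eucl n) (a b : Eucl n → Eucl n →L[ℝ] ℝ)
    (a₂ b₂ : Eucl n → Eucl n →L[ℝ] Eucl n →L[ℝ] ℝ) :
    refl2 R a a₂ - refl2 R b b₂ = refl2 R (a - b) (a₂ - b₂) := by
  ext x y z
  simp only [Pi.sub_apply, sub_apply, refl2_apply]
  ring

lemma tendsto_apply₂ {A : ℕ → Eucl n →L[ℝ] Eucl n →L[ℝ] ℝ} {B : Eucl n →L[ℝ] Eucl n →L[ℝ] ℝ}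
    (h : Tendsto A atTop (nhds B)) (y z : Eucl n) :
    Tendsto (fun k => A k y z) atTop (nhds (B y z)) :=
  ((ContinuousLinearMap.apply ℝ ℝ z).continuous.tendsto _).comp
    (((ContinuousLinearMap.apply ℝ (Eucl n →L[ℝ] ℝ) y).continuous.tendsto _).comp h)

/-- Convergence of functions and of their first two derivatives, uniform away from the origin. -/
def JetConverges (Ω : Set (Eucl n)) (u : ℕ → Eucl n → ℝ) (v : Eucl n → ℝ)
    (u' : ℕ → Eucl n → Eucl n →L[ℝ] ℝ) (v' : Eucl n → Eucl n →L[ℝ] ℝ)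
    (u'' : ℕ → Eucl n → Eucl n →L[ℝ] Eucl n →L[ℝ] ℝ)
    (v'' : Eucl n → Eucl n →L[ℝ] Eucl n →L[ℝ] ℝ) : Prop :=
  ∀ d > 0, ∀ η > 0, ∀ᶠ k in atTop, ∀ x ∈ closure Ω, d ≤ ‖x‖ →
    |u k x - v x| ≤ η ∧ ‖u' k x - v' x‖ ≤ η ∧ ‖u'' k x - v'' x‖ ≤ η

namespace JetConverges

lemma tendsto (hc : JetConverges Ω u v u' v' u'' v'') {x : Eucl n} (hx : x ∈ closure Ω \ {0}) :
    Tendsto (fun k => u k x) atTop (nhds (v x)) ∧ Tendsto (fun k => u' k x) atTop (nhds (v' x)) ∧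
      Tendsto (fun k => u'' k x) atTop (nhds (v'' x)) := by
  have hn : 0 < ‖x‖ := norm_pos_iff.2 hx.2
  refine ⟨?_, ?_, ?_⟩ <;> rw [Metric.tendsto_nhds] <;> intro ε hε <;>
    filter_upwards [hc _ hn _ (half_pos hε)] with k hk <;> obtain ⟨h1, h2, h3⟩ := hk x hx.1 le_rfl
  · rw [Real.dist_eq]; linarith
  · rw [dist_eq_norm]; linarith
  · rw [dist_eq_norm]; linarith

lemma hasFDerivWithinAt (hΩ : SmoothDomain Ω) (h0 : (0 : Eucl n) ∈ Ω)
    (hu : ∀ k, DomainJet Ω (u k) (u' k) (u'' k)) (hc : JetConverges Ω u v u' v' u'' v'')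
    {x : Eucl n} (hx : x ∈ closure Ω \ {0}) :
    HasFDerivWithinAt v (v' x) (closure Ω \ {0}) x ∧
      HasFDerivWithinAt v' (v'' x) (closure Ω \ {0}) x := by
  have hxn : 0 < ‖x‖ := norm_pos_iff.2 hx.2
  by_cases hxΩ : x ∈ Ω
  · obtain ⟨ρ, hρ, hb⟩ := Metric.eventually_nhds_iff_ball.1
      ((hΩ.1.eventually_mem hxΩ).and (continuous_norm.continuousAt.eventually_const_lt
      (half_lt_self hxn)))
    have hmem : ∀ y ∈ Metric.ball x ρ, y ∈ Ω \ {0} := fun y hy =>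
      ⟨(hb y hy).1, norm_pos_iff.1 ((half_pos hxn).trans (hb y hy).2)⟩
    have hmem' : ∀ y ∈ Metric.ball x ρ, y ∈ closure Ω \ {0} := fun y hy =>
      ⟨subset_closure (hmem y hy).1, (hmem y hy).2⟩
    constructor
    · refine (hasFDerivAt_of_tendstoUniformlyOn (l := atTop) (f := u) (f' := u') Metric.isOpen_ball
        ?_ (fun k y hy => (hu k).hasFDerivAt hΩ.1 (hmem y hy)) (fun y hy => (hc.tendsto (hmem' y hy)).1)
        (Metric.mem_ball_self hρ)).hasFDerivWithinAt
      refine Metric.tendstoUniformlyOn_iff.2 fun ε hε => ?_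
      filter_upwards [hc _ (half_pos hxn) _ (half_pos hε)] with k hk y hy
      rw [dist_comm, dist_eq_norm]
      linarith [(hk y (hmem' y hy).1 (hb y hy).2.le).2.1]
    · refine (hasFDerivAt_of_tendstoUniformlyOn (l := atTop) (f := u') (f' := u'') Metric.isOpen_ball
        ?_ (fun k y hy => (hu k).hasFDerivAt2 hΩ.1 (hmem y hy))
        (fun y hy => (hc.tendsto (hmem' y hy)).2.1)
        (Metric.mem_ball_self hρ)).hasFDerivWithinAt
      refine Metric.tendstoUniformlyOn_iff.2 fun ε hε => ?_
      filter_upwards [hc _ (half_pos hxn) _ (half_pos hε)] with k hk y hy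
      rw [dist_comm, dist_eq_norm]
      linarith [(hk y (hmem' y hy).1 (hb y hy).2.le).2.2]
  · have hxf : x ∈ frontier Ω := ⟨hx.1, by rwa [hΩ.1.interior_eq]⟩
    obtain ⟨φ, R, ρ₁, ρ₂, K, hch⟩ := exists_bdryChart hΩ h0 hxf
    have hK : 0 < K := zero_lt_one.trans_le hch.one_le
    have hjet := fun k => hch.dirichletJet (hu k)
    have hbound : ∀ η > 0, ∀ᶠ k in atTop,
        DirichletJet.Bound hch.side (u k - v) (u' k - v') (u'' k - v'') η η := fun η hη => by
      filter_upwards [hc _ (half_pos hxn) _ hη] with k hk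
      have hs : ∀ y ∈ hch.side, y ∈ closure Ω ∧ ‖x‖ / 2 ≤ ‖y‖ := fun y hy =>
        ⟨(hch.side_subset hy).1, (hch.half_lt y hy.2).le⟩
      exact ⟨hη.le, fun y hy => (hk y (hs y hy).1 (hs y hy).2).1,
        fun y hy => (hk y (hs y hy).1 (hs y hy).2).2.1,
        fun y hy => (hk y (hs y hy).1 (hs y hy).2).2.2⟩
    have e0 : ∀ k y, glue φ (u k) (fun z => -u k (R z)) y - glue φ v (fun z => -v (R z)) y
        = glue φ (u k - v) (fun z => -(u k - v) (R z)) y := fun k y => by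
      rw [glue_sub]
      congr 1
      funext z
      simp only [Pi.sub_apply]
      ring
    have hval : ∀ y ∈ Metric.ball x ρ₂, Tendsto (fun k => glue φ (u k) (fun z => -u k (R z)) y)
        atTop (nhds (glue φ v (fun z => -v (R z)) y)) := fun y hy => by
      refine Metric.tendsto_nhds.2 fun ε hε => ?_
      filter_upwards [hbound _ (half_pos hε)] with k hk
      rw [Real.dist_eq, e0]
      linarith [hch.norm_reflect_le hk hy]
    have hder : TendstoUniformlyOn (fun k => glue φ (u' k) (refl1 R (u' k)))
        (glue φ v' (refl1 R v')) atTop (Metric.ball x ρ₂) := by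
      refine Metric.tendstoUniformlyOn_iff.2 fun ε hε => ?_
      filter_upwards [hbound (ε / (2 * K)) (by positivity)] with k hk y hy
      rw [dist_comm, dist_eq_norm, glue_sub, refl1_sub]
      refine (hch.norm_reflect1_le hk hy).trans_lt ?_
      rw [show ε / (2 * K) * K = ε / 2 by field_simp]
      linarith
    have hder2 : TendstoUniformlyOn (fun k => glue φ (u'' k) (refl2 R (u' k) (u'' k)))
        (glue φ v'' (refl2 R v' v'')) atTop (Metric.ball x ρ₂) := by
      refine Metric.tendstoUniformlyOn_iff.2 fun ε hε => ?_
      filter_upwards [hbound (ε / (4 * K ^ 2)) (by positivity)] with k hk y hy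
      rw [dist_comm, dist_eq_norm, glue_sub, refl2_sub]
      refine (hch.norm_reflect2_le hk hy).trans_lt ?_
      rw [show 2 * K ^ 2 * (ε / (4 * K ^ 2)) = ε / 2 by field_simp; norm_num]
      linarith
    have hxb : x ∈ Metric.ball x ρ₂ := Metric.mem_ball_self hch.pos
    have h1 := hasFDerivAt_of_tendstoUniformlyOn Metric.isOpen_ball hder
      (fun k y hy => hch.hasFDerivAt_reflect (hjet k) hy) hval hxb
    have h2 := hasFDerivAt_of_tendstoUniformlyOn Metric.isOpen_ball hder2
      (fun k y hy => hch.hasFDerivAt_reflect1 (hjet k) hy)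
      (fun y hy => hder.tendsto_at hy) hxb
    rw [glue_of_nonpos hch.base.le] at h1 h2
    have hS : ∀ᶠ y in nhdsWithin x (closure Ω \ {0}), φ y ≤ 0 := by
      filter_upwards [self_mem_nhdsWithin, mem_nhdsWithin_of_mem_nhds
        (Metric.ball_mem_nhds x (hch.pos.trans_le hch.le))] with y hy hyb
      exact (hch.mem_closure_iff y hyb).1 hy.1
    exact ⟨h1.hasFDerivWithinAt.congr_of_eventuallyEq
        (hS.mono fun y hy => (glue_of_nonpos hy).symm) (glue_of_nonpos hch.base.le).symm,
      h2.hasFDerivWithinAt.congr_of_eventuallyEq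
        (hS.mono fun y hy => (glue_of_nonpos hy).symm) (glue_of_nonpos hch.base.le).symm⟩

/-- The limit of jets vanishing on the boundary, with trace-free second derivatives there, has the
same properties. -/
theorem domainJet (hΩ : SmoothDomain Ω) (h0 : (0 : Eucl n) ∈ Ω)
    (hu : ∀ k, DomainJet Ω (u k) (u' k) (u'' k)) (hc : JetConverges Ω u v u' v' u'' v'') :
    DomainJet Ω v v' v'' where
  deriv x hx := (hc.hasFDerivWithinAt hΩ h0 hu hx).1
  deriv2 x hx := (hc.hasFDerivWithinAt hΩ h0 hu hx).2
  cont x hx := by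
    have hxn : 0 < ‖x‖ := norm_pos_iff.2 hx.2
    have h1 : TendstoUniformlyOn u'' v'' atTop (closure Ω ∩ {y | ‖x‖ / 2 ≤ ‖y‖}) := by
      refine Metric.tendstoUniformlyOn_iff.2 fun ε hε => ?_
      filter_upwards [hc _ (half_pos hxn) _ (half_pos hε)] with k hk y hy
      rw [dist_comm, dist_eq_norm]
      linarith [(hk y hy.1 hy.2).2.2]
    have h2 := h1.continuousOn (Eventually.of_forall fun k =>
      (hu k).cont.mono (annulus_subset (half_pos hxn))).frequently
    refine (h2 x ⟨hx.1, (half_lt_self hxn).le⟩).mono_of_mem_nhdsWithin ?_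
    filter_upwards [self_mem_nhdsWithin, mem_nhdsWithin_of_mem_nhds
      (continuous_norm.continuousAt.eventually_const_lt (half_lt_self hxn))] with y hy hyn
    exact ⟨hy.1, hyn.le⟩
  symm x hx y z := by
    have h1 := (hc.tendsto hx).2.2
    have h2 : ∀ y z : Eucl n, Tendsto (fun k => u'' k x y z) atTop (nhds (v'' x y z)) :=
      fun y z => tendsto_apply₂ h1 y z
    refine tendsto_nhds_unique (h2 y z) ((h2 z y).congr fun k => (hu k).symm x hx z y)
  zero x hx := tendsto_nhds_unique (hc.tendsto (frontier_subset hΩ h0 hx)).1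
    (tendsto_const_nhds.congr fun k => ((hu k).zero x hx).symm)
  trace x hx := by
    have h1 := (hc.tendsto (frontier_subset hΩ h0 hx)).2.2
    have h2 : ∀ y z : Eucl n, Tendsto (fun k => u'' k x y z) atTop (nhds (v'' x y z)) :=
      fun y z => tendsto_apply₂ h1 y z
    refine tendsto_nhds_unique (tendsto_finsetSum _ fun i _ => h2 (bvec i) (bvec i))
      (tendsto_const_nhds.congr fun k => ((hu k).trace x hx).symm)



end JetConverges

namespace DirichletFamily

variable {F₁ F₂ : Eucl n → ℝ} {g g' : ℕ → ℝ → ℝ} (H : DirichletFamily Ω u F₁ F₂ g g')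
include H

/-- A family converging uniformly away from the origin converges with its derivatives. -/
theorem exists_jetConverges [NeZero n]
    (hu : ∀ d > 0, ∀ η > 0, ∀ᶠ k in atTop, ∀ x ∈ closure Ω, d ≤ ‖x‖ → |u k x - v x| ≤ η) :
    ∃ v' v'', JetConverges Ω u v H.du v' H.ddu v'' := by
  have hC : ∀ d > 0, ∀ η > 0, ∃ N : ℕ, ∀ k ≥ N, ∀ l ≥ N, ∀ x ∈ closure Ω, d ≤ ‖x‖ →
      ‖H.du k x - H.du l x‖ + ‖H.ddu k x - H.ddu l x‖ ≤ η := fun d hd η hη => by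
    refine H.exists_deriv_cauchy (fun d hd η hη => ?_) hd hη
    obtain ⟨N, hN⟩ := eventually_atTop.1 (hu d hd _ (half_pos hη))
    refine ⟨N, fun k hk l hl x hx hdx => ?_⟩
    have h1 := hN k hk x hx hdx
    have h2 := hN l hl x hx hdx
    rw [abs_sub_comm] at h2
    linarith [abs_sub_le (u k x) (v x) (u l x)]
  have hlim : ∀ x, ∃ a b, x ∈ closure Ω \ {0} → Tendsto (fun k => H.du k x) atTop (nhds a) ∧
      Tendsto (fun k => H.ddu k x) atTop (nhds b) := fun x => by
    by_cases hx : x ∈ closure Ω \ {0}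
    swap
    · exact ⟨0, 0, fun h => absurd h hx⟩
    have hn : 0 < ‖x‖ := norm_pos_iff.2 hx.2
    obtain ⟨a, ha⟩ := cauchySeq_tendsto_of_complete (u := fun k => H.du k x)
      (Metric.cauchySeq_iff.2 fun ε hε => by
        obtain ⟨N, hN⟩ := hC _ hn _ (half_pos hε)
        refine ⟨N, fun k hk l hl => ?_⟩
        rw [dist_eq_norm]
        linarith [hN k hk l hl x hx.1 le_rfl, norm_nonneg (H.ddu k x - H.ddu l x)])
    obtain ⟨b, hb⟩ := cauchySeq_tendsto_of_complete (u := fun k => H.ddu k x)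
      (Metric.cauchySeq_iff.2 fun ε hε => by
        obtain ⟨N, hN⟩ := hC _ hn _ (half_pos hε)
        refine ⟨N, fun k hk l hl => ?_⟩
        rw [dist_eq_norm]
        linarith [hN k hk l hl x hx.1 le_rfl, norm_nonneg (H.du k x - H.du l x)])
    exact ⟨a, b, fun _ => ⟨ha, hb⟩⟩
  choose v' v'' hv using hlim
  refine ⟨v', v'', fun d hd η hη => ?_⟩
  obtain ⟨N, hN⟩ := hC d hd η hη
  filter_upwards [hu d hd η hη, eventually_ge_atTop N] with k hk hkN x hx hdx
  have hx0 := annulus_subset hd ⟨hx, hdx⟩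
  refine ⟨hk x hx hdx, ?_, ?_⟩
  · refine le_of_tendsto (tendsto_const_nhds.sub (hv x hx0).1).norm ?_
    filter_upwards [eventually_ge_atTop N] with l hl
    linarith [hN k hkN l hl x hx hdx, norm_nonneg (H.ddu k x - H.ddu l x)]
  · refine le_of_tendsto (tendsto_const_nhds.sub (hv x hx0).2).norm ?_
    filter_upwards [eventually_ge_atTop N] with l hl
    linarith [hN k hkN l hl x hx hdx, norm_nonneg (H.du k x - H.du l x)]

lemma lapl_limit_eq {g₀ : ℝ → ℝ}
    (hg : ∀ (t : ℕ → ℝ) t₀, Tendsto t atTop (nhds t₀) →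
      Tendsto (fun k => g k (t k)) atTop (nhds (g₀ t₀)))
    {v' : Eucl n → Eucl n →L[ℝ] ℝ} {v'' : Eucl n → Eucl n →L[ℝ] Eucl n →L[ℝ] ℝ}
    (hc : JetConverges Ω u v H.du v' H.ddu v'') {x : Eucl n} (hx : x ∈ Ω \ {0}) :
    lapl v x = -(F₁ x * v x + F₂ x * g₀ (v x)) := by
  have hxc : x ∈ closure Ω \ {0} := ⟨subset_closure hx.1, hx.2⟩
  have hv := hc.domainJet H.domain H.zero_mem H.jet
  rw [hv.lapl_eq H.domain.1 hx]
  have h1 := (hc.tendsto hxc).1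
  refine tendsto_nhds_unique (tendsto_finsetSum _ fun i _ =>
    tendsto_apply₂ (hc.tendsto hxc).2.2 (bvec i) (bvec i)) ?_
  refine (((h1.const_mul (F₁ x)).add ((hg _ _ h1).const_mul (F₂ x))).neg).congr fun k => ?_
  rw [← H.eqn k x hx, (H.jet k).lapl_eq H.domain.1 hx]

end DirichletFamily

end Limit

section Compactness

variable {n : ℕ} {Ω : Set (Eucl n)} {u : ℕ → Eucl n → ℝ} {F₁ F₂ : Eucl n → ℝ}
  {g g' : ℕ → ℝ → ℝ}

namespace DirichletFamily

lemma comp (H : DirichletFamily Ω u F₁ F₂ g g') (ψ : ℕ → ℕ) :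
    DirichletFamily Ω (fun k => u (ψ k)) F₁ F₂ (fun k => g (ψ k)) (fun k => g' (ψ k)) where
  domain := H.domain
  zero_mem := H.zero_mem
  coeff₁ := H.coeff₁
  coeff₂ := H.coeff₂
  hasDerivAt k := H.hasDerivAt (ψ k)
  map_zero k := H.map_zero (ψ k)
  nonlin_bound B := (H.nonlin_bound B).imp fun _ h k => h (ψ k)
  smooth k := H.smooth (ψ k)
  zero k := H.zero (ψ k)
  eqn k := H.eqn (ψ k)
  bound d hd := (H.bound d hd).imp fun _ h k => h (ψ k)

variable (H : DirichletFamily Ω u F₁ F₂ g g')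
include H

/-- A family controlled uniformly at the origin has a uniformly convergent subsequence. -/
theorem exists_subseq_tendstoUniformlyOn [NeZero n] {δ M : ℝ} (hδ : 0 < δ)
    (hcont : ∀ k, ContinuousOn (u k) (closure Ω))
    (hM : ∀ k x, ‖x‖ ≤ δ → |u k x| ≤ M)
    (hosc : ∀ η > 0, ∃ ρ > 0, ∀ k x, ‖x‖ ≤ ρ → |u k x - u k 0| ≤ η) :
    ∃ (ψ : ℕ → ℕ) (v : Eucl n → ℝ), StrictMono ψ ∧
      TendstoUniformlyOn (fun k => u (ψ k)) v atTop (closure Ω) := by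
  obtain ⟨ψ, hψ, v, hv⟩ := exists_subseq_tendstoLocallyUniformlyOn (S := closure Ω) (f := u)
    (fun x hx => by
      rcases le_or_gt ‖x‖ δ with h | h
      · exact ⟨M, Eventually.of_forall fun k => hM k x h⟩
      · obtain ⟨B, hB⟩ := H.bound δ hδ
        exact ⟨B, Eventually.of_forall fun k => hB k x hx h.le⟩)
    (fun x hx ε hε => by
      by_cases hx0 : x = 0
      · subst hx0
        obtain ⟨ρ, hρ, h⟩ := hosc ε hε
        refine ⟨ρ, hρ, Eventually.of_forall fun k y hy hyx => h k y ?_⟩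
        rw [dist_zero_right] at hyx
        exact hyx.le
      · have hn : 0 < ‖x‖ := norm_pos_iff.2 hx0
        obtain ⟨D, hD⟩ := H.exists_deriv_bound (half_pos hn)
        set N := max D 1
        have hN : 0 < N := lt_max_of_lt_right one_pos
        refine ⟨min (‖x‖ / 2) (ε / N), by positivity, Eventually.of_forall fun k y hy hyx => ?_⟩
        have hball : ∀ z ∈ Metric.ball x (‖x‖ / 2), ‖x‖ / 2 ≤ ‖z‖ := fun z hz => by
          rw [Metric.mem_ball, dist_eq_norm, norm_sub_rev] at hz
          linarith [norm_sub_norm_le x z]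
        have := abs_sub_le_of_zero_frontier (f := u k) H.domain.1 (convex_ball x (‖x‖ / 2)) hN.le
          ((hcont k).mono inter_subset_left)
          (fun z hz => ⟨H.du k z, (H.jet k).hasFDerivAt H.domain.1
            ⟨hz.1, (annulus_subset (half_pos hn) ⟨subset_closure hz.1, hball z hz.2⟩).2⟩,
            ((le_add_of_nonneg_right (norm_nonneg _)).trans
              (hD k z (subset_closure hz.1) (hball z hz.2))).trans (le_max_left _ _)⟩)
          (H.zero k) (x := y) (y := x) ⟨hy, hyx.trans_le (min_le_left _ _)⟩
          ⟨hx, Metric.mem_ball_self (half_pos hn)⟩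
        refine this.trans ?_
        rw [dist_eq_norm] at hyx
        have h2 := (hyx.trans_le (min_le_right _ _)).le
        rw [le_div_iff₀ hN] at h2
        linarith)
  exact ⟨ψ, v, hψ, (tendstoLocallyUniformlyOn_iff_tendstoUniformlyOn_of_compact
    H.domain.isCompact_closure).1 hv⟩

lemma exists_norm_du_le [NeZero n] {A M δ : ℝ} (hδ : 0 < δ) (hδΩ : Metric.ball 0 δ ⊆ Ω)
    (hM : ∀ k x, ‖x‖ ≤ δ / 2 → |u k x| ≤ M)
    (he : ∀ k, ∀ x ∈ Metric.ball (0 : Eucl n) δ, x ≠ 0 → |lapl (u k) x| ≤ A / ‖x‖ ^ 2) :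
    ∃ C, ∀ k, ∀ x ∈ Ω \ {0}, ‖H.du k x‖ ≤ C / ‖x‖ := by
  obtain ⟨C₁, hC₁, h₁⟩ := gradient_estimate n
  obtain ⟨D, hD⟩ := H.exists_deriv_bound (show 0 < δ / 4 by positivity)
  obtain ⟨r₀, hr₀⟩ := H.domain.2.1.exists_norm_le
  refine ⟨max (C₁ * (2 * M + 2 * A)) (D * r₀), fun k x hx => ?_⟩
  have hn : 0 < ‖x‖ := norm_pos_iff.2 hx.2
  rw [le_div_iff₀ hn]
  rcases lt_or_ge ‖x‖ (δ / 4) with h | h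
  · refine le_trans ?_ (le_max_left _ _)
    have hball : ∀ z ∈ Metric.ball x (‖x‖ / 2), ‖x‖ / 2 ≤ ‖z‖ ∧ ‖z‖ ≤ δ / 2 := fun z hz => by
      rw [Metric.mem_ball, dist_eq_norm] at hz
      have h1 := norm_sub_norm_le z x
      rw [norm_sub_rev] at hz
      constructor <;> linarith [norm_sub_norm_le x z, norm_sub_rev x z]
    have hA : 0 ≤ A := by
      have := (abs_nonneg _).trans (he k x (by rw [mem_ball_zero_iff]; linarith) hx.2)
      by_contra hA
      exact absurd this (not_le.2 (div_neg_of_neg_of_pos (not_le.1 hA) (by positivity)))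
    have hmem : ∀ z ∈ Metric.ball x (‖x‖ / 2), z ∈ Metric.ball (0 : Eucl n) δ ∧ z ≠ 0 := fun z hz =>
      ⟨by rw [mem_ball_zero_iff]; linarith [(hball z hz).2],
        norm_pos_iff.1 ((half_pos hn).trans_le (hball z hz).1)⟩
    have := h₁ (u k) x (‖x‖ / 2) M (4 * A / ‖x‖ ^ 2) (half_pos hn)
      ((H.smooth k).mono fun z hz => ⟨subset_closure (hδΩ (hmem z hz).1), (hmem z hz).2⟩)
      (fun z hz => hM k z (hball z hz).2) (fun z hz => by
        refine (he k z (hmem z hz).1 (hmem z hz).2).trans ?_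
        rw [show 4 * A / ‖x‖ ^ 2 = A / (‖x‖ / 2) ^ 2 by field_simp; ring]
        have := (hball z hz).1
        gcongr)
    rw [(H.jet k).fderiv_eq H.domain.1 hx] at this
    refine (mul_le_mul_of_nonneg_right this hn.le).trans (le_of_eq ?_)
    field_simp
    ring
  · refine le_trans ?_ (le_max_right _ _)
    have h1 := (le_add_of_nonneg_right (norm_nonneg _)).trans (hD k x (subset_closure hx.1) h)
    exact mul_le_mul h1 (hr₀ x hx.1) hn.le ((norm_nonneg _).trans h1)

/-- Convergence of the energy. -/
theorem tendsto_energy [NeZero n] (hn : 3 ≤ n) {C : ℝ} {v : Eucl n → ℝ}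
    {v' : Eucl n → Eucl n →L[ℝ] ℝ} {v'' : Eucl n → Eucl n →L[ℝ] Eucl n →L[ℝ] ℝ}
    (hC : ∀ k, ∀ x ∈ Ω \ {0}, ‖H.du k x‖ ≤ C / ‖x‖)
    (hc : JetConverges Ω u v H.du v' H.ddu v'') :
    IntegrableOn (fun x => ‖fderiv ℝ v x‖ ^ 2) Ω ∧
      Tendsto (fun k => ∫ x in Ω, ‖fderiv ℝ (fun y => u k y - v y) x‖ ^ 2) atTop (nhds 0) := by
  have hv := hc.domainJet H.domain H.zero_mem H.jet
  have hΩ := H.domain.1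
  have hv' : ∀ x ∈ Ω \ {0}, ‖v' x‖ ≤ C / ‖x‖ := fun x hx =>
    le_of_tendsto (hc.tendsto ⟨subset_closure hx.1, hx.2⟩).2.1.norm
      (Eventually.of_forall fun k => hC k x hx)
  obtain ⟨r₀, hr₀⟩ := H.domain.2.1.exists_norm_le
  have hInt : ∀ K : ℝ, IntegrableOn (fun x : Eucl n => K * ‖x‖ ^ (-2 : ℝ)) Ω := fun K => by
    have hn' : (3 : ℝ) ≤ n := by exact_mod_cast hn
    have := integrable_indicator_rpow (n := n) (a := -2) (by linarith) K r₀
    rw [integrable_indicator_iff Metric.isClosed_closedBall.measurableSet] at this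
    exact this.mono_set fun x hx => mem_closedBall_zero_iff.2 (hr₀ x hx)
  have hae : ∀ᵐ x : Eucl n ∂volume.restrict Ω, x ∈ Ω \ {0} := by
    filter_upwards [ae_restrict_mem hΩ.measurableSet, ae_restrict_of_ae (ae_ne_zero n)] with x h1 h2
    exact ⟨h1, h2⟩
  have hsq : ∀ (x : Eucl n) (a K : ℝ), x ∈ Ω \ {0} → 0 ≤ a → a ≤ K / ‖x‖ →
      ‖a ^ 2‖ ≤ K ^ 2 * ‖x‖ ^ (-2 : ℝ) := fun x a K hx ha h => by
    rw [Real.norm_of_nonneg (by positivity), Real.rpow_neg (norm_nonneg _), Real.rpow_two,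
      ← div_eq_mul_inv, ← div_pow]
    gcongr
  have hfd : ∀ k, ∀ x ∈ Ω \ {0}, fderiv ℝ (fun y => u k y - v y) x = H.du k x - v' x :=
    fun k x hx => ((H.jet k).sub hv).fderiv_eq hΩ hx
  constructor
  · refine (hInt (C ^ 2)).mono' ((measurable_fderiv ℝ v).norm.pow_const 2).aestronglyMeasurable ?_
    filter_upwards [hae] with x hx
    rw [hv.fderiv_eq hΩ hx]
    exact hsq x _ C hx (norm_nonneg _) (hv' x hx)
  · rw [show (0 : ℝ) = ∫ x in Ω, (0 : ℝ) by simp]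
    refine tendsto_integral_of_dominated_convergence
      (fun x : Eucl n => (2 * C) ^ 2 * ‖x‖ ^ (-2 : ℝ))
      (fun k => ((measurable_fderiv ℝ _).norm.pow_const 2).aestronglyMeasurable) (hInt _)
      (fun k => ?_) ?_
    · filter_upwards [hae] with x hx
      rw [hfd k x hx]
      refine hsq x _ _ hx (norm_nonneg _) ((norm_sub_le _ _).trans ?_)
      rw [show 2 * C / ‖x‖ = C / ‖x‖ + C / ‖x‖ by ring]
      exact add_le_add (hC k x hx) (hv' x hx)
    · filter_upwards [hae] with x hx
      have h1 := (hc.tendsto ⟨subset_closure hx.1, hx.2⟩).2.1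
      have h2 := (h1.sub_const (v' x)).norm.pow 2
      rw [sub_self, norm_zero, zero_pow two_ne_zero] at h2
      exact h2.congr fun k => by rw [hfd k x hx]

/-- Compactness of families whose potential is subcritical at the origin. -/
theorem exists_limit [NeZero n] (hn : 3 ≤ n) {g₀ : ℝ → ℝ} {γ κ A δ : ℝ} (hκ0 : 0 < κ)
    (hκ2 : κ < 2) (hA : 0 ≤ A) (hδ : 0 < δ) (hδ1 : δ ≤ 1) (hδΩ : Metric.ball 0 δ ⊆ Ω)
    (hcont : ∀ k, ContinuousOn (u k) (closure Ω))
    (he : ∀ k, ∀ x ∈ Metric.ball (0 : Eucl n) δ, x ≠ 0 →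
      |lapl (u k) x + γ * u k x / ‖x‖ ^ 2| ≤ A * ‖x‖ ^ (κ - 2) * |u k x|)
    (hg : ∀ (ψ : ℕ → ℕ) (t : ℕ → ℝ) t₀, StrictMono ψ → Tendsto t atTop (nhds t₀) →
      Tendsto (fun k => g (ψ k) (t k)) atTop (nhds (g₀ t₀))) :
    ∃ (ψ : ℕ → ℕ) (v : Eucl n → ℝ), StrictMono ψ ∧ ContinuousOn v (closure Ω) ∧
      ContDiffOn ℝ 2 v (closure Ω \ {0}) ∧ IntegrableOn (fun x => ‖fderiv ℝ v x‖ ^ 2) Ω ∧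
      (∀ x ∈ frontier Ω, v x = 0) ∧
      (∀ x ∈ Ω \ {0}, lapl v x = -(F₁ x * v x + F₂ x * g₀ (v x))) ∧
      Tendsto (fun k => ∫ x in Ω, ‖fderiv ℝ (fun y => u (ψ k) y - v y) x‖ ^ 2) atTop (nhds 0) := by
  obtain ⟨⟨M, hM⟩, hosc⟩ := uniform_control_near_zero hn hκ0 hκ2 hA hδ
    (fun k => (H.smooth k).mono fun x hx => ⟨subset_closure (hδΩ hx.1), hx.2⟩)
    (fun k => (hcont k).mono (hδΩ.trans subset_closure)) he (fun ρ hρ => by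
      obtain ⟨B, hB⟩ := H.bound ρ hρ
      exact ⟨B, fun k x hx hxδ => hB k x
        (subset_closure (hδΩ (mem_ball_zero_iff.2 hxδ))) hx⟩)
  have hδ2 : 0 < δ / 2 := half_pos hδ
  have hM0 : 0 ≤ M := (abs_nonneg _).trans (hM 0 0 (by simpa using hδ2.le))
  obtain ⟨ψ, v, hψ, hv⟩ := H.exists_subseq_tendstoUniformlyOn hδ2 hcont hM hosc
  have hcv : ContinuousOn v (closure Ω) :=
    hv.continuousOn (Eventually.of_forall fun k => hcont (ψ k)).frequently
  have H' := H.comp ψ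
  obtain ⟨v', v'', hc⟩ := H'.exists_jetConverges (v := v) fun d hd η hη => by
    filter_upwards [Metric.tendstoUniformlyOn_iff.1 hv η hη] with k hk x hx _
    rw [abs_sub_comm]
    exact (hk x hx).le
  have hjet := hc.domainJet H.domain H.zero_mem H'.jet
  obtain ⟨C, hC⟩ := H'.exists_norm_du_le (A := (A + |γ|) * M) hδ2
    ((Metric.ball_subset_ball (half_le_self hδ.le)).trans hδΩ) (M := M)
    (fun k x hx => hM (ψ k) x (by linarith)) fun k x hx hx0 => by
      rw [mem_ball_zero_iff] at hx
      have hxp : 0 < ‖x‖ := norm_pos_iff.2 hx0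
      have h1 := he (ψ k) x (mem_ball_zero_iff.2 (by linarith)) hx0
      have h2 := hM (ψ k) x hx.le
      have h3 : ‖x‖ ^ (κ - 2) ≤ 1 / ‖x‖ ^ 2 := by
        rw [one_div, ← Real.rpow_two, ← Real.rpow_neg hxp.le]
        exact Real.rpow_le_rpow_of_exponent_ge hxp (by linarith) (by linarith)
      have h4 : A * ‖x‖ ^ (κ - 2) * |u (ψ k) x| ≤ A * (1 / ‖x‖ ^ 2) * M := by gcongr
      have h5 : |γ * u (ψ k) x / ‖x‖ ^ 2| ≤ |γ| * M / ‖x‖ ^ 2 := by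
        rw [abs_div, abs_mul, abs_of_nonneg (by positivity : 0 ≤ ‖x‖ ^ 2)]
        gcongr
      have h6 := abs_sub (lapl (u (ψ k)) x + γ * u (ψ k) x / ‖x‖ ^ 2) (γ * u (ψ k) x / ‖x‖ ^ 2)
      rw [add_sub_cancel_right] at h6
      calc |lapl (u (ψ k)) x| ≤ A * (1 / ‖x‖ ^ 2) * M + |γ| * M / ‖x‖ ^ 2 := by linarith
        _ = (A + |γ|) * M / ‖x‖ ^ 2 := by ring
  obtain ⟨hInt, hlim⟩ := H'.tendsto_energy hn hC hc
  exact ⟨ψ, v, hψ, hcv, hjet.contDiffOn (H.domain.uniqueDiffOn H.zero_mem), hInt, hjet.zero,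
    fun x hx => H'.lapl_limit_eq (fun t t₀ ht => hg ψ t t₀ hψ ht) hc hx, hlim⟩

end DirichletFamily

end Compactness

section SignedPower

lemma hasDerivAt_abs_rpow_mul {a : ℝ} (ha : 0 < a) (t : ℝ) :
    HasDerivAt (fun t : ℝ => |t| ^ a * t) ((a + 1) * |t| ^ a) t := by
  rcases eq_or_ne t 0 with rfl | ht
  · rw [abs_zero, Real.zero_rpow ha.ne', mul_zero, hasDerivAt_iff_tendsto_slope_zero]
    have h1 : Tendsto (fun t : ℝ => |t| ^ a) (nhds 0) (nhds 0) := by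
      have : Continuous fun t : ℝ => |t| ^ a := continuous_abs.rpow_const fun _ => Or.inr ha.le
      simpa [Real.zero_rpow ha.ne'] using this.tendsto 0
    refine (h1.mono_left nhdsWithin_le_nhds).congr' ?_
    filter_upwards [self_mem_nhdsWithin] with t ht
    have ht' : t ≠ 0 := ht
    simp only [zero_add, abs_zero, mul_zero, sub_zero, smul_eq_mul]
    field_simp
  · have h1 := ((hasDerivAt_abs ht).rpow_const (p := a) (Or.inl (abs_ne_zero.2 ht))).fun_mul
      (hasDerivAt_id t)
    refine h1.congr_deriv ?_
    have h2 : |t| ^ a = |t| ^ (a - 1) * |t| := by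
      rw [← Real.rpow_add_one (abs_ne_zero.2 ht), sub_add_cancel]
    have h3 : (SignType.sign t : ℝ) * t = |t| := sign_mul_self t
    rw [id, h2, ← h3]
    ring

lemma abs_rpow_le_max_rpow {a a' B t : ℝ} (ha : 0 ≤ a) (haa : a ≤ a') (ht : |t| ≤ B) :
    |t| ^ a ≤ max B 1 ^ a' :=
  (Real.rpow_le_rpow (abs_nonneg _) (ht.trans (le_max_left B 1)) ha).trans
    (Real.rpow_le_rpow_of_exponent_le (le_max_right _ _) haa)

end SignedPower

section Coefficients

variable {n : ℕ}

lemma contDiffOn_norm_rpow (a : ℝ) {S : Set (Eucl n)} (hS : (0 : Eucl n) ∉ S) :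
    ContDiffOn ℝ 1 (fun x : Eucl n => ‖x‖ ^ a) S := fun x hx => by
  have hx0 : x ≠ 0 := fun h => hS (h ▸ hx)
  exact ((contDiffAt_norm ℝ hx0).rpow_const_of_ne (norm_ne_zero_iff.2 hx0)).contDiffWithinAt

/-- The equation satisfied by a classical solution, in terms of the trace of the Hessian. -/
lemma ClassicalSolution.lapl_eq {Ω : Set (Eucl n)} {γ q s : ℝ} {h b u : Eucl n → ℝ}
    (hΩ : IsOpen Ω) (hu : ClassicalSolution Ω γ h b q s u) {x : Eucl n} (hx : x ∈ Ω \ {0}) :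
    lapl u x = -((h x + γ / ‖x‖ ^ 2) * u x
      + b x * ‖x‖ ^ (-s) * (|u x| ^ (q - 2) * u x)) := by
  obtain ⟨-, hsm, -, -, he⟩ := hu
  have hc : ContDiffAt ℝ 2 u x := hsm.contDiffAt (DomainJet.mem_nhds_of_mem hΩ hx)
  have h1 := he x hx
  rw [lap_eq_lapl ((hc.fderiv_right (m := 1) (by norm_num)).differentiableAt (by norm_num))] at h1
  have h2 : b x * |u x| ^ (q - 2) * u x / ‖x‖ ^ s
      = b x * ‖x‖ ^ (-s) * (|u x| ^ (q - 2) * u x) := by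
    rw [Real.rpow_neg (norm_nonneg _)]; ring
  rw [h2] at h1
  have h3 : γ * u x / ‖x‖ ^ 2 = γ / ‖x‖ ^ 2 * u x := by ring
  linarith

lemma ClassicalSolution.of_lapl_eq {Ω : Set (Eucl n)} {γ q s : ℝ} {h b u : Eucl n → ℝ}
    (hΩ : IsOpen Ω) (hc : ContinuousOn u (closure Ω)) (hsm : ContDiffOn ℝ 2 u (closure Ω \ {0}))
    (hInt : IntegrableOn (fun x => ‖fderiv ℝ u x‖ ^ 2) Ω) (hz : ∀ x ∈ frontier Ω, u x = 0)
    (he : ∀ x ∈ Ω \ {0}, lapl u x = -((h x + γ / ‖x‖ ^ 2) * u x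
      + b x * ‖x‖ ^ (-s) * (|u x| ^ (q - 2) * u x))) :
    ClassicalSolution Ω γ h b q s u := by
  refine ⟨hc, hsm, hInt, hz, fun x hx => ?_⟩
  have hc : ContDiffAt ℝ 2 u x := hsm.contDiffAt (DomainJet.mem_nhds_of_mem hΩ hx)
  rw [lap_eq_lapl ((hc.fderiv_right (m := 1) (by norm_num)).differentiableAt (by norm_num)), he x hx,
    Real.rpow_neg (norm_nonneg _)]
  ring

/-- The potential of the equation is subcritical at the origin under the weighted bound. -/
lemma exists_subcritical_bound {Ω : Set (Eucl n)} (hΩ : IsOpen Ω) (h0 : (0 : Eucl n) ∈ Ω)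
    {s θ c τ C a : ℝ} (hs2 : s < 2) (hθ2 : θ < 2) (ha : 0 < a)
    (hτ : max τ 0 * a < 2 - s) {h b : Eucl n → ℝ}
    (hhc : Tendsto (fun x : Eucl n => ‖x‖ ^ θ * h x) (nhdsWithin 0 {(0 : Eucl n)}ᶜ) (nhds c))
    (hb : ContinuousAt b 0) :
    ∃ κ A δ : ℝ, 0 < κ ∧ κ < 2 ∧ 0 ≤ A ∧ 0 < δ ∧ δ ≤ 1 ∧ Metric.ball 0 δ ⊆ Ω ∧
      ∀ x ∈ Metric.ball (0 : Eucl n) δ, x ≠ 0 → ∀ a' t : ℝ, 0 < a' → a' ≤ a →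
        ‖x‖ ^ τ * |t| ≤ C →
        |h x * t + b x * ‖x‖ ^ (-s) * (|t| ^ a' * t)| ≤ A * ‖x‖ ^ (κ - 2) * |t| := by
  have h1 : ∀ᶠ x in nhdsWithin (0 : Eucl n) {0}ᶜ, |‖x‖ ^ θ * h x| < |c| + 1 :=
    hhc.abs.eventually_lt_const (lt_add_one _)
  rw [eventually_nhdsWithin_iff] at h1
  have h2 : ∀ᶠ x in nhds (0 : Eucl n), |b x| < |b 0| + 1 :=
    hb.abs.eventually_lt_const (lt_add_one _)
  obtain ⟨δ₀, hδ₀, hball⟩ := Metric.eventually_nhds_iff_ball.1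
    ((h1.and h2).and (hΩ.eventually_mem h0))
  set T := max τ 0
  have hT0 : 0 ≤ T := le_max_right _ _
  set C₁ := max C 1
  have hC₁ : 1 ≤ C₁ := le_max_right _ _
  set κ := min 1 (min (2 - θ) (2 - s - T * a)) with hκ
  have hκ1 : κ ≤ 2 - θ := (min_le_right _ _).trans (min_le_left _ _)
  have hκ2 : κ ≤ 2 - s - T * a := (min_le_right _ _).trans (min_le_right _ _)
  refine ⟨κ, (|c| + 1) + (|b 0| + 1) * C₁ ^ a, min δ₀ 1,
    lt_min one_pos (lt_min (by linarith) (by linarith)),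
    (min_le_left _ _).trans_lt one_lt_two, by positivity, by positivity, min_le_right _ _,
    fun x hx => (hball x (Metric.ball_subset_ball (min_le_left _ _) hx)).2,
    fun x hx hx0 a' t ha' haa ht => ?_⟩
  obtain ⟨⟨hx1, hx2⟩, -⟩ := hball x (Metric.ball_subset_ball (min_le_left _ _) hx)
  rw [mem_ball_zero_iff] at hx
  have hxp : 0 < ‖x‖ := norm_pos_iff.2 hx0
  have hxle : ‖x‖ ≤ 1 := (hx.trans_le (min_le_right _ _)).le
  have hmono : ∀ {α β : ℝ}, β ≤ α → ‖x‖ ^ α ≤ ‖x‖ ^ β := fun h =>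
    Real.rpow_le_rpow_of_exponent_ge hxp hxle h
  have e1 : |h x| ≤ (|c| + 1) * ‖x‖ ^ (κ - 2) := by
    have := (hx1 hx0).le
    rw [abs_mul, abs_of_pos (by positivity : 0 < ‖x‖ ^ θ)] at this
    have e2 : |h x| = ‖x‖ ^ (-θ) * (‖x‖ ^ θ * |h x|) := by
      rw [← mul_assoc, ← Real.rpow_add hxp, neg_add_cancel, Real.rpow_zero, one_mul]
    rw [e2, mul_comm]
    exact mul_le_mul this (hmono (by linarith)) (by positivity) (by positivity)
  have e3 : |t| ≤ C₁ * ‖x‖ ^ (-T) := by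
    have e4 : |t| = (‖x‖ ^ τ * |t|) * ‖x‖ ^ (-τ) := by
      rw [mul_right_comm, ← Real.rpow_add hxp, add_neg_cancel, Real.rpow_zero, one_mul]
    rw [e4]
    exact mul_le_mul (ht.trans (le_max_left _ _)) (hmono (neg_le_neg (le_max_left _ _)))
      (by positivity) (by positivity)
  have e5 : |t| ^ a' ≤ C₁ ^ a * ‖x‖ ^ (-(T * a)) := by
    have e6 : 1 ≤ ‖x‖ ^ (-T) := Real.one_le_rpow_of_pos_of_le_one_of_nonpos hxp hxle (by linarith)
    have e7 : 1 ≤ C₁ * ‖x‖ ^ (-T) := one_le_mul_of_one_le_of_one_le hC₁ e6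
    refine ((Real.rpow_le_rpow (abs_nonneg _) e3 ha'.le).trans
      (Real.rpow_le_rpow_of_exponent_le e7 haa)).trans_eq ?_
    rw [Real.mul_rpow (by positivity) (by positivity), ← Real.rpow_mul hxp.le, neg_mul]
  have e8 : |b x| * (‖x‖ ^ (-s) * |t| ^ a') ≤ (|b 0| + 1) * (C₁ ^ a * ‖x‖ ^ (κ - 2)) := by
    refine mul_le_mul hx2.le ?_ (by positivity) (by positivity)
    calc ‖x‖ ^ (-s) * |t| ^ a' ≤ ‖x‖ ^ (-s) * (C₁ ^ a * ‖x‖ ^ (-(T * a))) := by gcongr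
      _ = C₁ ^ a * ‖x‖ ^ (-s + -(T * a)) := by rw [Real.rpow_add hxp]; ring
      _ ≤ C₁ ^ a * ‖x‖ ^ (κ - 2) :=
        mul_le_mul_of_nonneg_left (hmono (by linarith)) (by positivity)
  calc |h x * t + b x * ‖x‖ ^ (-s) * (|t| ^ a' * t)|
      = |(h x + b x * (‖x‖ ^ (-s) * |t| ^ a')) * t| := by congr 1; ring
    _ = |h x + b x * (‖x‖ ^ (-s) * |t| ^ a')| * |t| := abs_mul _ _
    _ ≤ (|h x| + |b x| * (‖x‖ ^ (-s) * |t| ^ a')) * |t| := by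
        gcongr
        refine (abs_add_le _ _).trans_eq ?_
        rw [abs_mul (b x), abs_of_nonneg (by positivity : 0 ≤ ‖x‖ ^ (-s) * |t| ^ a')]
    _ ≤ _ := by
        gcongr
        linarith

end Coefficients

/-- Compactness under a uniform weighted pointwise bound. -/
theorem stmt_13 (n : ℕ) (hn : 3 ≤ n)
    (Ω : Set (EuclideanSpace ℝ (Fin n))) (hΩ : SmoothDomain Ω)
    (h0 : (0 : EuclideanSpace ℝ (Fin n)) ∈ Ω)
    (s : ℝ) (hs0 : 0 < s) (hs2 : s < 2)
    (γ : ℝ) (hγ : γ < ((n : ℝ) - 2) ^ 2 / 4)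
    (θ c : ℝ) (hθ0 : 0 ≤ θ) (hθ2 : θ < 2)
    (h : EuclideanSpace ℝ (Fin n) → ℝ)
    (hh : ContDiffOn ℝ 1 h (closure Ω \ {0}))
    (hhc : Tendsto (fun x : EuclideanSpace ℝ (Fin n) => ‖x‖ ^ θ * h x)
      (nhdsWithin 0 {(0 : EuclideanSpace ℝ (Fin n))}ᶜ) (nhds c))
    (hhd : Tendsto (fun x : EuclideanSpace ℝ (Fin n) => ‖x‖ ^ θ * fderiv ℝ h x x)
      (nhdsWithin 0 {(0 : EuclideanSpace ℝ (Fin n))}ᶜ) (nhds (-c * θ)))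
    (hcoer : CoerciveOn Ω γ h)
    (b : EuclideanSpace ℝ (Fin n) → ℝ)
    (hb : ContDiffOn ℝ 1 b (closure Ω)) (hbnn : ∀ x ∈ closure Ω, 0 ≤ b x)
    (hb0 : 0 < b 0) (hbd : fderiv ℝ b 0 = 0)
    (p : ℝ → ℝ)
    (hp : ∀ ε : ℝ, 0 < ε → 0 ≤ p ε ∧ p ε < 2 * ((n : ℝ) - s) / ((n : ℝ) - 2) - 2)
    (hp0 : Tendsto p (nhdsWithin 0 (Set.Ioi 0)) (nhds 0))
    (u : ℝ → EuclideanSpace ℝ (Fin n) → ℝ)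
    (hsol : ∀ ε : ℝ, 0 < ε →
      ClassicalSolution Ω γ h b (2 * ((n : ℝ) - s) / ((n : ℝ) - 2) - p ε) s (u ε))
    (Λ : ℝ) (hΛ : ∀ ε : ℝ, 0 < ε → ∫ x in Ω, ‖fderiv ℝ (u ε) x‖ ^ 2 ≤ Λ)
    (τ : ℝ)
    (hτ1 : ((n : ℝ) - 2) / 2 - Real.sqrt (((n : ℝ) - 2) ^ 2 / 4 - γ) < τ)
    (hτ2 : τ < ((n : ℝ) - 2) / 2)
    (C : ℝ) (hC : ∀ ε : ℝ, 0 < ε → ∀ x ∈ Ω \ {0}, ‖x‖ ^ τ * |u ε x| ≤ C) :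
    ∃ (εk : ℕ → ℝ) (u₀ : EuclideanSpace ℝ (Fin n) → ℝ),
      (∀ k, 0 < εk k) ∧ Tendsto εk atTop (nhds 0) ∧
      ClassicalSolution Ω γ h b (2 * ((n : ℝ) - s) / ((n : ℝ) - 2)) s u₀ ∧
      Tendsto (fun k => ∫ x in Ω, ‖fderiv ℝ (fun y => u (εk k) y - u₀ y) x‖ ^ 2)
        atTop (nhds 0) := by
  have : NeZero n := ⟨by omega⟩
  have hn' : (3 : ℝ) ≤ n := by exact_mod_cast hn
  set a := 2 * ((n : ℝ) - s) / ((n : ℝ) - 2) - 2 with ha_def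
  have ha_eq : a * ((n : ℝ) - 2) = 2 * (2 - s) := by
    rw [ha_def, sub_mul, div_mul_cancel₀ _ (by linarith)]
    ring
  have ha : 0 < a := by
    by_contra h
    nlinarith
  set e : ℕ → ℝ := fun k => 1 / ((k : ℝ) + 1) with he_def
  have he0 : ∀ k, 0 < e k := fun k => by positivity
  have he : Tendsto e atTop (nhds 0) := tendsto_one_div_add_atTop_nhds_zero_nat
  have hpe : Tendsto (fun k => p (e k)) atTop (nhds 0) :=
    hp0.comp (tendsto_nhdsWithin_iff.2 ⟨he, Eventually.of_forall he0⟩)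
  set α : ℕ → ℝ := fun k => a - p (e k) with hα_def
  have hα0 : ∀ k, 0 < α k := fun k => sub_pos.2 (hp _ (he0 k)).2
  have hαa : ∀ k, α k ≤ a := fun k => sub_le_self _ (hp _ (he0 k)).1
  have hα : Tendsto α atTop (nhds a) := by simpa using tendsto_const_nhds.sub hpe
  have hq : ∀ k, 2 * ((n : ℝ) - s) / ((n : ℝ) - 2) - p (e k) - 2 = α k := fun k => by
    rw [hα_def, ha_def]
    ring
  have heq : ∀ k, ∀ x ∈ Ω \ {0}, lapl (u (e k)) x = -((h x + γ / ‖x‖ ^ 2) * u (e k) x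
      + b x * ‖x‖ ^ (-s) * (|u (e k) x| ^ α k * u (e k) x)) := fun k x hx => by
    rw [← hq k]
    exact (hsol _ (he0 k)).lapl_eq hΩ.1 hx
  have hsub : closure Ω \ {(0 : Eucl n)} ⊆ {0}ᶜ := fun x hx => hx.2
  have hzero : (0 : Eucl n) ∉ closure Ω \ {(0 : Eucl n)} := fun h => h.2 rfl
  have hfront : ∀ x ∈ closure Ω, x ∉ Ω → x ∈ frontier Ω := fun x hx hxΩ =>
    ⟨hx, by rwa [hΩ.1.interior_eq]⟩
  have H : DirichletFamily Ω (fun k => u (e k)) (fun x => h x + γ / ‖x‖ ^ 2)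
      (fun x => b x * ‖x‖ ^ (-s)) (fun k t => |t| ^ α k * t) (fun k t => (α k + 1) * |t| ^ α k) :=
    { domain := hΩ
      zero_mem := h0
      coeff₁ := hh.add (contDiffOn_const.div (contDiff_norm_sq ℝ).contDiffOn fun x hx =>
        pow_ne_zero 2 (norm_ne_zero_iff.2 (hsub hx)))
      coeff₂ := (hb.mono diff_subset).mul (contDiffOn_norm_rpow _ hzero)
      hasDerivAt := fun k t => hasDerivAt_abs_rpow_mul (hα0 k) t
      map_zero := fun k => mul_zero _
      nonlin_bound := fun B => by
        refine ⟨max (max B 1 ^ a * max B 1) ((a + 1) * max B 1 ^ a), fun k t ht => ⟨?_, ?_⟩⟩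
        · refine le_trans ?_ (le_max_left _ _)
          rw [abs_mul, abs_of_nonneg (by positivity : 0 ≤ |t| ^ α k)]
          exact mul_le_mul (abs_rpow_le_max_rpow (hα0 k).le (hαa k) ht) (ht.trans (le_max_left _ _))
            (abs_nonneg _) (by positivity)
        · refine le_trans ?_ (le_max_right _ _)
          have h1 := hα0 k
          rw [abs_of_nonneg (by positivity)]
          exact mul_le_mul (by linarith [hαa k]) (abs_rpow_le_max_rpow h1.le (hαa k) ht)
            (by positivity) (by positivity)
      smooth := fun k => (hsol _ (he0 k)).2.1
      zero := fun k => (hsol _ (he0 k)).2.2.2.1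
      eqn := heq
      bound := fun d hd => by
        obtain ⟨B, hB⟩ := (hΩ.isCompact_annulus d).exists_bound_of_continuousOn
          ((contDiffOn_norm_rpow (-τ) hzero).continuousOn.mono (annulus_subset hd))
        refine ⟨max C 0 * max B 0, fun k x hx hdx => ?_⟩
        have hx0 : x ≠ 0 := (annulus_subset hd ⟨hx, hdx⟩).2
        have hxp : 0 < ‖x‖ := norm_pos_iff.2 hx0
        by_cases hxΩ : x ∈ Ω
        · have h1 := hB x ⟨hx, hdx⟩
          rw [Real.norm_of_nonneg (by positivity)] at h1
          have h2 : |u (e k) x| = (‖x‖ ^ τ * |u (e k) x|) * ‖x‖ ^ (-τ) := by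
            rw [mul_right_comm, ← Real.rpow_add hxp, add_neg_cancel, Real.rpow_zero, one_mul]
          rw [h2]
          exact mul_le_mul ((hC _ (he0 k) x ⟨hxΩ, hx0⟩).trans (le_max_left _ _))
            (h1.trans (le_max_left _ _)) (by positivity) (le_max_right _ _)
        · rw [(hsol _ (he0 k)).2.2.2.1 x (hfront x hx hxΩ), abs_zero]
          positivity }
  obtain ⟨κ, A, δ, hκ0, hκ2, hA, hδ, hδ1, hδΩ, hsc⟩ :=
    exists_subcritical_bound (C := C) hΩ.1 h0 hs2 hθ2 ha (τ := τ) (by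
      rw [max_mul_of_nonneg _ _ ha.le, zero_mul]
      refine max_lt ?_ (by linarith)
      nlinarith) hhc
      ((hb.continuousOn 0 (subset_closure h0)).continuousAt
        (mem_of_superset (hΩ.1.mem_nhds h0) subset_closure))
  obtain ⟨ψ, v, hψ, hvc, hvs, hvi, hvz, hve, hlim⟩ := H.exists_limit hn
    (g₀ := fun t => |t| ^ a * t) (γ := γ) hκ0 hκ2 hA hδ hδ1 hδΩ (fun k => (hsol _ (he0 k)).1)
    (fun k x hx hx0 => by
      have hxΩ : x ∈ Ω \ {0} := ⟨hδΩ hx, hx0⟩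
      have h1 := hsc x hx hx0 (α k) (u (e k) x) (hα0 k) (hαa k) (hC _ (he0 k) x hxΩ)
      rw [heq k x hxΩ]
      rw [← abs_neg] at h1
      refine le_trans (le_of_eq ?_) h1
      congr 1
      ring)
    (fun ψ t t₀ hψ ht =>
      (ht.abs.rpow (hα.comp hψ.tendsto_atTop) (Or.inr ha)).mul ht)
  exact ⟨fun k => e (ψ k), v, fun k => he0 _, he.comp hψ.tendsto_atTop,
    ClassicalSolution.of_lapl_eq hΩ.1 hvc hvs hvi hvz hve, hlim⟩
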